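/- For every real t with |t| ≥ 2 and every real β with β ≥ 1 − 1/(5.558691 · log|t|), one has ζ(β + it) ≠ 0. -/

import Mathlib

open Complex Filter Topology Metric Set MeasureTheory ComplexConjugate

theorem exists_entire_div_pow {g : ℂ → ℂ} (hg : Differentiable ℂ g) (r : ℂ)
    (hr : analyticOrderAt g r ≠ ⊤) :
    ∃ q : ℂ → ℂ, Differentiable ℂ q ∧ q r ≠ 0 ∧
      ∀ w, g w = (w - r) ^ analyticOrderNatAt g r * q w := by
  have han : AnalyticAt ℂ g r := hg.analyticAt r
  obtain ⟨p, hp, hpr, hloc⟩ := han.analyticOrderAt_ne_top.mp hr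
  set n := analyticOrderNatAt g r
  set q : ℂ → ℂ := Function.update (fun w ↦ g w / (w - r) ^ n) r (p r) with hq
  have hqne : ∀ w, w ≠ r → q w = g w / (w - r) ^ n := fun w hw ↦ by simp [hq, hw]
  have hqr : q r = p r := by simp [hq]
  have hfac : ∀ w, w ≠ r → g w = (w - r) ^ n * q w := fun w hw ↦ by
    rw [hqne w hw, mul_div_cancel₀ _ (pow_ne_zero _ (sub_ne_zero.mpr hw))]
  refine ⟨q, fun w ↦ ?_, hqr ▸ hpr, fun w ↦ ?_⟩
  · by_cases hw : w = r
    · subst hw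
      refine hp.differentiableAt.congr_of_eventuallyEq ?_
      filter_upwards [hloc] with z hz
      by_cases hzw : z = w
      · rw [hzw, hqr]
      · rw [hqne z hzw, hz, smul_eq_mul, mul_div_cancel_left₀ _ (pow_ne_zero _ (sub_ne_zero.mpr hzw))]
    · have : DifferentiableAt ℂ (fun w ↦ g w / (w - r) ^ n) w :=
        (hg w).fun_div (by fun_prop) (pow_ne_zero _ (sub_ne_zero.mpr hw))
      refine this.congr_of_eventuallyEq ?_
      filter_upwards [isOpen_ne.mem_nhds hw] with z hz
      exact hqne z hz
  · by_cases hw : w = r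
    · subst hw
      rw [hqr]
      simpa using hloc.self_of_nhds
    · exact hfac w hw

theorem exists_entire_factorization {F : ℂ → ℂ} (hF : Differentiable ℂ F)
    (h : ∀ r, analyticOrderAt F r ≠ ⊤) (S : Finset ℂ) :
    ∃ g : ℂ → ℂ, Differentiable ℂ g ∧ (∀ r ∈ S, g r ≠ 0) ∧
      ∀ w, F w = (∏ r ∈ S, (w - r) ^ analyticOrderNatAt F r) * g w := by
  classical
  induction S using Finset.induction_on with
  | empty => exact ⟨F, hF, by simp, by simp⟩
  | insert a S ha ih =>
    obtain ⟨g, hg, hgS, hfac⟩ := ih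
    have hP : Differentiable ℂ (fun w ↦ ∏ r ∈ S, (w - r) ^ analyticOrderNatAt F r) := by
      fun_prop
    have hPa : (∏ r ∈ S, (a - r) ^ analyticOrderNatAt F r) ≠ 0 :=
      Finset.prod_ne_zero_iff.mpr fun r hr ↦ pow_ne_zero _
        (sub_ne_zero.mpr fun h ↦ ha (h ▸ hr))
    have hord : analyticOrderAt F a = analyticOrderAt g a := by
      have : F = (fun w ↦ ∏ r ∈ S, (w - r) ^ analyticOrderNatAt F r) * g := funext hfac
      rw [this, analyticOrderAt_mul (hP.analyticAt a) (hg.analyticAt a),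
        (hP.analyticAt a).analyticOrderAt_eq_zero.mpr hPa, zero_add]
    obtain ⟨q, hq, hqa, hgq⟩ := exists_entire_div_pow hg a (hord ▸ h a)
    have hn : analyticOrderNatAt g a = analyticOrderNatAt F a := by
      simp [analyticOrderNatAt, hord]
    refine ⟨q, hq, fun r hr ↦ ?_, fun w ↦ ?_⟩
    · rcases Finset.mem_insert.mp hr with rfl | hr
      · exact hqa
      · intro h0
        exact hgS r hr (by rw [hgq, h0, mul_zero])
    · rw [hfac, hgq, Finset.prod_insert ha, hn]
      ring

theorem norm_logDeriv_sub_le_of_bound {g : ℂ → ℂ} {R M : ℝ} (hR : 0 < R) (hM : 0 < M)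
    (hg : Differentiable ℂ g) (hg0 : ∀ w ∈ ball (0 : ℂ) R, g w ≠ 0)
    (hb : ∀ w ∈ ball (0 : ℂ) R, ‖g w‖ ≤ ‖g 0‖ * Real.exp M) {w : ℂ} (hw : ‖w‖ < R / 8) :
    ‖logDeriv g w - logDeriv g 0‖ ≤ 64 * M * ‖w‖ / R ^ 2 := by
  have hd : DifferentiableOn ℂ (logDeriv g) (ball 0 R) := by
    intro z hz
    have : DifferentiableAt ℂ (fun z ↦ deriv g z / g z) z :=
      (hg.deriv z).fun_div (hg z) (hg0 z hz)
    exact this.differentiableWithinAt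
  obtain ⟨h, h00, hh⟩ := hd.isExactOn_ball.with_val_at 0 0
  have h0R : (0 : ℂ) ∈ ball (0 : ℂ) R := by simpa using hR
  have hexp : ∀ z ∈ ball (0 : ℂ) R, exp (h z) * g 0 = g z := by
    have key : ∀ z ∈ ball (0 : ℂ) R, HasDerivAt (fun z ↦ g z * exp (-h z)) 0 z := by
      intro z hz
      have hgz := hg0 z hz
      refine ((hg z).hasDerivAt.mul ((hh z hz).neg.cexp)).congr_deriv ?_
      rw [logDeriv_apply]
      field_simp
      ring
    intro z hz
    have hc := (convex_ball (0 : ℂ) R).is_const_of_fderivWithin_eq_zero (𝕜 := ℂ)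
      (f := fun z ↦ g z * exp (-h z))
      (fun z hz ↦ (key z hz).differentiableAt.differentiableWithinAt)
      (fun z hz ↦ by
        rw [fderivWithin_of_isOpen isOpen_ball hz]
        have := (key z hz).hasFDerivAt.fderiv
        rw [this]; ext; simp) hz h0R
    simp only [h00, neg_zero, Complex.exp_zero, mul_one] at hc
    rw [← hc, mul_comm, mul_assoc, ← Complex.exp_add]
    simp
  have hre : MapsTo h (ball 0 R) {z | z.re ≤ M} := by
    intro z hz
    have h1 := hb z hz
    rw [← hexp z hz, norm_mul, mul_comm, Complex.norm_exp] at h1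
    have := le_of_mul_le_mul_left h1 (norm_pos_iff.mpr (hg0 0 h0R))
    simpa using Real.exp_le_exp.mp this
  have hhd : DifferentiableOn ℂ h (ball 0 R) :=
    fun z hz ↦ (hh z hz).differentiableAt.differentiableWithinAt
  have hbd : ∀ z : ℂ, ‖z‖ ≤ R / 2 → ‖h z‖ ≤ 2 * M := by
    intro z hz
    have hzR : z ∈ ball (0 : ℂ) R := by rw [mem_ball_zero_iff]; linarith
    refine (borelCaratheodory_zero hM hhd hre hR hzR h00).trans ?_
    rw [div_le_iff₀ (by linarith)]
    nlinarith
  have hd1 : ∀ z : ℂ, ‖z‖ ≤ R / 4 → ‖logDeriv g z‖ ≤ 2 * M / (R / 4) := by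
    intro z hz
    have hzR : z ∈ ball (0 : ℂ) R := by rw [mem_ball_zero_iff]; linarith
    rw [← (hh z hzR).deriv]
    refine norm_deriv_le_of_forall_mem_sphere_norm_le (by positivity) ?_ ?_
    · refine DifferentiableOn.diffContOnCl (hhd.mono ?_)
      rw [closure_ball _ (by positivity)]
      intro y hy
      rw [mem_ball_zero_iff]
      have h1 := norm_sub_norm_le y z
      rw [mem_closedBall, dist_eq_norm] at hy
      linarith
    · intro y hy
      apply hbd
      rw [mem_sphere, dist_eq_norm] at hy
      have h1 := norm_sub_norm_le y z
      linarith
  have hd2 : ∀ z ∈ ball (0 : ℂ) (R / 8), ‖deriv (logDeriv g) z‖ ≤ 64 * M / R ^ 2 := by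
    intro z hz
    rw [mem_ball_zero_iff] at hz
    have : ‖deriv (logDeriv g) z‖ ≤ 2 * M / (R / 4) / (R / 8) := by
      refine norm_deriv_le_of_forall_mem_sphere_norm_le (by positivity) ?_ ?_
      · refine DifferentiableOn.diffContOnCl (hd.mono ?_)
        rw [closure_ball _ (by positivity)]
        intro y hy
        rw [mem_ball_zero_iff]
        have h1 := norm_sub_norm_le y z
        rw [mem_closedBall, dist_eq_norm] at hy
        linarith
      · intro y hy
        apply hd1
        rw [mem_sphere, dist_eq_norm] at hy
        have h1 := norm_sub_norm_le y z
        linarith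
    refine this.trans_eq ?_
    field_simp
    ring
  have := (convex_ball (0 : ℂ) (R / 8)).norm_image_sub_le_of_norm_deriv_le (𝕜 := ℂ)
    (f := logDeriv g) (C := 64 * M / R ^ 2) (x := 0) (y := w)
    (fun z hz ↦ hd.differentiableAt (isOpen_ball.mem_nhds (by
      rw [mem_ball_zero_iff] at hz ⊢; linarith))) hd2
    (by simpa using hR) (by simpa using hw)
  rw [sub_zero] at this
  refine this.trans_eq ?_
  ring

theorem entire_zeros_inter_compact_finite {F : ℂ → ℂ} (hF : Differentiable ℂ F) {x : ℂ}
    (hx : F x ≠ 0) {K : Set ℂ} (hK : IsCompact K) : (K ∩ F ⁻¹' {0}).Finite := by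
  have han : AnalyticOnNhd ℂ F univ := fun z _ ↦ hF.analyticAt z
  have hcod : (F ⁻¹' {0})ᶜ ∈ codiscrete ℂ :=
    han.preimage_zero_mem_codiscreteWithin hx (mem_univ x) isConnected_univ
  obtain ⟨hc, hd⟩ := mem_codiscrete'.mp hcod
  rw [compl_compl] at hd
  have hcl : IsClosed (F ⁻¹' {0}) := by simpa using hc
  exact (hK.inter_right hcl).finite (hd.mono inter_subset_right)

theorem entire_analyticOrderAt_ne_top {F : ℂ → ℂ} (hF : Differentiable ℂ F) {x : ℂ}
    (hx : F x ≠ 0) (r : ℂ) : analyticOrderAt F r ≠ ⊤ := by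
  intro h
  have han : AnalyticOnNhd ℂ F univ := fun z _ ↦ hF.analyticAt z
  exact hx (han.eqOn_zero_of_preconnected_of_eventuallyEq_zero isPreconnected_univ
    (mem_univ r) (analyticOrderAt_eq_top.mp h) (mem_univ x))

theorem logDeriv_prod_pow_mul {S : Finset ℂ} {m : ℂ → ℕ} {g : ℂ → ℂ} (hg : Differentiable ℂ g)
    {w : ℂ} (hS : ∀ r ∈ S, w ≠ r) (hgw : g w ≠ 0) :
    logDeriv (fun z ↦ (∏ r ∈ S, (z - r) ^ m r) * g z) w =
      ∑ r ∈ S, (m r : ℂ) * (1 / (w - r)) + logDeriv g w := by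
  have hne : ∀ r ∈ S, (w - r) ^ m r ≠ 0 := fun r hr ↦ pow_ne_zero _ (sub_ne_zero.mpr (hS r hr))
  have hp : (∏ r ∈ S, (w - r) ^ m r) ≠ 0 := Finset.prod_ne_zero_iff.mpr hne
  rw [logDeriv_mul (f := fun z ↦ ∏ r ∈ S, (z - r) ^ m r) w hp hgw (by fun_prop) (hg w)]
  congr 1
  have := logDeriv_prod (s := S) (f := fun r z ↦ (z - r) ^ m r) (x := w) hne
    (fun r _ ↦ by fun_prop)
  rw [show (fun z ↦ ∏ r ∈ S, (z - r) ^ m r) = ∏ r ∈ S, fun z ↦ (z - r) ^ m r by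
    ext z; simp] 
  rw [show (∏ r ∈ S, fun z ↦ (z - r) ^ m r) = fun z ↦ ∏ r ∈ S, (z - r) ^ m r by
    ext z; simp]
  rw [this]
  refine Finset.sum_congr rfl fun r _ ↦ ?_
  rw [logDeriv_fun_pow (by fun_prop), logDeriv_apply]
  simp

theorem logDeriv_neg_conj {F : ℂ → ℂ} (hF : Differentiable ℂ F)
    (hsym : ∀ w, F (-conj w) = conj (F w)) (w : ℂ) :
    logDeriv F (-conj w) = -conj (logDeriv F w) := by
  have h1 : F = fun z ↦ (conj ∘ F ∘ conj) (-z) := by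
    ext z
    simp [← hsym, map_neg]
  have h2 : HasDerivAt (conj ∘ F ∘ conj) (conj (deriv F w)) (conj w) :=
    (hF w).hasDerivAt.conj_conj
  have h3 : HasDerivAt F (-(conj (deriv F w))) (-conj w) := by
    have h4 : HasDerivAt (conj ∘ F ∘ conj) (conj (deriv F w)) (-(-conj w)) := by
      rwa [neg_neg]
    have h5 := h4.scomp (-conj w) (hasDerivAt_neg (-conj w))
    refine (h5.congr_deriv (by simp)).congr_of_eventuallyEq (Eventually.of_forall fun z ↦ ?_)
    exact congrFun h1 z
  rw [logDeriv_apply, logDeriv_apply, h3.deriv, hsym, map_div₀, neg_div]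

theorem exists_finset_tendsto_sum_add_logDeriv {F : ℂ → ℂ} (hF : Differentiable ℂ F)
    {x : ℂ} (hx : F x ≠ 0) {A : ℝ → ℝ}
    (hApos : ∀ R, 0 < A R)
    (hA : ∀ R w, ‖w‖ ≤ R → ‖F w‖ ≤ ‖F x‖ * Real.exp (A R))
    (hA' : Tendsto (fun R ↦ A R / R ^ 2) atTop (𝓝 0)) :
    ∃ (S : ℕ → Finset ℂ) (G : ℕ → ℂ), (∀ n r, r ∈ S n ↔ F r = 0 ∧ ‖r‖ ≤ n) ∧
      ∀ w, F w ≠ 0 → Tendsto (fun n ↦ ∑ r ∈ S n, (analyticOrderNatAt F r : ℂ) *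
        (1 / (w - r)) + G n) atTop (𝓝 (logDeriv F w)) := by
  have hfin : ∀ n : ℕ, (closedBall (0 : ℂ) n ∩ F ⁻¹' {0}).Finite := fun n ↦
    entire_zeros_inter_compact_finite hF hx (isCompact_closedBall _ _)
  set S : ℕ → Finset ℂ := fun n ↦ (hfin n).toFinset
  have hS : ∀ n r, r ∈ S n ↔ F r = 0 ∧ ‖r‖ ≤ n := by
    intro n r
    simp [S, and_comm]
  set m := analyticOrderNatAt F
  choose g hg hgS hfac using fun n ↦
    exists_entire_factorization hF (entire_analyticOrderAt_ne_top hF hx) (S n)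
  have hgne : ∀ (n : ℕ) (z : ℂ), ‖z‖ ≤ (n : ℝ) → g n z ≠ 0 := by
    intro n z hz hgz
    have : F z = 0 := by rw [hfac n, hgz, mul_zero]
    exact hgS n z ((hS n z).mpr ⟨this, hz⟩) hgz
  have hgb : ∀ n : ℕ, 0 < n → ‖x‖ ≤ n → ∀ z, ‖z‖ ≤ 3 * n →
      ‖g n z‖ ≤ ‖g n x‖ * Real.exp (A (3 * n)) := by
    intro n hn hxn z hz
    have hn' : (0 : ℝ) < n := by exact_mod_cast hn
    refine norm_le_of_forall_mem_frontier_norm_le (U := ball 0 (3 * n)) isBounded_ball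
      (hg n).diffContOnCl ?_ ?_
    · intro u hu
      rw [frontier_ball _ (by positivity), mem_sphere_zero_iff_norm] at hu
      have hP : ‖∏ r ∈ S n, (x - r) ^ m r‖ ≤ ‖∏ r ∈ S n, (u - r) ^ m r‖ := by
        rw [norm_prod, norm_prod]
        refine Finset.prod_le_prod (fun _ _ ↦ norm_nonneg _) fun r hr ↦ ?_
        rw [norm_pow, norm_pow]
        have h1 := ((hS n r).mp hr).2
        have h2 := norm_sub_norm_le u r
        refine pow_le_pow_left₀ (norm_nonneg _) ?_ _
        have h3 := norm_sub_le x r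
        linarith
      have hP0 : (0 : ℝ) < ‖∏ r ∈ S n, (x - r) ^ m r‖ := by
        refine norm_pos_iff.mpr fun h ↦ hx ?_
        rw [hfac n x, h, zero_mul]
      have h3 := hA (3 * n) u hu.le
      rw [hfac n u, hfac n x, norm_mul, norm_mul] at h3
      have h4 := mul_le_mul_of_nonneg_right hP (norm_nonneg (g n u))
      have h5 := h4.trans h3
      rw [mul_assoc] at h5
      exact le_of_mul_le_mul_left h5 hP0
    · rw [closure_ball _ (by positivity)]
      simpa using hz
  refine ⟨S, fun n ↦ logDeriv (g n) x, hS, fun w hw ↦ ?_⟩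
  have key : ∀ n : ℕ, ‖w‖ < n →
      ∑ r ∈ S n, (m r : ℂ) * (1 / (w - r)) = logDeriv F w - logDeriv (g n) w := by
    intro n hun
    rw [eq_sub_iff_add_eq, ← logDeriv_prod_pow_mul (hg n)
      (fun r hr h ↦ hw (by rw [h]; exact ((hS n r).mp hr).1)) (hgne n w hun.le)]
    congr 1
    exact (funext (hfac n)).symm
  have hlim : Tendsto (fun n : ℕ ↦ logDeriv (g n) w - logDeriv (g n) x) atTop (𝓝 0) := by
    have hA2 : Tendsto (fun n : ℕ ↦ 64 * (‖w‖ + ‖x‖) * (9 * (A (3 * n) / (3 * n) ^ 2) * 4)) atTop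
        (𝓝 0) := by
      have h1 : Tendsto (fun n : ℕ ↦ (3 * (n : ℝ))) atTop atTop :=
        tendsto_natCast_atTop_atTop.const_mul_atTop (by norm_num)
      have := ((hA'.comp h1).const_mul 9 |>.mul_const 4).const_mul (64 * (‖w‖ + ‖x‖))
      simpa using this
    refine squeeze_zero_norm' ?_ hA2
    filter_upwards [eventually_gt_atTop 0, eventually_gt_atTop ⌈16 * (‖w‖ + ‖x‖)⌉₊] with n hn hn2
    have hn' : (0 : ℝ) < n := by exact_mod_cast hn
    have hwn : ‖w‖ + ‖x‖ < n / 16 := by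
      have h2 := Nat.le_ceil (16 * (‖w‖ + ‖x‖))
      have h3 : ((⌈16 * (‖w‖ + ‖x‖)⌉₊ : ℕ) : ℝ) < n := by exact_mod_cast hn2
      linarith
    have hw0 := norm_nonneg w
    have h1 : ∀ z ∈ ball (0 : ℂ) (n / 2), ‖z + x‖ ≤ n := by
      intro z hz
      rw [mem_ball_zero_iff] at hz
      have := norm_add_le z x
      linarith
    have hux : ‖w - x‖ ≤ ‖w‖ + ‖x‖ := norm_sub_le w x
    have h2 := norm_logDeriv_sub_le_of_bound (g := fun z ↦ g n (z + x)) (R := n / 2)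
      (by positivity) (hApos (3 * n)) ((hg n).comp (by fun_prop))
      (fun z hz ↦ hgne n _ (h1 z hz))
      (fun z hz ↦ by simpa using hgb n hn (by linarith) _ ((h1 z hz).trans (by linarith)))
      (w := w - x) (by linarith)
    have h3 : ∀ z, logDeriv (fun z ↦ g n (z + x)) z = logDeriv (g n) (z + x) := by
      intro z
      rw [logDeriv_apply, logDeriv_apply, deriv_comp_add_const]
    rw [h3, h3, sub_add_cancel, zero_add] at h2
    refine h2.trans ?_
    have := (hApos (3 * n)).le
    calc _ ≤ 64 * A (3 * n) * (‖w‖ + ‖x‖) / (n / 2 : ℝ) ^ 2 := by gcongr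
      _ = _ := by field_simp; norm_num; ring
  have := hlim.const_sub (logDeriv F w)
  rw [sub_zero] at this
  refine this.congr' ?_
  filter_upwards [eventually_gt_atTop ⌈‖w‖⌉₊] with n hn
  rw [key n ((Nat.le_ceil _).trans_lt (by exact_mod_cast hn))]
  ring

theorem exists_finset_tendsto_re_sum_logDeriv {F : ℂ → ℂ} (hF : Differentiable ℂ F)
    (hsym : ∀ w, F (-conj w) = conj (F w)) {x : ℂ} (hx : F x ≠ 0) {A : ℝ → ℝ}
    (hApos : ∀ R, 0 < A R)
    (hA : ∀ R w, ‖w‖ ≤ R → ‖F w‖ ≤ ‖F x‖ * Real.exp (A R))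
    (hA' : Tendsto (fun R ↦ A R / R ^ 2) atTop (𝓝 0)) :
    ∃ S : ℕ → Finset ℂ, (∀ n r, r ∈ S n ↔ F r = 0 ∧ ‖r‖ ≤ n) ∧
      ∀ {ι : Type} [Fintype ι] (c w : ι → ℂ), (∑ j, c j).im = 0 → (∀ j, F (w j) ≠ 0) →
      Tendsto (fun n ↦ ∑ r ∈ S n, (analyticOrderNatAt F r : ℝ) *
        (((∑ j, c j * (1 / (w j - r))).re + (∑ j, c j * (1 / (w j + conj r))).re) / 2)) atTop
        (𝓝 (∑ j, c j * logDeriv F (w j)).re) := by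
  obtain ⟨S, G, hS, h⟩ := exists_finset_tendsto_sum_add_logDeriv hF hx hApos hA hA'
  refine ⟨S, hS, fun {ι} _ c w hc hw ↦ ?_⟩
  set m := analyticOrderNatAt F
  have hw' : ∀ j, F (-conj (w j)) ≠ 0 := fun j ↦ by rw [hsym]; simpa using hw j
  have h1 := tendsto_finsetSum Finset.univ fun j _ ↦ (h (w j) (hw j)).const_mul (c j)
  have h2 := tendsto_finsetSum Finset.univ fun j _ ↦ (h (-conj (w j)) (hw' j)).const_mul (conj (c j))
  have h3 := (continuous_re.tendsto _).comp ((h1.sub h2).div_const 2)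
  have e1 : ((∑ j, c j * logDeriv F (w j) - ∑ j, conj (c j) * logDeriv F (-conj (w j))) / 2).re =
      (∑ j, c j * logDeriv F (w j)).re := by
    have : ∑ j, conj (c j) * logDeriv F (-conj (w j)) = -conj (∑ j, c j * logDeriv F (w j)) := by
      rw [map_sum, ← Finset.sum_neg_distrib]
      refine Finset.sum_congr rfl fun j _ ↦ ?_
      rw [logDeriv_neg_conj hF hsym, map_mul]
      ring
    rw [this]
    simp
  rw [e1] at h3
  refine h3.congr fun n ↦ ?_
  have e2 : ∀ r, (∑ j, conj (c j) * (1 / (-conj (w j) - r))) =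
      -conj (∑ j, c j * (1 / (w j + conj r))) := by
    intro r
    rw [map_sum, ← Finset.sum_neg_distrib]
    refine Finset.sum_congr rfl fun j _ ↦ ?_
    simp only [map_mul, map_div₀, map_one, map_add, conj_conj]
    rw [← neg_add', one_div_neg_eq_neg_one_div]
    ring
  have e3 : ∀ (d v : ι → ℂ), ∑ j, d j * (∑ r ∈ S n, (m r : ℂ) * (1 / (v j - r)) + G n) =
      ∑ r ∈ S n, (m r : ℂ) * ∑ j, d j * (1 / (v j - r)) + (∑ j, d j) * G n := by
    intro d v
    simp only [mul_add, Finset.sum_add_distrib, Finset.mul_sum, Finset.sum_mul]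
    rw [Finset.sum_comm]
    congr 1
    refine Finset.sum_congr rfl fun _ _ ↦ Finset.sum_congr rfl fun _ _ ↦ by ring
  have e4 : ∑ j, conj (c j) = ∑ j, c j := by
    rw [← map_sum]; exact conj_eq_iff_im.mpr hc
  simp only [Function.comp_apply]
  rw [e3, e3, e4, add_sub_add_right_eq_sub, ← Finset.sum_sub_distrib, Finset.sum_div, re_sum]
  refine Finset.sum_congr rfl fun r _ ↦ ?_
  rw [e2, ← mul_sub, sub_neg_eq_add, mul_div_assoc, ← ofReal_natCast, re_ofReal_mul]
  have h4 : ∀ X Y : ℂ, ((X + conj Y) / 2).re = (X.re + Y.re) / 2 := fun X Y ↦ by simp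
  rw [h4]

noncomputable def riemannXi (s : ℂ) : ℂ := s * (s - 1) * completedRiemannZeta₀ s + 1

theorem differentiable_riemannXi : Differentiable ℂ riemannXi := by
  have := differentiable_completedZeta₀
  unfold riemannXi
  fun_prop

theorem riemannXi_one_sub (s : ℂ) : riemannXi (1 - s) = riemannXi s := by
  rw [riemannXi, riemannXi, completedRiemannZeta₀_one_sub]
  ring

theorem riemannXi_eq {s : ℂ} (hs : 0 < s.re) (h1 : s ≠ 1) :
    riemannXi s = s * (s - 1) * (Gammaℝ s * riemannZeta s) := by
  have h0 : s ≠ 0 := by rintro rfl; simp at hs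
  have h1' : 1 - s ≠ 0 := sub_ne_zero.mpr h1.symm
  rw [riemannZeta_def_of_ne_zero h0, mul_div_cancel₀ _ (Gammaℝ_ne_zero_of_re_pos hs),
    completedRiemannZeta_eq, riemannXi]
  field_simp
  ring

theorem Gammaℝ_conj (s : ℂ) : Gammaℝ (conj s) = conj (Gammaℝ s) := by
  have hpi : conj (Real.pi : ℂ) = Real.pi := conj_ofReal _
  have harg : (Real.pi : ℂ).arg ≠ Real.pi := by
    rw [arg_ofReal_of_nonneg Real.pi_pos.le]; exact Real.pi_pos.ne
  rw [Gammaℝ, Gammaℝ, map_mul, ← Gamma_conj, map_div₀]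
  congr 1
  · have := cpow_conj (Real.pi : ℂ) (-s / 2) harg
    rw [hpi] at this
    rw [← this]
    simp [map_ofNat]
  · simp [map_ofNat]

theorem riemannXi_conj (s : ℂ) : riemannXi (conj s) = conj (riemannXi s) := by
  have key : ∀ s : ℂ, 0 < s.re → riemannXi (conj s) = conj (riemannXi s) := by
    intro s hs
    by_cases h1 : s = 1
    · simp [h1, riemannXi]
    · have h1' : conj s ≠ 1 := fun h ↦ h1 (by simpa using congrArg conj h)
      rw [riemannXi_eq hs h1, riemannXi_eq (by simpa using hs) h1', Gammaℝ_conj,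
        riemannZeta_conj]
      simp
  rcases lt_or_ge 0 s.re with hs | hs
  · exact key s hs
  · rw [← riemannXi_one_sub s, ← key _ (by simp; linarith), ← riemannXi_one_sub (conj s)]
    simp

theorem riemannXi_ne_zero_of_one_le_re {s : ℂ} (hs : 1 ≤ s.re) : riemannXi s ≠ 0 := by
  by_cases h1 : s = 1
  · simp [h1, riemannXi]
  · have h0 : s ≠ 0 := by rintro rfl; simp at hs; linarith
    rw [riemannXi_eq (by linarith) h1]
    exact mul_ne_zero (mul_ne_zero h0 (sub_ne_zero.mpr h1))
      (mul_ne_zero (Gammaℝ_ne_zero_of_re_pos (by linarith))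
        (riemannZeta_ne_zero_of_one_le_re hs))

theorem re_mem_Ioo_of_riemannXi_eq_zero {s : ℂ} (hs : riemannXi s = 0) :
    s.re ∈ Ioo (0 : ℝ) 1 := by
  constructor
  · by_contra! h
    exact riemannXi_ne_zero_of_one_le_re (s := 1 - s) (by simp; linarith)
      (by rw [riemannXi_one_sub, hs])
  · by_contra! h
    exact riemannXi_ne_zero_of_one_le_re h hs

theorem exists_norm_completedRiemannZeta₀_le (a b : ℝ) :
    ∃ C, 0 ≤ C ∧ ∀ s : ℂ, a ≤ s.re → s.re ≤ b → ‖completedRiemannZeta₀ s‖ ≤ C := by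
  set P := HurwitzZeta.hurwitzEvenFEPair 0
  have hP := P.isStrongFEPair_toStrongFEPair
  have hc : ∀ s : ℂ, MellinConvergent P.f_modif s := fun s ↦ (hP.hasMellin s).1
  have hn : ∀ (s : ℂ) (x : ℝ), 0 < x →
      ‖(x : ℂ) ^ (s - 1) • P.f_modif x‖ = x ^ (s.re - 1) * ‖P.f_modif x‖ := by
    intro s x hx
    rw [norm_smul, norm_cpow_eq_rpow_re_of_pos hx]
    simp
  have h_int : ∀ c : ℝ, IntegrableOn (fun x : ℝ ↦ x ^ (c - 1) * ‖P.f_modif x‖) (Ioi 0) := by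
    intro c
    refine IntegrableOn.congr_fun (hc c).norm (fun x hx ↦ ?_) measurableSet_Ioi
    simpa using hn c x hx
  refine ⟨(∫ x in Ioi (0 : ℝ), (x ^ (a / 2 - 1) * ‖P.f_modif x‖ +
    x ^ (b / 2 - 1) * ‖P.f_modif x‖)), ?_, fun s ha hb ↦ ?_⟩
  · refine setIntegral_nonneg measurableSet_Ioi fun x hx ↦ ?_
    have : (0 : ℝ) < x := hx
    positivity
  have h1 : completedRiemannZeta₀ s = mellin P.f_modif (s / 2) / 2 := rfl
  rw [h1, norm_div, mellin]
  have h2 : ‖∫ t in Ioi (0 : ℝ), (t : ℂ) ^ (s / 2 - 1) • P.f_modif t‖ ≤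
      ∫ x in Ioi (0 : ℝ), (x ^ (a / 2 - 1) * ‖P.f_modif x‖ +
        x ^ (b / 2 - 1) * ‖P.f_modif x‖) := by
    refine (norm_integral_le_integral_norm _).trans ?_
    refine setIntegral_mono_on (hc (s / 2)).norm ((h_int (a / 2)).add (h_int (b / 2)))
      measurableSet_Ioi fun x hx ↦ ?_
    have hx : (0 : ℝ) < x := hx
    rw [hn _ x hx, ← add_mul]
    refine mul_le_mul_of_nonneg_right ?_ (norm_nonneg _)
    have hre : (s / 2).re = s.re / 2 := by simp
    rw [hre]
    rcases le_total x 1 with h | h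
    · have := Real.rpow_le_rpow_of_exponent_ge hx h (show a / 2 - 1 ≤ s.re / 2 - 1 by linarith)
      have := Real.rpow_nonneg hx.le (b / 2 - 1)
      linarith
    · have := Real.rpow_le_rpow_of_exponent_le h (show s.re / 2 - 1 ≤ b / 2 - 1 by linarith)
      have := Real.rpow_nonneg hx.le (a / 2 - 1)
      linarith
  have : ‖(2 : ℂ)‖ = 2 := by simp
  rw [this]
  have := norm_nonneg (∫ t in Ioi (0 : ℝ), (t : ℂ) ^ (s / 2 - 1) • P.f_modif t)
  linarith

theorem norm_Gamma_le {s : ℂ} (hs : 0 < s.re) : ‖Gamma s‖ ≤ Real.Gamma s.re := by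
  rw [Gamma_eq_integral hs, Real.Gamma_eq_integral hs, GammaIntegral]
  refine (norm_integral_le_integral_norm _).trans_eq ?_
  refine setIntegral_congr_fun measurableSet_Ioi fun x hx ↦ ?_
  have hx : (0 : ℝ) < x := hx
  rw [norm_mul, norm_cpow_eq_rpow_re_of_pos hx, norm_real, Real.norm_eq_abs,
    abs_of_pos (Real.exp_pos _)]
  simp

theorem Real.Gamma_le_exp_rpow {x : ℝ} (hx : 1 ≤ x) :
    Real.Gamma x ≤ Real.exp (2 * (x + 1) ^ (3 / 2 : ℝ)) := by
  have hx0 : 0 < x := by linarith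
  set n := ⌈x⌉₊
  have hn := Nat.le_ceil x
  have hn1 := (Nat.ceil_lt_add_one hx0.le).le
  have h1 : Real.Gamma x ≤ Real.Gamma (x + 1) := by
    rw [Real.Gamma_add_one hx0.ne']
    exact le_mul_of_one_le_left (Real.Gamma_pos_of_pos hx0).le hx
  have h2 : Real.Gamma (x + 1) ≤ Real.Gamma (n + 1) :=
    Real.Gamma_strictMonoOn_Ici.monotoneOn (by simp; linarith) (by simp; linarith) (by linarith)
  rw [Real.Gamma_nat_eq_factorial] at h2
  have h3 : (n.factorial : ℝ) ≤ (n : ℝ) ^ n := by exact_mod_cast n.factorial_le_pow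
  have h4 : (n : ℝ) ^ n ≤ (x + 1) ^ (x + 1) := by
    rw [← Real.rpow_natCast]
    calc (n : ℝ) ^ (n : ℝ) ≤ (x + 1) ^ (n : ℝ) := by gcongr
      _ ≤ (x + 1) ^ (x + 1) := by
        apply Real.rpow_le_rpow_of_exponent_le <;> linarith
  refine (h1.trans h2).trans (h3.trans (h4.trans ?_))
  rw [Real.rpow_def_of_pos (by linarith), Real.exp_le_exp]
  have h5 := Real.log_le_rpow_div (x := x + 1) (by linarith) (ε := 1 / 2) (by norm_num)
  have h6 : (x + 1) ^ (3 / 2 : ℝ) = (x + 1) * (x + 1) ^ (1 / 2 : ℝ) := by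
    rw [← Real.rpow_one_add' (by linarith) (by norm_num)]
    norm_num
  rw [h6]
  have : Real.log (x + 1) * (x + 1) ≤ ((x + 1) ^ (1 / 2 : ℝ) / (1 / 2)) * (x + 1) := by gcongr
  linarith

theorem norm_riemannZeta_le_of_two_le_re {s : ℂ} (hs : 2 ≤ s.re) : ‖riemannZeta s‖ ≤ 2 := by
  rw [zeta_eq_tsum_one_div_nat_cpow (by linarith)]
  have h2 := hasSum_zeta_two
  refine (tsum_of_norm_bounded h2 fun n ↦ ?_).trans ?_
  · rcases Nat.eq_zero_or_pos n with rfl | hn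
    · have : s ≠ 0 := by rintro rfl; simp at hs; linarith
      simp [this]
    · rw [norm_div, norm_one, norm_natCast_cpow_of_pos hn]
      have : (n : ℝ) ^ 2 ≤ (n : ℝ) ^ s.re := by
        rw [← Real.rpow_natCast]
        exact Real.rpow_le_rpow_of_exponent_le (by exact_mod_cast hn) (by simpa using hs)
      gcongr
  · nlinarith [Real.pi_lt_d2, Real.pi_pos]

theorem exists_norm_completedRiemannZeta₀_le_exp :
    ∃ C, 0 ≤ C ∧ ∀ s : ℂ, ‖completedRiemannZeta₀ s‖ ≤
      Real.exp (C + 2 * (‖s‖ + 2) ^ (3 / 2 : ℝ)) := by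
  obtain ⟨C, hC0, hC⟩ := exists_norm_completedRiemannZeta₀_le 0 2
  have key : ∀ s : ℂ, 0 ≤ s.re → ‖completedRiemannZeta₀ s‖ ≤
      (C + 4) * Real.exp (2 * (‖s‖ + 1) ^ (3 / 2 : ℝ)) := by
    intro s hs
    have he : 1 ≤ Real.exp (2 * (‖s‖ + 1) ^ (3 / 2 : ℝ)) := Real.one_le_exp (by positivity)
    rcases le_total s.re 2 with h | h
    · have := hC s hs h
      nlinarith
    · have h0 : s ≠ 0 := by rintro rfl; simp at h; linarith
      have h1 : (1 : ℂ) - s ≠ 0 := fun h' ↦ by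
        have := congrArg re h'
        simp at this
        linarith
      have e1 : completedRiemannZeta₀ s = Gammaℝ s * riemannZeta s + 1 / s + 1 / (1 - s) := by
        rw [riemannZeta_def_of_ne_zero h0,
          mul_div_cancel₀ _ (Gammaℝ_ne_zero_of_re_pos (by linarith)), completedRiemannZeta_eq]
        ring
      have e2 : ‖1 / s‖ ≤ 1 := by
        rw [norm_div, norm_one]
        refine div_le_one_of_le₀ ?_ (norm_nonneg _)
        have := abs_re_le_norm s
        have := le_abs_self s.re
        linarith
      have e3 : ‖1 / (1 - s)‖ ≤ 1 := by
        rw [norm_div, norm_one]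
        refine div_le_one_of_le₀ ?_ (norm_nonneg _)
        have := abs_re_le_norm (1 - s)
        have := neg_abs_le (1 - s).re
        simp at *
        linarith
      have e4 : ‖Gammaℝ s‖ ≤ Real.exp (2 * (‖s‖ + 1) ^ (3 / 2 : ℝ)) := by
        rw [Gammaℝ, norm_mul, norm_cpow_eq_rpow_re_of_pos Real.pi_pos]
        have hs2 : (s / 2).re = s.re / 2 := by simp
        have f1 : Real.pi ^ (-s / 2).re ≤ 1 := by
          refine Real.rpow_le_one_of_one_le_of_nonpos (by linarith [Real.pi_gt_three]) ?_
          simp [neg_div]; linarith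
        have f2 : ‖Gamma (s / 2)‖ ≤ Real.exp (2 * (‖s‖ + 1) ^ (3 / 2 : ℝ)) := by
          refine (norm_Gamma_le (by rw [hs2]; linarith)).trans ?_
          refine (Real.Gamma_le_exp_rpow (by rw [hs2]; linarith)).trans ?_
          rw [Real.exp_le_exp, hs2]
          have := abs_re_le_norm s
          have := le_abs_self s.re
          gcongr
          linarith
        calc _ ≤ 1 * ‖Gamma (s / 2)‖ := by gcongr
          _ ≤ _ := by rw [one_mul]; exact f2
      have e5 := norm_riemannZeta_le_of_two_le_re h
      rw [e1]
      calc _ ≤ ‖Gammaℝ s‖ * ‖riemannZeta s‖ + 1 + 1 := by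
            refine (norm_add_le _ _).trans (add_le_add ((norm_add_le _ _).trans
              (add_le_add (norm_mul_le _ _) e2)) e3)
        _ ≤ Real.exp (2 * (‖s‖ + 1) ^ (3 / 2 : ℝ)) * 2 + 1 + 1 := by gcongr
        _ ≤ _ := by nlinarith
  refine ⟨Real.log (C + 4), Real.log_nonneg (by linarith), fun s ↦ ?_⟩
  rw [Real.exp_add, Real.exp_log (by linarith)]
  rcases le_total 0 s.re with h | h
  · refine (key s h).trans ?_
    gcongr
    norm_num
  · rw [← completedRiemannZeta₀_one_sub]
    refine (key _ (by simp; linarith)).trans ?_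
    have := norm_sub_le 1 s
    rw [norm_one] at this
    have : ‖1 - s‖ + 1 ≤ ‖s‖ + 2 := by linarith
    gcongr

theorem riemannXi_two_ne_zero : riemannXi 2 ≠ 0 := riemannXi_ne_zero_of_one_le_re (by simp)

theorem exists_finset_tendsto_re_sum_logDeriv_riemannXi :
    ∃ S : ℕ → Finset ℂ, (∀ n r, r ∈ S n ↔ riemannXi (1 / 2 + r) = 0 ∧ ‖r‖ ≤ n) ∧
      ∀ {ι : Type} [Fintype ι] (c s : ι → ℂ), (∑ j, c j).im = 0 → (∀ j, riemannXi (s j) ≠ 0) →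
      Tendsto (fun n ↦ ∑ r ∈ S n, (analyticOrderNatAt (fun w ↦ riemannXi (1 / 2 + w)) r : ℝ) *
        (((∑ j, c j * (1 / (s j - 1 / 2 - r))).re +
          (∑ j, c j * (1 / (s j - 1 / 2 + conj r))).re) / 2)) atTop
        (𝓝 (∑ j, c j * logDeriv riemannXi (s j)).re) := by
  obtain ⟨C, hC0, hC⟩ := exists_norm_completedRiemannZeta₀_le_exp
  have hd : Differentiable ℂ (fun w ↦ riemannXi (1 / 2 + w)) :=
    differentiable_riemannXi.comp (by fun_prop)
  have hsym : ∀ w, riemannXi (1 / 2 + -conj w) = conj (riemannXi (1 / 2 + w)) := by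
    intro w
    rw [← riemannXi_conj, ← riemannXi_one_sub]
    congr 1
    simp [map_ofNat]
    ring
  have hx : riemannXi (1 / 2 + 3 / 2) ≠ 0 := by
    have : (1 / 2 + 3 / 2 : ℂ) = 2 := by norm_num
    rw [this]
    exact riemannXi_two_ne_zero
  set N := ‖riemannXi (1 / 2 + 3 / 2)‖ with hN
  have hNpos : 0 < N := norm_pos_iff.mpr hx
  set A : ℝ → ℝ := fun R ↦ |Real.log (2 / N)| + C + 1 + 2 * (|R| + 3)  +
    2 * (|R| + 3) ^ (3 / 2 : ℝ) with hA
  have hApos : ∀ R, 0 < A R := fun R ↦ by positivity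
  have hbound : ∀ R w, ‖w‖ ≤ R → ‖riemannXi (1 / 2 + w)‖ ≤ N * Real.exp (A R) := by
    intro R w hw
    have hR : ‖w‖ ≤ |R| := hw.trans (le_abs_self R)
    set s := 1 / 2 + w
    have hs : ‖s‖ ≤ |R| + 1 := by
      refine (norm_add_le _ _).trans ?_
      have : ‖(1 / 2 : ℂ)‖ = 1 / 2 := by simp
      linarith
    have hs1 : ‖s - 1‖ ≤ |R| + 2 := by
      refine (norm_sub_le _ _).trans ?_
      rw [norm_one]; linarith
    set E := Real.exp (C + 2 * (|R| + 3) ^ (3 / 2 : ℝ)) with hE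
    have hE1 : 1 ≤ E := Real.one_le_exp (by positivity)
    have h0 : ‖completedRiemannZeta₀ s‖ ≤ E := by
      refine (hC s).trans ?_
      rw [hE]
      refine Real.exp_le_exp.mpr ?_
      have : (‖s‖ + 2) ^ (3 / 2 : ℝ) ≤ (|R| + 3) ^ (3 / 2 : ℝ) := by
        gcongr ?_ ^ _; linarith
      linarith
    have h1 : ∀ y : ℝ, 0 ≤ y → y ≤ Real.exp y := fun y _ ↦ by
      linarith [Real.add_one_le_exp y]
    have ha := h1 (|R| + 3) (by positivity)
    have h2 : ‖riemannXi s‖ ≤ 2 * (Real.exp (|R| + 3) * Real.exp (|R| + 3) * E) := by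
      rw [riemannXi]
      calc _ ≤ ‖s‖ * ‖s - 1‖ * ‖completedRiemannZeta₀ s‖ + 1 := by
            refine (norm_add_le _ _).trans ?_
            rw [norm_mul, norm_mul, norm_one]
        _ ≤ (Real.exp (|R| + 3) * Real.exp (|R| + 3)) * E + 1 := by
            gcongr <;> linarith
        _ ≤ _ := by
            have : 1 ≤ Real.exp (|R| + 3) * Real.exp (|R| + 3) * E := by
              have h1 : 1 ≤ Real.exp (|R| + 3) := Real.one_le_exp (by positivity)
              exact one_le_mul_of_one_le_of_one_le (one_le_mul_of_one_le_of_one_le h1 h1) hE1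
            linarith
    refine h2.trans ?_
    have h3 : N * Real.exp (Real.log (2 / N)) = 2 := by
      rw [Real.exp_log (by positivity)]
      field_simp
    calc 2 * (Real.exp (|R| + 3) * Real.exp (|R| + 3) * E)
        = N * Real.exp (Real.log (2 / N) + (|R| + 3) + (|R| + 3) +
          (C + 2 * (|R| + 3) ^ (3 / 2 : ℝ))) := by
          rw [Real.exp_add _ (C + _), Real.exp_add _ (|R| + 3), Real.exp_add _ (|R| + 3), ← hE]
          linear_combination -(Real.exp (|R| + 3) * Real.exp (|R| + 3) * E) * h3
      _ ≤ _ := by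
          gcongr
          rw [hA]
          have := le_abs_self (Real.log (2 / N))
          simp only
          linarith
  have hlim : Tendsto (fun R ↦ A R / R ^ 2) atTop (𝓝 0) := by
    set K := |Real.log (2 / N)| + C + 1
    have hb : ∀ᶠ R : ℝ in atTop, ‖A R / R ^ 2‖ ≤ (K + 24) * R ^ (-(1 / 2) : ℝ) := by
      filter_upwards [eventually_ge_atTop 3] with R hR
      have hR0 : 0 < R := by linarith
      have hK : 0 ≤ K := by positivity
      rw [Real.norm_eq_abs, abs_of_nonneg (by have := hApos R; positivity)]
      rw [div_le_iff₀ (by positivity)]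
      have e1 : R ^ (-(1 / 2) : ℝ) * R ^ 2 = R ^ (3 / 2 : ℝ) := by
        rw [← Real.rpow_natCast, ← Real.rpow_add hR0]; norm_num
      have e2 : R ≤ R ^ (3 / 2 : ℝ) := by
        conv_lhs => rw [← Real.rpow_one R]
        exact Real.rpow_le_rpow_of_exponent_le (by linarith) (by norm_num)
      have e3 : (|R| + 3) ^ (3 / 2 : ℝ) ≤ 4 * R ^ (3 / 2 : ℝ) := by
        rw [abs_of_pos hR0]
        calc (R + 3) ^ (3 / 2 : ℝ) ≤ (2 * R) ^ (3 / 2 : ℝ) := by gcongr; linarith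
          _ = 2 ^ (3 / 2 : ℝ) * R ^ (3 / 2 : ℝ) := Real.mul_rpow (by norm_num) hR0.le
          _ ≤ 2 ^ (2 : ℝ) * R ^ (3 / 2 : ℝ) := by gcongr <;> norm_num
          _ = _ := by norm_num
      rw [mul_assoc, e1, hA]
      simp only
      rw [abs_of_pos hR0] at *
      have : K * 1 ≤ K * R ^ (3 / 2 : ℝ) := by gcongr; linarith
      linarith
    refine squeeze_zero_norm' hb ?_
    simpa using (tendsto_rpow_neg_atTop (y := 1 / 2) (by norm_num)).const_mul (K + 24)
  obtain ⟨S, hS, hlimS⟩ := exists_finset_tendsto_re_sum_logDeriv hd hsym hx hApos hbound hlim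
  refine ⟨S, hS, fun {ι} _ c s hc hs ↦ ?_⟩
  have h1 := hlimS c (fun j ↦ s j - 1 / 2) hc (fun j ↦ by simpa using hs j)
  have h2 : ∀ j, logDeriv (fun w ↦ riemannXi (1 / 2 + w)) (s j - 1 / 2) =
      logDeriv riemannXi (s j) := by
    intro j
    rw [logDeriv_apply, logDeriv_apply, deriv_comp_const_add]
    simp
  simpa only [h2] using h1

theorem norm_GammaSeq_le {s : ℂ} (hs : 0 < s.re) {n : ℕ} (hn : n ≠ 0) :
    ‖GammaSeq s n‖ ≤ Real.Gamma s.re := by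
  rw [GammaSeq_eq_approx_Gamma_integral hs hn, intervalIntegral.integral_of_le (by positivity)]
  refine (norm_integral_le_integral_norm _).trans ?_
  rw [Real.Gamma_eq_integral hs]
  have hi : IntegrableOn (fun x : ℝ ↦ Real.exp (-x) * x ^ (s.re - 1)) (Ioi 0) :=
    Real.GammaIntegral_convergent hs
  refine le_trans ?_ (setIntegral_mono_set (s := Ioc 0 (n : ℝ)) hi ?_
    Ioc_subset_Ioi_self.eventuallyLE)
  · refine integral_mono_of_nonneg (Eventually.of_forall fun x ↦ norm_nonneg _)
      (hi.mono_set Ioc_subset_Ioi_self) ?_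
    filter_upwards [ae_restrict_mem measurableSet_Ioc] with x hx
    have hx0 : 0 < x := hx.1
    have h1 : x / n ≤ 1 := div_le_one_of_le₀ hx.2 (by positivity)
    rw [norm_mul, norm_cpow_eq_rpow_re_of_pos hx0, norm_real, Real.norm_eq_abs,
      abs_of_nonneg (pow_nonneg (by linarith) _)]
    simp only [sub_re, one_re]
    gcongr
    exact Real.one_sub_div_pow_le_exp_neg hx.2
  · filter_upwards [ae_restrict_mem measurableSet_Ioi] with x hx
    have hx0 : (0 : ℝ) < x := hx
    positivity

theorem logDeriv_GammaSeq {z : ℂ} (hz : 0 < z.re) {n : ℕ} (hn : n ≠ 0) :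
    DifferentiableAt ℂ (fun s ↦ GammaSeq s n) z ∧ GammaSeq z n ≠ 0 ∧
    logDeriv (fun s ↦ GammaSeq s n) z =
      Real.log n - ∑ k ∈ Finset.range (n + 1), 1 / (z + k) := by
  have hn' : (n : ℂ) ≠ 0 := by exact_mod_cast hn
  have hk : ∀ k : ℕ, z + k ≠ 0 := fun k h ↦ by
    have := congrArg re h
    simp at this
    have : (0 : ℝ) ≤ k := by positivity
    linarith
  have hp : (∏ j ∈ Finset.range (n + 1), (z + j)) ≠ 0 :=
    Finset.prod_ne_zero_iff.mpr fun k _ ↦ hk k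
  have hf : (n.factorial : ℂ) ≠ 0 := by exact_mod_cast n.factorial_ne_zero
  have hd1 : HasDerivAt (fun s : ℂ ↦ (n : ℂ) ^ s * n.factorial)
      ((n : ℂ) ^ z * log n * 1 * n.factorial) z :=
    ((hasDerivAt_id z).const_cpow (Or.inl hn')).mul_const _
  have hd2 : DifferentiableAt ℂ (fun s : ℂ ↦ ∏ j ∈ Finset.range (n + 1), (s + j)) z := by
    fun_prop
  have hnz : (n : ℂ) ^ z * n.factorial ≠ 0 := mul_ne_zero (by simp [cpow_eq_zero_iff, hn]) hf
  refine ⟨hd1.differentiableAt.fun_div hd2 hp, div_ne_zero hnz hp, ?_⟩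
  have h1 : logDeriv (fun s ↦ GammaSeq s n) z = logDeriv (fun s : ℂ ↦ (n : ℂ) ^ s * n.factorial) z -
      logDeriv (fun s : ℂ ↦ ∏ j ∈ Finset.range (n + 1), (s + j)) z := by
    rw [← logDeriv_div z hnz hp hd1.differentiableAt hd2]
    rfl
  rw [h1]
  congr 1
  · rw [logDeriv_apply, hd1.deriv, ← natCast_log]
    have : (n : ℂ) ^ z ≠ 0 := left_ne_zero_of_mul hnz
    field_simp
  · have := logDeriv_prod (s := Finset.range (n + 1)) (f := fun (j : ℕ) (s : ℂ) ↦ s + j) (x := z)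
      (fun k _ ↦ hk k) (fun k _ ↦ by fun_prop)
    rw [this]
    refine Finset.sum_congr rfl fun k _ ↦ ?_
    rw [logDeriv_apply]
    simp

theorem tendsto_deriv_GammaSeq {z : ℂ} (hz : 0 < z.re) :
    Tendsto (fun n : ℕ ↦ deriv (fun s ↦ GammaSeq s n) z) atTop (𝓝 (deriv Gamma z)) := by
  set R := z.re / 2
  have hR : 0 < R := by positivity
  have hre : ∀ w ∈ closedBall z R, 0 < w.re := by
    intro w hw
    have h1 := abs_re_le_norm (w - z)
    rw [mem_closedBall, dist_eq] at hw
    have := (abs_le.mp (h1.trans hw)).1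
    simp only [sub_re] at this
    have : R = z.re / 2 := rfl
    linarith
  have key : ∀ f : ℂ → ℂ, (∀ w, 0 < w.re → DifferentiableAt ℂ f w) →
      deriv f z = (2 * Real.pi * I)⁻¹ * ∮ w in C(z, R), (1 / (w - z) ^ 2) • f w := by
    intro f hf
    rw [DifferentiableOn.deriv_eq_smul_circleIntegral hR
      (fun w hw ↦ (hf w (hre w hw)).differentiableWithinAt), smul_eq_mul,
      inv_mul_cancel_left₀ two_pi_I_ne_zero]
  have hG : ∀ w : ℂ, 0 < w.re → DifferentiableAt ℂ Gamma w := fun w hw ↦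
    differentiableAt_Gamma w fun m h ↦ by
      rw [h] at hw
      simp at hw
      have : (0 : ℝ) ≤ m := by positivity
      linarith
  rw [key Gamma hG]
  refine Tendsto.congr' (f₁ := fun n : ℕ ↦ (2 * Real.pi * I)⁻¹ *
    ∮ w in C(z, R), (1 / (w - z) ^ 2) • GammaSeq w n) ?_ ?_
  · filter_upwards [eventually_ne_atTop 0] with n hn
    rw [key _ fun w hw ↦ (logDeriv_GammaSeq hw hn).1]
  refine Tendsto.const_mul _ ?_
  have hcm : ∀ θ, circleMap z R θ ∈ closedBall z R := fun θ ↦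
    circleMap_mem_closedBall _ hR.le _
  have hcont : ∀ f : ℂ → ℂ, (∀ w, 0 < w.re → DifferentiableAt ℂ f w) →
      Continuous (fun θ ↦ f (circleMap z R θ)) := fun f hf ↦
    continuous_iff_continuousAt.mpr fun θ ↦
      ContinuousAt.comp (f := circleMap z R) (hf _ (hre _ (hcm θ))).continuousAt
        (continuous_circleMap z R).continuousAt
  have hne : ∀ θ, circleMap z R θ - z ≠ 0 := fun θ ↦ by
    rw [circleMap_sub_center]; exact circleMap_ne_center hR.ne'
  have hc0 : Continuous fun θ ↦ deriv (circleMap z R) θ * (1 / (circleMap z R θ - z) ^ 2) := by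
    have h1 : Continuous (deriv (circleMap z R)) := by
      have : deriv (circleMap z R) = fun θ ↦ circleMap 0 R θ * I := by
        ext θ; simp
      rw [this]
      fun_prop
    refine h1.mul (continuous_const.div (by fun_prop) fun θ ↦ pow_ne_zero _ (hne θ))
  have hcG : Continuous fun θ ↦ Real.Gamma (circleMap z R θ).re := by
    refine continuous_iff_continuousAt.mpr fun θ ↦ ?_
    have h2 : ContinuousAt Real.Gamma (circleMap z R θ).re :=
      (Real.differentiableAt_Gamma fun m h ↦ by
        have := hre _ (hcm θ)
        rw [h] at this
        have : (0 : ℝ) ≤ m := by positivity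
        linarith).continuousAt
    exact ContinuousAt.comp (f := fun θ ↦ (circleMap z R θ).re) h2 (by fun_prop)
  unfold circleIntegral
  refine intervalIntegral.tendsto_integral_filter_of_dominated_convergence
    (fun θ ↦ ‖deriv (circleMap z R) θ * (1 / (circleMap z R θ - z) ^ 2)‖ *
      Real.Gamma (circleMap z R θ).re) ?_ ?_ ?_ ?_
  · filter_upwards [eventually_ne_atTop 0] with n hn
    have := hc0.mul (hcont _ fun w hw ↦ (logDeriv_GammaSeq hw hn).1)
    refine Continuous.aestronglyMeasurable ?_
    refine this.congr fun θ ↦ ?_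
    simp [mul_assoc]
  · filter_upwards [eventually_ne_atTop 0] with n hn
    refine Eventually.of_forall fun θ _ ↦ ?_
    rw [smul_eq_mul, smul_eq_mul, ← mul_assoc, norm_mul]
    gcongr
    exact norm_GammaSeq_le (hre _ (hcm θ)) hn
  · exact (hc0.norm.mul hcG).intervalIntegrable _ _
  · refine Eventually.of_forall fun θ _ ↦ ?_
    exact ((GammaSeq_tendsto_Gamma _).const_smul _).const_smul _

theorem tendsto_log_sub_sum_digamma {z : ℂ} (hz : 0 < z.re) :
    Tendsto (fun n : ℕ ↦ (Real.log n : ℂ) - ∑ k ∈ Finset.range (n + 1), 1 / (z + k)) atTop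
      (𝓝 (digamma z)) := by
  rw [digamma_def, logDeriv_apply]
  refine ((tendsto_deriv_GammaSeq hz).div (GammaSeq_tendsto_Gamma z)
    (Gamma_ne_zero_of_re_pos hz)).congr' ?_
  filter_upwards [eventually_ne_atTop 0] with n hn
  rw [← (logDeriv_GammaSeq hz hn).2.2, logDeriv_apply]
  rfl

theorem norm_log_sub_log_sub_le {m : ℂ} (hm : 2 ≤ m.re) :
    ‖log (m + 1 / 2) - log (m - 1 / 2) - 1 / (2 * (m - 1 / 2)) - 1 / (2 * (m + 1 / 2))‖ ≤
      19 / 100 / ‖m‖ ^ 3 := by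
  have hm2 : 2 ≤ ‖m‖ := hm.trans ((le_abs_self _).trans (abs_re_le_norm m))
  set f : ℝ → ℂ := fun s ↦ log (m + s) - log (m - s) - s / (m - s) - s / (m + s)
  set f' : ℝ → ℂ := fun s ↦ -4 * m * s ^ 2 / ((m + s) ^ 2 * (m - s) ^ 2)
  have hre : ∀ s ∈ Icc (0 : ℝ) (1 / 2), 0 < (m + s).re ∧ 0 < (m - s).re := by
    intro s hs
    simp only [add_re, sub_re, ofReal_re]
    exact ⟨by linarith [hs.1], by linarith [hs.2]⟩
  have hne : ∀ w : ℂ, 0 < w.re → w ≠ 0 := by rintro w hw rfl; simp at hw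
  have hder : ∀ s ∈ Icc (0 : ℝ) (1 / 2), HasDerivAt f (f' s) s := by
    intro s hs
    obtain ⟨h1, h2⟩ := hre s hs
    have hid : HasDerivAt (fun s : ℝ ↦ (s : ℂ)) 1 s := ofRealCLM.hasDerivAt
    have p1 : HasDerivAt (fun s : ℝ ↦ m + (s : ℂ)) 1 s := hid.const_add m
    have p2 : HasDerivAt (fun s : ℝ ↦ m - (s : ℂ)) (-1) s := hid.const_sub m
    refine ((((p1.clog_real (Or.inl h1)).sub (p2.clog_real (Or.inl h2))).sub
      (hid.fun_div p2 (hne _ h2))).sub (hid.fun_div p1 (hne _ h1))).congr_deriv ?_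
    have n1 := hne _ h1
    have n2 := hne _ h2
    simp only [f']
    field_simp
    ring
  have hB : ∀ s : ℝ, HasDerivAt (fun s : ℝ ↦ 4 / 3 * (256 / 225) / ‖m‖ ^ 3 * s ^ 3)
      (4 * (256 / 225) / ‖m‖ ^ 3 * s ^ 2) s := by
    intro s
    refine ((hasDerivAt_pow 3 s).const_mul _).congr_deriv ?_
    push_cast
    ring
  have hb : ∀ s ∈ Ico (0 : ℝ) (1 / 2), ‖f' s‖ ≤ 4 * (256 / 225) / ‖m‖ ^ 3 * s ^ 2 := by
    intro s hs
    have e1 : (m + s) ^ 2 * (m - s) ^ 2 = (m ^ 2 - s ^ 2) ^ 2 := by ring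
    simp only [f']
    rw [e1, norm_div, norm_mul, norm_mul, norm_pow, norm_pow, norm_real]
    have e2 : ‖m‖ ^ 2 * (15 / 16) ≤ ‖m ^ 2 - s ^ 2‖ := by
      have := norm_sub_norm_le (m ^ 2) ((s : ℂ) ^ 2)
      rw [norm_pow, norm_pow, norm_real, Real.norm_eq_abs, sq_abs] at this
      nlinarith [hs.1, hs.2]
    have e3 : ‖(-4 : ℂ)‖ = 4 := by simp
    have hm0 : 0 < ‖m‖ := by linarith
    rw [e3, Real.norm_eq_abs, sq_abs]
    have hden : 0 < ‖m ^ 2 - s ^ 2‖ := lt_of_lt_of_le (by positivity) e2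
    have e4 : (‖m‖ ^ 2 * (15 / 16)) ^ 2 ≤ ‖m ^ 2 - s ^ 2‖ ^ 2 := by gcongr
    rw [div_le_iff₀ (by positivity)]
    calc 4 * ‖m‖ * s ^ 2 = 4 * (256 / 225) / ‖m‖ ^ 3 * s ^ 2 * (‖m‖ ^ 2 * (15 / 16)) ^ 2 := by
          field_simp
          ring
      _ ≤ _ := by gcongr
  have := image_norm_le_of_norm_deriv_right_le_deriv_boundary
    (fun s hs ↦ (hder s hs).continuousAt.continuousWithinAt)
    (fun s hs ↦ (hder s (Ico_subset_Icc_self hs)).hasDerivWithinAt) (by simp [f]) hB hb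
    (x := 1 / 2) (by norm_num)
  have e : log (m + 1 / 2) - log (m - 1 / 2) - 1 / (2 * (m - 1 / 2)) - 1 / (2 * (m + 1 / 2)) =
      f (1 / 2) := by
    obtain ⟨h1, h2⟩ := hre (1 / 2) (by norm_num)
    have n1 := hne _ h1
    have n2 := hne _ h2
    simp only [f]
    push_cast at n1 n2 ⊢
    field_simp
  rw [e]
  refine this.trans ?_
  rw [div_mul_eq_mul_div]
  gcongr
  norm_num

theorem norm_digamma_sub_le {z : ℂ} (hz : 3 / 2 ≤ z.re) :
    ‖digamma z - log z + 1 / (2 * z)‖ ≤ 19 / 200 / z.re ^ 2 ∧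
    ‖digamma z - log z + 1 / (2 * z)‖ * |z.im| ≤ 19 / 100 / z.re := by
  have hz0 : 0 < z.re := by linarith
  have hne : ∀ k : ℕ, z + k ≠ 0 := fun k h ↦ by
    have := congrArg re h
    simp at this
    have : (0 : ℝ) ≤ k := by positivity
    linarith
  set h : ℂ → ℂ := fun z ↦ log z - 1 / (2 * z) with hh
  set g : ℕ → ℂ := fun k ↦ log (z + k + 1) - log (z + k) - 1 / (2 * (z + k)) -
    1 / (2 * (z + k + 1)) with hg
  have hsum : ∀ n : ℕ, ∑ k ∈ Finset.range n, 1 / (z + k) =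
      h (z + n) - h z - ∑ k ∈ Finset.range n, g k := by
    intro n
    induction n with
    | zero => simp
    | succ n ih =>
      rw [Finset.sum_range_succ, Finset.sum_range_succ, ih]
      have h1 := hne n
      have h2 := hne (n + 1)
      simp only [hh, hg]
      push_cast at h2 ⊢
      rw [← add_assoc] at h2 ⊢
      field_simp
      ring
  have hlim : Tendsto (fun n : ℕ ↦ (Real.log n : ℂ) - h (z + (n + 1 : ℕ))) atTop (𝓝 0) := by
    have t1 : Tendsto (fun n : ℕ ↦ (z + 1) / n) atTop (𝓝 0) :=
      tendsto_const_div_atTop_nhds_zero_nat (z + 1)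
    have t2 : Tendsto (fun n : ℕ ↦ log (1 + (z + 1) / n)) atTop (𝓝 0) := by
      have : ContinuousAt log (1 : ℂ) := continuousAt_clog (by simp [slitPlane])
      have t3 := this.tendsto.comp (f := fun n : ℕ ↦ 1 + (z + 1) / n) (by
        simpa using t1.const_add 1)
      simpa [Function.comp_def] using t3
    have t4 : Tendsto (fun n : ℕ ↦ 1 / (2 * (z + (n + 1 : ℕ)))) atTop (𝓝 0) := by
      have : Tendsto (fun n : ℕ ↦ (1 / 2 : ℂ) * (1 / (n : ℂ) / (1 + (z + 1) / n))) atTop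
          (𝓝 ((1 / 2) * (0 / (1 + 0)))) :=
        ((tendsto_const_div_atTop_nhds_zero_nat (1 : ℂ)).div (t1.const_add 1)
          (by simp)).const_mul _
      rw [zero_div, mul_zero] at this
      refine this.congr' ?_
      filter_upwards [eventually_ne_atTop 0] with n hn
      have hn' : (n : ℂ) ≠ 0 := by exact_mod_cast hn
      have := hne (n + 1)
      have h5 : (n : ℂ) + (z + 1) ≠ 0 := by
        push_cast at this
        convert this using 1; ring
      push_cast
      rw [div_div, mul_add, mul_one, mul_div_cancel₀ _ hn', one_div_mul_one_div]
      congr 2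
      ring
    have := t4.sub t2
    rw [sub_zero] at this
    refine this.congr' ?_
    filter_upwards [eventually_ne_atTop 0] with n hn
    have hn' : (n : ℂ) ≠ 0 := by exact_mod_cast hn
    have hnp : (0 : ℝ) < n := by exact_mod_cast Nat.pos_of_ne_zero hn
    have e1 : z + (n + 1 : ℕ) = (n : ℝ) * (1 + (z + 1) / n) := by
      push_cast
      field_simp
      ring
    have e2 : (1 + (z + 1) / n : ℂ) ≠ 0 := by
      intro h0
      rw [h0, mul_zero] at e1
      exact hne (n + 1) e1
    simp only [hh]
    rw [e1, log_ofReal_mul hnp e2]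
    push_cast
    ring
  have hlim2 : Tendsto (fun n : ℕ ↦ ‖∑ k ∈ Finset.range (n + 1), g k‖) atTop
      (𝓝 ‖digamma z - log z + 1 / (2 * z)‖) := by
    have := (((tendsto_log_sub_sum_digamma hz0).sub hlim).sub_const (h z)).norm
    have e : digamma z - 0 - h z = digamma z - log z + 1 / (2 * z) := by simp only [hh]; ring
    rw [e] at this
    refine this.congr fun n ↦ ?_
    rw [hsum]
    congr 1
    ring
  have hgb : ∀ k : ℕ, ‖g k‖ ≤ 19 / 100 / ‖z + k + 1 / 2‖ ^ 3 := by
    intro k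
    have hk : (0 : ℝ) ≤ k := by positivity
    have := norm_log_sub_log_sub_le (m := z + k + 1 / 2) (by simp; linarith)
    refine le_trans (le_of_eq ?_) this
    simp only [hg]
    rw [add_sub_cancel_right, add_assoc (z + k) (1 / 2) (1 / 2), add_halves]
  have hre : ∀ k : ℕ, (z + k + 1 / 2).re = z.re + k + 1 / 2 := fun k ↦ by simp
  have him : ∀ k : ℕ, (z + k + 1 / 2).im = z.im := fun k ↦ by simp
  constructor
  · refine le_of_tendsto hlim2 (Eventually.of_forall fun n ↦ ?_)
    have : ∀ n : ℕ, ∑ k ∈ Finset.range n, ‖g k‖ ≤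
        19 / 200 / z.re ^ 2 - 19 / 200 / (z.re + n) ^ 2 := by
      intro n
      induction n with
      | zero => simp
      | succ n ih =>
        rw [Finset.sum_range_succ]
        have h1 := hgb n
        have h2 : z.re + n + 1 / 2 ≤ ‖z + n + 1 / 2‖ := by
          rw [← hre]; exact (le_abs_self _).trans (abs_re_le_norm _)
        have hx : 3 / 2 ≤ z.re + n := by have : (0 : ℝ) ≤ n := by positivity
                                         linarith
        set x := z.re + n
        have h3 : 19 / 100 / ‖z + n + 1 / 2‖ ^ 3 ≤ 19 / 100 / (x + 1 / 2) ^ 3 := by gcongr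
        have h4 : 19 / 100 / (x + 1 / 2) ^ 3 ≤ 19 / 200 / x ^ 2 - 19 / 200 / (x + 1) ^ 2 := by
          have hx0 : 0 < x := by linarith
          rw [div_sub_div _ _ (by positivity) (by positivity), div_le_div_iff₀ (by positivity)
            (by positivity)]
          nlinarith [pow_pos hx0 2, pow_pos hx0 3]
        push_cast
        rw [← add_assoc]
        linarith
    refine (norm_sum_le _ _).trans ((this (n + 1)).trans ?_)
    have : 0 ≤ 19 / 200 / (z.re + (n + 1 : ℕ)) ^ 2 := by positivity
    linarith
  · refine le_of_tendsto (hlim2.mul_const |z.im|) (Eventually.of_forall fun n ↦ ?_)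
    have : ∀ n : ℕ, ∑ k ∈ Finset.range n, ‖g k‖ * |z.im| ≤
        19 / 100 / z.re - 19 / 100 / (z.re + n) := by
      intro n
      induction n with
      | zero => simp
      | succ n ih =>
        rw [Finset.sum_range_succ]
        have h1 := hgb n
        have h2 : z.re + n + 1 / 2 ≤ ‖z + n + 1 / 2‖ := by
          rw [← hre]; exact (le_abs_self _).trans (abs_re_le_norm _)
        have h2' : |z.im| ≤ ‖z + n + 1 / 2‖ := by
          rw [← him n]; exact abs_im_le_norm _
        have hx : 3 / 2 ≤ z.re + n := by have : (0 : ℝ) ≤ n := by positivity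
                                         linarith
        set x := z.re + n
        set N := ‖z + n + 1 / 2‖
        have hN : 0 < N := by linarith
        have h3 : ‖g n‖ * |z.im| ≤ 19 / 100 / (x + 1 / 2) ^ 2 := by
          calc ‖g n‖ * |z.im| ≤ 19 / 100 / N ^ 3 * N := by gcongr
            _ = 19 / 100 / N ^ 2 := by field_simp
            _ ≤ _ := by gcongr
        have h4 : 19 / 100 / (x + 1 / 2) ^ 2 ≤ 19 / 100 / x - 19 / 100 / (x + 1) := by
          have hx0 : 0 < x := by linarith
          rw [div_sub_div _ _ (by positivity) (by positivity), div_le_div_iff₀ (by positivity)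
            (by positivity)]
          nlinarith [pow_pos hx0 2, pow_pos hx0 3]
        push_cast
        rw [← add_assoc]
        linarith
    have h5 := this (n + 1)
    rw [← Finset.sum_mul] at h5
    refine (mul_le_mul_of_nonneg_right (norm_sum_le _ _) (abs_nonneg _)).trans (h5.trans ?_)
    have : 0 ≤ 19 / 100 / (z.re + (n + 1 : ℕ)) := by positivity
    linarith

theorem neg_logDeriv_riemannZeta_eq {s : ℂ} (hs : 1 < s.re) :
    -deriv riemannZeta s / riemannZeta s = 1 / (s - 1) - Real.log Real.pi / 2 +
      digamma (s / 2 + 1) / 2 - logDeriv riemannXi s := by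
  have h1 : s ≠ 1 := by rintro rfl; simp at hs
  have h0 : s ≠ 0 := by rintro rfl; simp at hs; linarith
  have hz : riemannZeta s ≠ 0 := riemannZeta_ne_zero_of_one_lt_re hs
  have hs2 : 0 < (s / 2).re := by simp; linarith
  have hnat : ∀ m : ℕ, s / 2 ≠ -m := fun m h ↦ by
    rw [h] at hs2
    simp at hs2
    have : (0 : ℝ) ≤ m := by positivity
    linarith
  have hG : Gamma (s / 2) ≠ 0 := Gamma_ne_zero_of_re_pos hs2
  have hpi : (Real.pi : ℂ) ≠ 0 := by exact_mod_cast Real.pi_pos.ne'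
  have hd1 : HasDerivAt (fun s : ℂ ↦ (Real.pi : ℂ) ^ (-s / 2))
      ((Real.pi : ℂ) ^ (-s / 2) * log Real.pi * (-1 / 2)) s := by
    have : HasDerivAt (fun s : ℂ ↦ -s / 2) (-1 / 2) s := ((hasDerivAt_id s).neg).div_const 2
    exact this.const_cpow (Or.inl hpi)
  have hd2 : HasDerivAt (fun s : ℂ ↦ Gamma (s / 2)) (deriv Gamma (s / 2) * (1 / 2)) s := by
    have h3 : HasDerivAt (fun s : ℂ ↦ s / 2) (1 / 2) s := (hasDerivAt_id s).div_const 2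
    exact (differentiableAt_Gamma _ hnat).hasDerivAt.comp s h3
  have hd3 := (differentiableAt_riemannZeta h1).hasDerivAt
  have hd0 : HasDerivAt (fun s : ℂ ↦ s * (s - 1)) (1 * (s - 1) + s * 1) s :=
    (hasDerivAt_id s).mul ((hasDerivAt_id s).sub_const 1)
  have hd := hd0.mul ((hd1.mul hd2).mul hd3)
  have hev : riemannXi =ᶠ[𝓝 s] fun s ↦ s * (s - 1) *
      ((Real.pi : ℂ) ^ (-s / 2) * Gamma (s / 2) * riemannZeta s) := by
    have : {s : ℂ | 1 < s.re} ∈ 𝓝 s := (isOpen_lt continuous_const continuous_re).mem_nhds hs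
    filter_upwards [this] with w hw
    have hw1 : 1 < w.re := hw
    exact riemannXi_eq (by linarith) (by rintro rfl; simp at hw1)
  have hdX := hd.congr_of_eventuallyEq hev
  have hdig : digamma (s / 2 + 1) = deriv Gamma (s / 2) / Gamma (s / 2) + (s / 2)⁻¹ := by
    rw [digamma_apply_add_one _ hnat, digamma_def, logDeriv_apply]
  have hp0 : (Real.pi : ℂ) ^ (-s / 2) ≠ 0 := by simp [cpow_eq_zero_iff, hpi]
  have hs1 : s - 1 ≠ 0 := sub_ne_zero.mpr h1
  rw [logDeriv_apply, hdX.deriv, hev.self_of_nhds, hdig, ofReal_log Real.pi_pos.le]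
  simp only [Pi.mul_apply]
  field_simp
  ring

theorem sum_mul_re_neg_logDeriv_riemannZeta_nonneg {ι : Type*} [Fintype ι] {a : ℕ → ℝ} {N : ℕ}
    (hP : ∀ θ : ℝ, 0 ≤ ∑ k ∈ Finset.range N, a k * Real.cos (k * θ))
    {c b : ι → ℂ} (hb : ∀ j, 0 < (b j).re)
    (hFim : ∀ u : ℝ, (∑ j, c j * exp (-(b j * u))).im = 0)
    (hF : ∀ u : ℝ, Real.log 2 ≤ u → 0 ≤ (∑ j, c j * exp (-(b j * u))).re) (γ : ℝ) :
    0 ≤ ∑ k ∈ Finset.range N, a k * (∑ j, c j * (-deriv riemannZeta (1 + b j + k * γ * I) /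
      riemannZeta (1 + b j + k * γ * I))).re := by
  set Λ := ArithmeticFunction.vonMangoldt
  have hre : ∀ (k : ℕ) j, 1 < (1 + b j + k * γ * I).re := fun k j ↦ by
    simpa using hb j
  have hsum : ∀ (k : ℕ) j, HasSum (LSeries.term (fun n ↦ (Λ n : ℂ)) (1 + b j + k * γ * I))
      (-deriv riemannZeta (1 + b j + k * γ * I) / riemannZeta (1 + b j + k * γ * I)) := by
    intro k j
    rw [← ArithmeticFunction.LSeries_vonMangoldt_eq_deriv_riemannZeta_div (hre k j)]
    exact (ArithmeticFunction.LSeriesSummable_vonMangoldt (hre k j)).LSeriesHasSum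
  have hsum2 : HasSum (fun n ↦ ∑ k ∈ Finset.range N, a k * (∑ j, c j *
      LSeries.term (fun n ↦ (Λ n : ℂ)) (1 + b j + k * γ * I) n).re)
      (∑ k ∈ Finset.range N, a k * (∑ j, c j * (-deriv riemannZeta (1 + b j + k * γ * I) /
      riemannZeta (1 + b j + k * γ * I))).re) :=
    hasSum_sum fun k _ ↦ (hasSum_re (hasSum_sum fun j _ ↦ (hsum k j).mul_left (c j))).mul_left _
  refine hsum2.nonneg fun n ↦ ?_
  rcases Nat.lt_or_ge n 2 with hn | hn
  · have h0 : ∀ s, LSeries.term (fun n ↦ (Λ n : ℂ)) s n = 0 := by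
      intro s
      interval_cases n <;> simp [LSeries.term, Λ]
    simp [h0]
  have hn0 : n ≠ 0 := by lia
  have hnpos : (0 : ℝ) < n := by exact_mod_cast Nat.pos_of_ne_zero hn0
  set u := Real.log n
  set F := ∑ j, c j * exp (-(b j * u))
  have hu : Real.log 2 ≤ u := Real.log_le_log (by norm_num) (by exact_mod_cast hn)
  have hFr : F = (F.re : ℂ) := by
    apply Complex.ext
    · simp
    · rw [ofReal_im]; exact hFim u
  have hterm : ∀ k : ℕ, (∑ j, c j * LSeries.term (fun n ↦ (Λ n : ℂ)) (1 + b j + k * γ * I) n).re =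
      Λ n / n * F.re * Real.cos (k * (γ * u)) := by
    intro k
    have e1 : ∀ j, c j * LSeries.term (fun n ↦ (Λ n : ℂ)) (1 + b j + k * γ * I) n =
        (Λ n / n : ℝ) * exp (((-(k * (γ * u)) : ℝ) : ℂ) * I) * (c j * exp (-(b j * u))) := by
      intro j
      rw [LSeries.term_of_ne_zero hn0, cpow_def_of_ne_zero (by exact_mod_cast hn0), ← natCast_log]
      change c j * ((Λ n : ℂ) / exp ((u : ℂ) * _)) = _
      have : (u : ℂ) * (1 + b j + k * γ * I) = u - ((-(k * (γ * u)) : ℝ) : ℂ) * I - (-(b j * u)) := by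
        push_cast; ring
      rw [this, exp_sub, exp_sub, ← ofReal_exp, Real.exp_log hnpos]
      have := exp_ne_zero (((-(k * (γ * u)) : ℝ) : ℂ) * I)
      have := exp_ne_zero (-(b j * u))
      push_cast at *
      field_simp
    rw [Finset.sum_congr rfl fun j _ ↦ e1 j, ← Finset.mul_sum]
    change ((_ * _) * F).re = _
    rw [hFr, mul_assoc, re_ofReal_mul, re_mul_ofReal, exp_ofReal_mul_I_re, Real.cos_neg, ofReal_re]
    ring
  rw [Finset.sum_congr rfl fun k _ ↦ by rw [hterm k]]
  have : ∑ k ∈ Finset.range N, a k * (Λ n / n * F.re * Real.cos (k * (γ * u))) =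
      Λ n / n * F.re * ∑ k ∈ Finset.range N, a k * Real.cos (k * (γ * u)) := by
    rw [Finset.mul_sum]
    exact Finset.sum_congr rfl fun _ _ ↦ by ring
  rw [this]
  have h1 : 0 ≤ Λ n := ArithmeticFunction.vonMangoldt_nonneg
  exact mul_nonneg (mul_nonneg (by positivity) (hF u hu)) (hP _)

/-- The rational function `z ↦ ∑ j, c j / (z + b j)`. -/
noncomputable def ratKernel {ι : Type} [Fintype ι] (c b : ι → ℂ) (z : ℂ) : ℂ :=
  ∑ j, c j * (1 / (z + b j))

/-- The real part of a rational kernel, symmetrized under reflection in the critical line. -/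
noncomputable def symmKernel {ι : Type} [Fintype ι] (c b : ι → ℂ) (z : ℂ) : ℝ :=
  (ratKernel c b z).re + (ratKernel c b (1 - conj z)).re

theorem one_le_analyticOrderNatAt_riemannXi {r : ℂ} (hr : riemannXi (1 / 2 + r) = 0) :
    1 ≤ analyticOrderNatAt (fun w ↦ riemannXi (1 / 2 + w)) r := by
  have hd : Differentiable ℂ (fun w ↦ riemannXi (1 / 2 + w)) :=
    differentiable_riemannXi.comp (by fun_prop)
  have hx : (fun w ↦ riemannXi (1 / 2 + w)) (3 / 2) ≠ 0 := by
    have : (1 / 2 + 3 / 2 : ℂ) = 2 := by norm_num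
    simp only [this]
    exact riemannXi_two_ne_zero
  have h1 := entire_analyticOrderAt_ne_top hd hx r
  have h2 : analyticOrderAt (fun w ↦ riemannXi (1 / 2 + w)) r ≠ 0 := by
    rw [Ne, (hd.analyticAt r).analyticOrderAt_eq_zero]
    simpa using hr
  rw [Nat.one_le_iff_ne_zero]
  intro h
  rcases ENat.toNat_eq_zero.mp h with h | h
  · exact h2 h
  · exact h1 h

theorem sum_symmKernel_le {ι : Type} [Fintype ι] {c b : ι → ℂ} (hb : ∀ j, 0 < (b j).re)
    (hc : (∑ j, c j).im = 0) {w : ℂ} (hw : w.re = 1)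
    (hpos : ∀ ρ, riemannXi ρ = 0 → 0 ≤ symmKernel c b (w - ρ))
    {Z : Finset ℂ} (hZ : ∀ ρ ∈ Z, riemannXi ρ = 0) :
    ∑ ρ ∈ Z, symmKernel c b (w - ρ) / 2 ≤ (∑ j, c j * logDeriv riemannXi (w + b j)).re := by
  classical
  obtain ⟨S, hS, hlim⟩ := exists_finset_tendsto_re_sum_logDeriv_riemannXi
  have h1 := hlim c (fun j ↦ w + b j) hc fun j ↦
    riemannXi_ne_zero_of_one_le_re (by simpa [hw] using (hb j).le)
  refine ge_of_tendsto h1 ?_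
  set M := ∑ ρ ∈ Z, ‖ρ - 1 / 2‖
  filter_upwards [eventually_ge_atTop ⌈M⌉₊] with n hn
  have hMn : M ≤ n := (Nat.le_ceil M).trans (by exact_mod_cast hn)
  have hw' : conj w = 2 - w := by
    apply Complex.ext
    · simp [hw]; norm_num
    · simp
  have hterm : ∀ r : ℂ, (∑ j, c j * (1 / (w + b j - 1 / 2 - r))).re +
      (∑ j, c j * (1 / (w + b j - 1 / 2 + conj r))).re = symmKernel c b (w - (1 / 2 + r)) := by
    intro r
    rw [symmKernel, ratKernel, ratKernel]
    congr 2
    · refine Finset.sum_congr rfl fun j _ ↦ ?_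
      congr 2; ring
    · refine Finset.sum_congr rfl fun j _ ↦ ?_
      congr 2
      simp only [map_sub, hw', map_add, map_div₀, map_one, map_ofNat]
      ring
  simp only [hterm]
  have hinj : ∀ x ∈ Z, ∀ y ∈ Z, x - 1 / 2 = y - 1 / 2 → x = y := by
    intro x _ y _ h
    simpa using h
  have hsub : Z.image (fun ρ ↦ ρ - 1 / 2) ⊆ S n := by
    intro r hr
    obtain ⟨ρ, hρ, rfl⟩ := Finset.mem_image.mp hr
    refine (hS n _).mpr ⟨by simpa using hZ ρ hρ, le_trans ?_ hMn⟩
    exact Finset.single_le_sum (f := fun ρ : ℂ ↦ ‖ρ - 1 / 2‖) (fun _ _ ↦ norm_nonneg _) hρ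
  calc ∑ ρ ∈ Z, symmKernel c b (w - ρ) / 2
      = ∑ r ∈ Z.image (fun ρ ↦ ρ - 1 / 2), symmKernel c b (w - (1 / 2 + r)) / 2 := by
        rw [Finset.sum_image hinj]
        refine Finset.sum_congr rfl fun ρ _ ↦ ?_
        congr 3; ring
    _ ≤ ∑ r ∈ S n, symmKernel c b (w - (1 / 2 + r)) / 2 := by
        refine Finset.sum_le_sum_of_subset_of_nonneg hsub fun r hr _ ↦ ?_
        have := hpos _ ((hS n r).mp hr).1
        positivity
    _ ≤ _ := by
        refine Finset.sum_le_sum fun r hr ↦ ?_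
        have h2 := hpos _ ((hS n r).mp hr).1
        have h3 : (1 : ℝ) ≤ analyticOrderNatAt (fun w ↦ riemannXi (1 / 2 + w)) r := by
          exact_mod_cast one_le_analyticOrderNatAt_riemannXi ((hS n r).mp hr).1
        exact le_mul_of_one_le_left (by positivity) h3

theorem sum_mul_sum_symmKernel_le {ι : Type} [Fintype ι] {a : ℕ → ℝ} {N : ℕ}
    (ha : ∀ k, 0 ≤ a k) (hP : ∀ θ : ℝ, 0 ≤ ∑ k ∈ Finset.range N, a k * Real.cos (k * θ))
    {c b : ι → ℂ} (hb : ∀ j, 0 < (b j).re)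
    (hFim : ∀ u : ℝ, (∑ j, c j * exp (-(b j * u))).im = 0)
    (hF : ∀ u : ℝ, Real.log 2 ≤ u → 0 ≤ (∑ j, c j * exp (-(b j * u))).re) (γ : ℝ)
    (hpos : ∀ k ∈ Finset.range N, ∀ ρ, riemannXi ρ = 0 → 0 ≤ symmKernel c b (1 + k * γ * I - ρ))
    {Z : ℕ → Finset ℂ} (hZ : ∀ k, ∀ ρ ∈ Z k, riemannXi ρ = 0) :
    ∑ k ∈ Finset.range N, a k * ∑ ρ ∈ Z k, symmKernel c b (1 + k * γ * I - ρ) / 2 ≤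
      ∑ k ∈ Finset.range N, a k * (∑ j, c j * (1 / (b j + k * γ * I) - Real.log Real.pi / 2 +
        digamma ((3 + b j + k * γ * I) / 2) / 2)).re := by
  have h1 := sum_mul_re_neg_logDeriv_riemannZeta_nonneg hP hb hFim hF γ
  have hc : (∑ j, c j).im = 0 := by simpa using hFim 0
  have h2 : ∀ k ∈ Finset.range N, a k * ∑ ρ ∈ Z k, symmKernel c b (1 + k * γ * I - ρ) / 2 ≤
      a k * (∑ j, c j * logDeriv riemannXi (1 + k * γ * I + b j)).re := fun k hk ↦
    mul_le_mul_of_nonneg_left (sum_symmKernel_le hb hc (by simp) (hpos k hk) (hZ k)) (ha k)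
  have h3 : ∀ k : ℕ, (∑ j, c j * (-deriv riemannZeta (1 + b j + k * γ * I) /
      riemannZeta (1 + b j + k * γ * I))).re =
      (∑ j, c j * (1 / (b j + k * γ * I) - Real.log Real.pi / 2 +
        digamma ((3 + b j + k * γ * I) / 2) / 2)).re -
      (∑ j, c j * logDeriv riemannXi (1 + k * γ * I + b j)).re := by
    intro k
    rw [← sub_re, ← Finset.sum_sub_distrib]
    congr 1
    refine Finset.sum_congr rfl fun j _ ↦ ?_
    rw [neg_logDeriv_riemannZeta_eq (by simpa using hb j), ← mul_sub]
    have e1 : (1 : ℂ) + b j + k * γ * I - 1 = b j + k * γ * I := by ring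
    have e2 : (1 + b j + k * γ * I) / 2 + 1 = (3 + b j + k * γ * I) / 2 := by ring
    have e3 : (1 : ℂ) + b j + k * γ * I = 1 + k * γ * I + b j := by ring
    rw [e1, e2, e3]
  simp only [h3, mul_sub, Finset.sum_sub_distrib] at h1
  have h4 := Finset.sum_le_sum h2
  linarith

theorem log_pi_gt : 1.144 < Real.log Real.pi := by
  rw [Real.lt_log_iff_exp_lt Real.pi_pos]
  have h1 : Real.exp 0.144 ≤ 1.1549 :=
    (Real.exp_bound' (x := 0.144) (by norm_num) (by norm_num) (n := 4) (by norm_num)).trans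
      (by norm_num [Finset.sum_range_succ, Nat.factorial])
  have h2 := Real.exp_one_lt_d9
  have h3 : Real.exp 1.144 = Real.exp 1 * Real.exp 0.144 := by rw [← Real.exp_add]; norm_num
  have h4 := Real.pi_gt_d4
  have h5 := Real.exp_pos 1
  rw [h3]
  nlinarith

theorem re_digamma_le {z : ℂ} (hz : 3 / 2 ≤ z.re) :
    (digamma z).re ≤ Real.log ‖z‖ - (1 / (2 * z)).re + 19 / 200 / z.re ^ 2 := by
  have h1 := (norm_digamma_sub_le hz).1
  have h2 := (abs_le.mp ((abs_re_le_norm _).trans h1)).2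
  rw [add_re, sub_re, log_re] at h2
  linarith

theorem two_lt_abs_im_of_riemannXi_eq_zero {ρ : ℂ} (h0 : riemannXi ρ = 0) (hre : ρ.re ≠ 1 / 2) :
    2 < |ρ.im| := by
  classical
  by_contra! hle
  obtain ⟨hp0, hp1⟩ := re_mem_Ioo_of_riemannXi_eq_zero h0
  have hsymm : ∀ z, symmKernel (fun _ : Unit ↦ 1) (fun _ ↦ 1) z =
      (1 + z.re) / ((1 + z.re) ^ 2 + z.im ^ 2) + (2 - z.re) / ((2 - z.re) ^ 2 + z.im ^ 2) := by
    intro z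
    simp only [symmKernel, ratKernel, Finset.univ_unique, Finset.sum_const, Finset.card_singleton,
      one_smul, one_mul, one_div, inv_re, normSq_apply, add_re, sub_re, one_re, conj_re, add_im,
      one_im, sub_im, conj_im]
    ring
  have hge : ∀ z : ℂ, riemannXi z = 0 → ∀ m : ℝ, (∀ u ∈ Icc (1 : ℝ) 2, m ≤ u / (u ^ 2 + z.im ^ 2)) →
      2 * m ≤ symmKernel (fun _ : Unit ↦ 1) (fun _ ↦ 1) (1 - z) := by
    intro z hz m hm
    obtain ⟨h1, h2⟩ := re_mem_Ioo_of_riemannXi_eq_zero hz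
    rw [hsymm]
    have e1 := hm (1 + (1 - z).re) ⟨by simp; linarith, by simp; linarith⟩
    have e2 := hm (2 - (1 - z).re) ⟨by simp; linarith, by simp; linarith⟩
    have : (1 - z).im ^ 2 = z.im ^ 2 := by simp
    rw [this]
    linarith
  have hpos : ∀ z : ℂ, riemannXi z = 0 →
      0 ≤ symmKernel (fun _ : Unit ↦ 1) (fun _ ↦ 1) (1 - z) := fun z hz ↦ by
    have := hge z hz 0 fun u hu ↦ by have := hu.1; positivity
    linarith
  have hc0 : riemannXi (conj ρ) = 0 := by rw [riemannXi_conj, h0, map_zero]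
  have hs0 : riemannXi (1 - ρ) = 0 := by rw [riemannXi_one_sub, h0]
  have hsc0 : riemannXi (1 - conj ρ) = 0 := by rw [riemannXi_one_sub, hc0]
  have key : ∀ Z : Finset ℂ, (∀ z ∈ Z, riemannXi z = 0) →
      ∑ z ∈ Z, symmKernel (fun _ : Unit ↦ 1) (fun _ ↦ 1) (1 - z) / 2 < 0.67 := by
    intro Z hZ
    have h := sum_mul_sum_symmKernel_le (a := fun _ ↦ 1) (N := 1) (c := fun _ : Unit ↦ 1)
      (b := fun _ ↦ 1) (by simp) (by simp) (by simp) (fun u ↦ by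
        simp only [one_mul, Finset.univ_unique, Finset.sum_const, Finset.card_singleton, one_smul]
        rw [← ofReal_neg, exp_ofReal_im])
      (fun u _ ↦ by
        simp only [one_mul, Finset.univ_unique, Finset.sum_const, Finset.card_singleton, one_smul]
        rw [← ofReal_neg, exp_ofReal_re]; positivity) 0
      (fun k _ z hz ↦ by simpa using hpos z hz) (Z := fun _ ↦ Z) (fun _ ↦ hZ)
    simp only [Finset.range_one, Finset.sum_singleton, one_mul, Nat.cast_zero, zero_mul, ofReal_zero,
      add_zero, Finset.univ_unique, Finset.sum_const, Finset.card_singleton, one_smul] at h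
    refine h.trans_lt ?_
    have e1 : ((3 + 1) / 2 : ℂ) = 2 := by norm_num
    have e2 := re_digamma_le (z := 2) (by norm_num)
    have e3 : ((1 : ℂ) / 1 - Real.log Real.pi / 2 + digamma 2 / 2).re =
        1 - Real.log Real.pi / 2 + (digamma 2).re / 2 := by
      simp
    have e4 : (1 / (2 * 2) : ℂ).re = 1 / 4 := by
      have : (1 / (2 * 2) : ℂ) = ((1 / 4 : ℝ) : ℂ) := by push_cast; norm_num
      rw [this, ofReal_re]
    rw [e4] at e2
    norm_num at e2
    rw [e1, e3]
    have := log_pi_gt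
    have := Real.log_two_lt_d9
    norm_num at *
    linarith
  have hne1 : ρ ≠ 1 - ρ := fun h ↦ hre (by
    have := congrArg re h
    simp at this
    linarith)
  rcases le_or_gt (|ρ.im|) 1 with hle1 | hgt1
  · have h := key {ρ, 1 - ρ} (by simp [h0, hs0])
    rw [Finset.sum_pair hne1] at h
    have him : ρ.im ^ 2 ≤ 1 := by rw [← sq_abs]; nlinarith [abs_nonneg ρ.im]
    have hm : ∀ u ∈ Icc (1 : ℝ) 2, (0.4 : ℝ) ≤ u / (u ^ 2 + ρ.im ^ 2) := fun u hu ↦ by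
      obtain ⟨hu1, hu2⟩ := hu
      rw [le_div_iff₀ (by positivity)]
      nlinarith
    have e1 := hge ρ h0 0.4 hm
    have e2 := hge (1 - ρ) hs0 0.4 (by simpa using hm)
    linarith
  · have hm : ∀ u ∈ Icc (1 : ℝ) 2, (0.2 : ℝ) ≤ u / (u ^ 2 + ρ.im ^ 2) := fun u hu ↦ by
      obtain ⟨hu1, hu2⟩ := hu
      have him : ρ.im ^ 2 ≤ 4 := by rw [← sq_abs]; nlinarith [abs_nonneg ρ.im]
      rw [le_div_iff₀ (by positivity)]
      nlinarith
    have him0 : ρ.im ≠ 0 := fun h ↦ by rw [h] at hgt1; norm_num at hgt1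
    have n1 : ρ ≠ conj ρ := fun h ↦ him0 (conj_eq_iff_im.mp h.symm)
    have n2 : ρ ≠ 1 - conj ρ := fun h ↦ hre (by
      have := congrArg re h
      simp at this
      linarith)
    have n3 : conj ρ ≠ 1 - ρ := fun h ↦ n2 (by
      have := congrArg conj h
      simpa using this)
    have n4 : conj ρ ≠ 1 - conj ρ := fun h ↦ hne1 (by
      have := congrArg conj h
      simpa using this)
    have n5 : 1 - ρ ≠ 1 - conj ρ := fun h ↦ n1 (by simpa using h)
    have h := key {ρ, conj ρ, 1 - ρ, 1 - conj ρ} (by simp [h0, hs0, hc0, hsc0])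
    rw [Finset.sum_insert (by simp only [Finset.mem_insert, Finset.mem_singleton]; tauto),
      Finset.sum_insert (by simp only [Finset.mem_insert, Finset.mem_singleton]; tauto),
      Finset.sum_pair n5] at h
    have e1 := hge ρ h0 0.2 hm
    have e2 := hge (1 - ρ) hs0 0.2 (by simpa using hm)
    have e3 := hge (conj ρ) hc0 0.2 (by simpa using hm)
    have e4 := hge (1 - conj ρ) hsc0 0.2 (by simpa using hm)
    linarith

/-- Fourier coefficients of `(0.91 + cos θ)² (0.28 + cos θ)²`. -/
noncomputable def cosCoeff : ℕ → ℝ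
  | 0 => 1.40277304
  | 1 => 2.391424
  | 2 => 1.46285
  | 3 => 0.595
  | 4 => 0.125
  | _ => 0

theorem cosCoeff_nonneg (k : ℕ) : 0 ≤ cosCoeff k := by
  unfold cosCoeff
  split <;> norm_num

theorem sum_cosCoeff_mul_cos_nonneg (θ : ℝ) :
    0 ≤ ∑ k ∈ Finset.range 5, cosCoeff k * Real.cos (k * θ) := by
  have h4 : Real.cos (4 * θ) = 2 * (2 * Real.cos θ ^ 2 - 1) ^ 2 - 1 := by
    rw [show 4 * θ = 2 * (2 * θ) by ring, Real.cos_two_mul, Real.cos_two_mul]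
  have : ∑ k ∈ Finset.range 5, cosCoeff k * Real.cos (k * θ) =
      (0.91 + Real.cos θ) ^ 2 * (0.28 + Real.cos θ) ^ 2 := by
    simp only [Finset.sum_range_succ, Finset.sum_range_zero, cosCoeff, Nat.cast_zero, Nat.cast_one,
      Nat.cast_ofNat, zero_mul, one_mul, Real.cos_zero, Real.cos_two_mul, Real.cos_three_mul, h4]
    ring
  rw [this]
  positivity

theorem two_mul_symmKernel_one_sub {ι : Type} [Fintype ι] {c b : ι → ℂ} {ρ : ℂ} {γ : ℝ}
    (hγ : ρ.im = γ) :
    symmKernel c b (1 + (1 : ℕ) * γ * I - ρ) / 2 + symmKernel c b (1 + (1 : ℕ) * γ * I -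
      (1 - conj ρ)) / 2 = symmKernel c b ((1 - ρ.re : ℝ) : ℂ) := by
  have e1 : 1 + (1 : ℕ) * γ * I - ρ = ((1 - ρ.re : ℝ) : ℂ) := by
    apply Complex.ext <;> simp [hγ]
  have e2 : 1 + (1 : ℕ) * γ * I - (1 - conj ρ) = ((ρ.re : ℝ) : ℂ) := by
    apply Complex.ext <;> simp [hγ]
  rw [e1, e2]
  have e3 : 1 - conj ((ρ.re : ℝ) : ℂ) = ((1 - ρ.re : ℝ) : ℂ) := by simp
  have e4 : 1 - conj (((1 - ρ.re : ℝ)) : ℂ) = ((ρ.re : ℝ) : ℂ) := by simp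
  rw [symmKernel, symmKernel, e3, e4]
  ring

theorem cosCoeff_one_mul_symmKernel_le {ι : Type} [Fintype ι]
    {c b : ι → ℂ} (hb : ∀ j, 0 < (b j).re)
    (hFim : ∀ u : ℝ, (∑ j, c j * exp (-(b j * u))).im = 0)
    (hF : ∀ u : ℝ, Real.log 2 ≤ u → 0 ≤ (∑ j, c j * exp (-(b j * u))).re) {ρ : ℂ}
    (h0 : riemannXi ρ = 0) (hre : ρ.re ≠ 1 / 2)
    (hpos : ∀ k : ℕ, k < 5 → ∀ z, riemannXi z = 0 → 0 ≤ symmKernel c b (1 + k * ρ.im * I - z)) :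
    2.391424 * symmKernel c b ((1 - ρ.re : ℝ) : ℂ) ≤
      ∑ k ∈ Finset.range 5, cosCoeff k * (∑ j, c j * (1 / (b j + k * ρ.im * I) -
        Real.log Real.pi / 2 + digamma ((3 + b j + k * ρ.im * I) / 2) / 2)).re := by
  classical
  have hne : ρ ≠ 1 - conj ρ := fun h ↦ hre (by
    have := congrArg re h
    simp at this
    linarith)
  have hs0 : riemannXi (1 - conj ρ) = 0 := by
    rw [riemannXi_one_sub, riemannXi_conj, h0, map_zero]
  have h := sum_mul_sum_symmKernel_le cosCoeff_nonneg sum_cosCoeff_mul_cos_nonneg hb hFim hF ρ.im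
    (fun k hk ↦ hpos k (Finset.mem_range.mp hk)) (Z := fun k ↦ if k = 1 then {ρ, 1 - conj ρ} else ∅)
    (fun k z hz ↦ by
      split_ifs at hz
      · simp only [Finset.mem_insert, Finset.mem_singleton] at hz
        rcases hz with rfl | rfl <;> assumption
      · simp at hz)
  refine le_trans (le_of_eq ?_) h
  rw [Finset.sum_eq_single 1 (by intro k _ hk; simp [hk]) (by simp), if_pos rfl, Finset.sum_pair hne,
    two_mul_symmKernel_one_sub rfl]
  rfl

theorem re_log_derivative_term_le {η γ Q : ℝ} {k : ℕ} (hη : 0 < η) (hγ : 0 < γ) (hk : k ≠ 0)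
    (hQ : ((3 + 3 * η) / 2) ^ 2 ≤ Q * γ ^ 2) :
    (1 / (((3 * η : ℝ) : ℂ) + k * γ * I) - Real.log Real.pi / 2 +
      digamma ((3 + ((3 * η : ℝ) : ℂ) + k * γ * I) / 2) / 2).re ≤
      3 * η / (k ^ 2 * γ ^ 2) - 0.572 + (Real.log γ + Real.log (Q + k ^ 2 / 4) / 2 + 0.0423) / 2 := by
  have hk' : (0 : ℝ) < k := by exact_mod_cast Nat.pos_of_ne_zero hk
  set z : ℂ := (3 + ((3 * η : ℝ) : ℂ) + k * γ * I) / 2 with hz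
  have hre : z.re = (3 + 3 * η) / 2 := by simp [z]
  have him : z.im = k * γ / 2 := by simp [z]
  have hQ0 : 0 < Q := by
    by_contra! h
    have : Q * γ ^ 2 ≤ 0 := mul_nonpos_of_nonpos_of_nonneg h (by positivity)
    have : 0 < ((3 + 3 * η) / 2) ^ 2 := by positivity
    linarith
  have h1 := re_digamma_le (z := z) (by rw [hre]; linarith)
  have h2 : 0 ≤ (1 / (2 * z)).re := by
    rw [one_div, inv_re]
    refine div_nonneg ?_ (normSq_nonneg _)
    simp [hre]
    linarith
  have h3 : 19 / 200 / z.re ^ 2 ≤ 0.0423 := by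
    rw [hre, div_le_iff₀ (by positivity)]
    nlinarith
  have h4 : Real.log ‖z‖ ≤ Real.log γ + Real.log (Q + k ^ 2 / 4) / 2 := by
    have e1 : ‖z‖ ^ 2 ≤ γ ^ 2 * (Q + k ^ 2 / 4) := by
      rw [← normSq_eq_norm_sq, normSq_apply, hre, him]
      nlinarith
    have hz0 : 0 < ‖z‖ := norm_pos_iff.mpr fun h ↦ by
      rw [h, zero_im] at him
      have : 0 < k * γ / 2 := by positivity
      linarith
    have e2 := Real.log_le_log (by positivity) e1
    rw [Real.log_mul (by positivity) (by positivity), Real.log_pow, Real.log_pow] at e2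
    push_cast at e2
    linarith
  have h5 : (1 / (((3 * η : ℝ) : ℂ) + k * γ * I)).re ≤ 3 * η / (k ^ 2 * γ ^ 2) := by
    rw [one_div, inv_re, normSq_apply]
    simp only [add_re, ofReal_re, mul_re, natCast_re, natCast_im, ofReal_im, I_re, I_im, add_im,
      mul_im]
    have e1 : 3 * η + ((k * γ - 0 * 0) * 0 - (k * 0 + 0 * γ) * 1) = 3 * η := by ring
    have e2 : 0 + ((k * γ - 0 * 0) * 1 + (k * 0 + 0 * γ) * 0) = k * γ := by ring
    rw [e1, e2]
    refine div_le_div_of_nonneg_left (by positivity) (by positivity) ?_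
    nlinarith [sq_nonneg η]
  have h6 := log_pi_gt
  rw [add_re, sub_re]
  have e7 : ((Real.log Real.pi : ℂ) / 2).re = Real.log Real.pi / 2 := by simp
  have e8 : (digamma z / 2).re = (digamma z).re / 2 := by simp
  rw [e7, e8]
  norm_num at *
  linarith

theorem log_le_nat_mul_log_two_add {x : ℝ} (hx : 0 < x) (n : ℕ) :
    Real.log x ≤ n * 0.6931471808 + (x / 2 ^ n - 1) := by
  have h1 := Real.log_le_sub_one_of_pos (show 0 < x / 2 ^ n by positivity)
  rw [Real.log_div hx.ne' (by positivity), Real.log_pow] at h1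
  have h2 := Real.log_two_lt_d9
  have h3 : (n : ℝ) * Real.log 2 ≤ n * 0.6931471808 := by gcongr
  linarith

theorem re_log_derivative_term_zero_le {x y B : ℝ} (hx : 3 / 2 ≤ x) (hxy : x ≤ y)
    (hB : Real.log y - 1 / (2 * y) + 0.0423 ≤ B) : (digamma (x : ℂ)).re ≤ B := by
  have h1 := re_digamma_le (z := (x : ℂ)) (by simpa using hx)
  have e1 : (1 / (2 * (x : ℂ))).re = 1 / (2 * x) := by
    rw [show (1 / (2 * (x : ℂ))) = ((1 / (2 * x) : ℝ) : ℂ) by push_cast; rfl, ofReal_re]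
  have e2 : ‖(x : ℂ)‖ = x := by
    rw [norm_real, Real.norm_eq_abs, abs_of_pos (by linarith)]
  have e3 : 19 / 200 / x ^ 2 ≤ 0.0423 := by
    rw [div_le_iff₀ (by positivity)]
    nlinarith
  rw [e1, e2, ofReal_re] at h1
  have h2 : Real.log x ≤ Real.log y := Real.log_le_log (by linarith) hxy
  have h3 : 1 / (2 * y) ≤ 1 / (2 * x) := one_div_le_one_div_of_le (by linarith) (by linarith)
  linarith

theorem low_zero_inequality {ρ : ℂ} {η γ Q B p : ℝ} (h0 : riemannXi ρ = 0) (hη : 0 < η)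
    (hη2 : η < 1 / 2)
    (hγ : 0 < γ) (hρ : ρ.re = 1 - η) (hρi : ρ.im = γ) (hQ : ((3 + 3 * η) / 2) ^ 2 ≤ Q * γ ^ 2)
    (hB : (digamma (((3 + 3 * η) / 2 : ℝ) : ℂ)).re ≤ B) (hp : 3 * η / γ ^ 2 ≤ p) :
    2.391424 * (1 / (4 * η) + 1 / (1 + 2 * η)) ≤ 1.40277304 * (1 / (3 * η) - 0.572 + B / 2) +
      2.391424 * (p - 0.572 + (Real.log γ + Real.log (Q + 1 / 4) / 2 + 0.0423) / 2) +
      1.46285 * (p / 4 - 0.572 + (Real.log γ + Real.log (Q + 1) / 2 + 0.0423) / 2) +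
      0.595 * (p / 9 - 0.572 + (Real.log γ + Real.log (Q + 9 / 4) / 2 + 0.0423) / 2) +
      0.125 * (p / 16 - 0.572 + (Real.log γ + Real.log (Q + 4) / 2 + 0.0423) / 2) := by
  have h := cosCoeff_one_mul_symmKernel_le (ι := Unit) (c := fun _ ↦ 1)
    (b := fun _ ↦ ((3 * η : ℝ) : ℂ)) (fun _ ↦ by rw [ofReal_re]; positivity)
    (fun u ↦ by
      simp only [Finset.univ_unique, Finset.sum_const, Finset.card_singleton, one_smul, one_mul,
        ← ofReal_mul, ← ofReal_neg, exp_ofReal_im])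
    (fun u _ ↦ by
      simp only [Finset.univ_unique, Finset.sum_const, Finset.card_singleton, one_smul, one_mul,
        ← ofReal_mul, ← ofReal_neg, exp_ofReal_re]
      positivity) h0 (by rw [hρ]; linarith)
    (fun k _ z hz ↦ by
      obtain ⟨h1, h2⟩ := re_mem_Ioo_of_riemannXi_eq_zero hz
      simp only [symmKernel, ratKernel, Finset.univ_unique, Finset.sum_const,
        Finset.card_singleton, one_smul, one_mul, one_div, inv_re]
      refine add_nonneg (div_nonneg ?_ (normSq_nonneg _)) (div_nonneg ?_ (normSq_nonneg _))
      · simp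
        linarith
      · simp
        linarith)
  have hl : symmKernel (fun _ : Unit ↦ 1) (fun _ ↦ ((3 * η : ℝ) : ℂ)) ((1 - ρ.re : ℝ) : ℂ) =
      1 / (4 * η) + 1 / (1 + 2 * η) := by
    simp only [symmKernel, ratKernel, Finset.univ_unique, Finset.sum_const, hρ, conj_ofReal,
        Finset.card_singleton, one_smul, one_mul]
    rw [← ofReal_add, ← ofReal_one, ← ofReal_sub, ← ofReal_add, ← ofReal_div, ← ofReal_div,
      ofReal_re, ofReal_re]
    ring_nf
  have h1 := re_log_derivative_term_le (k := 1) hη hγ (by norm_num) hQ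
  have h2 := re_log_derivative_term_le (k := 2) hη hγ (by norm_num) hQ
  have h3 := re_log_derivative_term_le (k := 3) hη hγ (by norm_num) hQ
  have h4 := re_log_derivative_term_le (k := 4) hη hγ (by norm_num) hQ
  have hk : ((1 / (((3 * η : ℝ) : ℂ) + (0 : ℕ) * γ * I) - Real.log Real.pi / 2 +
      digamma ((3 + ((3 * η : ℝ) : ℂ) + (0 : ℕ) * γ * I) / 2) / 2).re) ≤
      1 / (3 * η) - 0.572 + B / 2 := by
    have e1 : (3 + ((3 * η : ℝ) : ℂ) + (0 : ℕ) * γ * I) / 2 = (((3 + 3 * η) / 2 : ℝ) : ℂ) := by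
      push_cast; ring
    have e2 : 1 / (((3 * η : ℝ) : ℂ) + (0 : ℕ) * γ * I) = ((1 / (3 * η) : ℝ) : ℂ) := by
      push_cast; simp
    have e7 : ((Real.log Real.pi : ℂ) / 2).re = Real.log Real.pi / 2 := by simp
    have h6 := log_pi_gt
    rw [e1, e2, add_re, sub_re, e7, ofReal_re, div_ofNat_re]
    norm_num at *
    linarith
  have hd : ∀ m : ℝ, 0 < m → 3 * η / (m * γ ^ 2) ≤ p / m := fun m hm ↦ by
    rw [mul_comm m, ← div_div]
    gcongr
  have d1 := hd 1 one_pos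
  have d2 := hd 4 (by norm_num)
  have d3 := hd 9 (by norm_num)
  have d4 := hd 16 (by norm_num)
  rw [hl, hρi] at h
  simp only [Finset.sum_range_succ, Finset.sum_range_zero, Finset.univ_unique, Finset.sum_const,
    Finset.card_singleton, one_smul, one_mul, zero_add, cosCoeff] at h
  refine h.trans ?_
  norm_num only [Nat.cast_one, Nat.cast_ofNat] at h1 h2 h3 h4 hk d1 d2 d3 d4 ⊢
  linarith

theorem riemannXi_ne_zero_of_log_im_le_three {ρ : ℂ} (hγ : 2 ≤ ρ.im) (hL : Real.log ρ.im ≤ 3)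
    (hre : 1 / 2 < ρ.re)
    (hη : (1 - ρ.re) * (5.558691 * Real.log ρ.im) ≤ 1) : riemannXi ρ ≠ 0 := by
  intro h0
  obtain ⟨-, h1⟩ := re_mem_Ioo_of_riemannXi_eq_zero h0
  set η := 1 - ρ.re with hη'
  set γ := ρ.im
  have hη0 : 0 < η := by linarith
  have hl2 := Real.log_two_gt_d9
  have hL2 : Real.log 2 ≤ Real.log γ := Real.log_le_log (by norm_num) hγ
  have hmain : 5.558691 * Real.log γ ≤ 1 / η := by
    rw [le_div_iff₀ hη0]
    linarith
  have hη2 : η < 1 / 2 := by linarith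
  have hγ0 : 0 < γ := by linarith
  have hρη : ρ.re = 1 - η := by linarith
  have key := fun Q B p ↦ low_zero_inequality (Q := Q) (B := B) (p := p) h0 hη0 hη2 hγ0 hρη rfl
  have e1 : 1 / (4 * η) = 1 / η / 4 := by field_simp
  have e2 : 1 / (3 * η) = 1 / η / 3 := by field_simp
  rw [e1, e2] at key
  have hlog4 : Real.log 4 = 2 * Real.log 2 := by
    rw [show (4 : ℝ) = 2 ^ 2 by norm_num, Real.log_pow]; norm_num
  rcases le_total γ 4 with h4 | h4
  · have hη1 : η ≤ 0.26 := by nlinarith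
    have hL4 : Real.log γ ≤ Real.log 4 := Real.log_le_log (by linarith) h4
    have key2 := key 0.9 0.416 0.195 (by nlinarith)
      (re_log_derivative_term_zero_le (y := 1.89) (by linarith) (by linarith) (by
        have := log_le_nat_mul_log_two_add (x := 1.89) (by norm_num) 1
        norm_num at this ⊢
        linarith))
      (by rw [div_le_iff₀ (by positivity)]; nlinarith)
    have l1 := log_le_nat_mul_log_two_add (x := 0.9 + 1 / 4) (by norm_num) 0
    have l2 := log_le_nat_mul_log_two_add (x := 0.9 + 1) (by norm_num) 1
    have l3 := log_le_nat_mul_log_two_add (x := 0.9 + 9 / 4) (by norm_num) 2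
    have l4 := log_le_nat_mul_log_two_add (x := 0.9 + 4) (by norm_num) 2
    have h5 : 0.65 ≤ 1 / (1 + 2 * η) := by
      rw [le_div_iff₀ (by positivity)]
      linarith
    have hl2' := Real.log_two_lt_d9
    norm_num at key2 l1 l2 l3 l4 h5 hmain hl2 hl2' ⊢
    linarith
  · have hL4 : Real.log 4 ≤ Real.log γ := Real.log_le_log (by linarith) h4
    have hη1 : η ≤ 0.13 := by nlinarith
    have key2 := key 0.181 0.292 0.025 (by nlinarith)
      (re_log_derivative_term_zero_le (y := 1.7) (by linarith) (by linarith) (by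
        have := log_le_nat_mul_log_two_add (x := 1.7) (by norm_num) 1
        norm_num at this ⊢
        linarith))
      (by rw [div_le_iff₀ (by positivity)]; nlinarith)
    have l1 : Real.log (0.181 + 1 / 4) ≤ -0.831 := by
      have h1 := Real.log_le_sub_one_of_pos (show (0 : ℝ) < 0.862 by norm_num)
      rw [show (0.862 : ℝ) = 2 * (0.181 + 1 / 4) by norm_num,
        Real.log_mul (by norm_num) (by norm_num)] at h1
      norm_num at h1 hl2 ⊢
      linarith
    have l2 := log_le_nat_mul_log_two_add (x := 0.181 + 1) (by norm_num) 0
    have l3 := log_le_nat_mul_log_two_add (x := 0.181 + 9 / 4) (by norm_num) 1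
    have l4 := log_le_nat_mul_log_two_add (x := 0.181 + 4) (by norm_num) 2
    have h5 : 0.79 ≤ 1 / (1 + 2 * η) := by
      rw [le_div_iff₀ (by positivity)]
      linarith
    norm_num at key2 l1 l2 l3 l4 h5 hmain hl2 ⊢
    linarith

/-- Coefficients of the exponential sum `e⁻⁵ᵛ (15/8 - 7/8 cos 4v + 9/5 sin 4v - 11/40 sin 8v)`. -/
noncomputable def expCoeff : Fin 5 → ℂ :=
  ![15 / 8, -7 / 16 - 9 / 10 * I, -7 / 16 + 9 / 10 * I, 11 / 80 * I, -(11 / 80 * I)]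

/-- Exponents of the exponential sum with coefficients `expCoeff`. -/
noncomputable def expRate : Fin 5 → ℂ := ![5, 5 - 4 * I, 5 + 4 * I, 5 - 8 * I, 5 + 8 * I]

/-- Coefficients of the mollified kernel. -/
noncomputable def kerCoeff (l : ℝ) : Fin 5 ⊕ Fin 2 → ℂ :=
  Sum.elim expCoeff ![((-1.1019 * l : ℝ) : ℂ), ((0.6122 * l : ℝ) : ℂ)]

/-- Exponents of the mollified kernel. -/
noncomputable def kerRate (η κ : ℝ) : Fin 5 ⊕ Fin 2 → ℂ :=
  Sum.elim (fun j ↦ η * (expRate j - κ)) ![((1 : ℝ) : ℂ), ((3 / 2 : ℝ) : ℂ)]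

theorem sum_expCoeff : ∑ j, expCoeff j = 1 := by
  simp [expCoeff, Fin.sum_univ_five]
  ring

theorem sum_expCoeff_mul_expRate : ∑ j, expCoeff j * expRate j = 0 := by
  simp [expCoeff, expRate, Fin.sum_univ_five]
  linear_combination 5 * I_sq

theorem sum_expCoeff_mul_expRate_sq : ∑ j, expCoeff j * expRate j ^ 2 = -11 := by
  simp [expCoeff, expRate, Fin.sum_univ_five]
  ring_nf
  linear_combination 36 * I_sq

theorem expRate_re (j : Fin 5) : (expRate j).re = 5 := by
  fin_cases j <;> simp [expRate]

/-- Upper bounds for `‖expCoeff j‖`. -/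
noncomputable def expCoeffBound : Fin 5 → ℝ := ![1.875, 1.001, 1.001, 0.1375, 0.1375]

/-- Upper bounds for `‖expRate j‖`. -/
noncomputable def expRateBound : Fin 5 → ℝ := ![5, 6.4032, 6.4032, 9.434, 9.434]

theorem norm_le_of_normSq_le {z : ℂ} {r : ℝ} (hr : 0 ≤ r) (h : z.re ^ 2 + z.im ^ 2 ≤ r ^ 2) :
    ‖z‖ ≤ r := by
  refine abs_le_of_sq_le_sq' ?_ hr |>.2
  rw [← normSq_eq_norm_sq, normSq_apply]
  linarith

theorem norm_expCoeff_le (j : Fin 5) : ‖expCoeff j‖ ≤ expCoeffBound j := by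
  fin_cases j <;> refine norm_le_of_normSq_le ?_ ?_ <;>
    norm_num [expCoeff, expCoeffBound]

theorem norm_expRate_sub_le {κ : ℝ} (h0 : 0 ≤ κ) (h1 : κ ≤ 1) (j : Fin 5) :
    ‖expRate j - κ‖ ≤ expRateBound j := by
  fin_cases j <;> refine norm_le_of_normSq_le ?_ ?_ <;>
    norm_num [expRate, expRateBound] <;> nlinarith

theorem kerRate_re_pos {η κ : ℝ} (hη : 0 < η) (h1 : κ ≤ 1) (j : Fin 5 ⊕ Fin 2) :
    0 < (kerRate η κ j).re := by
  rcases j with j | j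
  · have : 0 < η * (5 - κ) := mul_pos hη (by linarith)
    simpa [kerRate, expRate_re] using this
  · fin_cases j <;> simp [kerRate]

theorem sum_expCoeff_mul_exp (v : ℝ) : ∑ j, expCoeff j * exp (-(expRate j * v)) =
    ((Real.exp (-(5 * v)) * (15 / 8 - 7 / 8 * Real.cos (4 * v) + 9 / 5 * Real.sin (4 * v) -
      11 / 20 * Real.sin (4 * v) * Real.cos (4 * v)) : ℝ) : ℂ) := by
  have h8c : Real.cos (8 * v) = 2 * Real.cos (4 * v) ^ 2 - 1 := by
    rw [← Real.cos_two_mul]; ring_nf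
  have h8s : Real.sin (8 * v) = 2 * Real.sin (4 * v) * Real.cos (4 * v) := by
    rw [← Real.sin_two_mul]; ring_nf
  have hexp : ∀ m : ℝ, exp (-((5 + m * I) * v)) = (Real.exp (-(5 * v)) : ℝ) *
      ((Real.cos (m * v) : ℝ) - (Real.sin (m * v) : ℝ) * I) := fun m ↦ by
    rw [show -((5 + m * I) * v) = ((-(5 * v) : ℝ) : ℂ) + ((-(m * v) : ℝ) : ℂ) * I by
      push_cast; ring, Complex.exp_add, exp_mul_I, ← ofReal_exp, ← ofReal_cos, ← ofReal_sin,
      Real.cos_neg, Real.sin_neg]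
    push_cast
    ring
  have e0 : (5 : ℂ) = 5 + (0 : ℝ) * I := by simp
  have e1 : 5 - 4 * I = 5 + ((-4 : ℝ) : ℂ) * I := by push_cast; ring
  have e2 : 5 + 4 * I = 5 + ((4 : ℝ) : ℂ) * I := by push_cast; ring
  have e3 : 5 - 8 * I = 5 + ((-8 : ℝ) : ℂ) * I := by push_cast; ring
  have e4 : 5 + 8 * I = 5 + ((8 : ℝ) : ℂ) * I := by push_cast; ring
  have h0 := hexp 0
  have h1 := hexp (-4)
  have h2 := hexp 4
  have h3 := hexp (-8)
  have h4 := hexp 8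
  rw [← e0] at h0
  rw [← e1] at h1
  rw [← e2] at h2
  rw [← e3] at h3
  rw [← e4] at h4
  rw [show -4 * v = -(4 * v) by ring, Real.cos_neg, Real.sin_neg] at h1
  rw [show -8 * v = -(8 * v) by ring, Real.cos_neg, Real.sin_neg, h8c, h8s] at h3
  rw [h8c, h8s] at h4
  simp only [expCoeff, expRate, Fin.sum_univ_five, Matrix.cons_val]
  rw [h0, h1, h2, h3, h4]
  simp only [zero_mul, Real.cos_zero, Real.sin_zero]
  push_cast
  ring_nf
  rw [I_sq]
  ring

theorem trig_lower_bound {c s : ℝ} (h : s ^ 2 + c ^ 2 = 1) :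
    0.04 ≤ 15 / 8 - 7 / 8 * c + 9 / 5 * s - 11 / 20 * s * c := by
  nlinarith [sq_nonneg (0.9 * c - 0.275 * s - 0.4375), sq_nonneg (s * 0.735 + 0.6897),
    sq_nonneg (s + 0.94), sq_nonneg (c - 0.77)]

theorem kernel_sum_exp_eq (η κ l u : ℝ) :
    ∑ j, kerCoeff l j * exp (-(kerRate η κ j * u)) =
      ((Real.exp (κ * (η * u)) * (Real.exp (-(5 * (η * u))) * (15 / 8 -
        7 / 8 * Real.cos (4 * (η * u)) + 9 / 5 * Real.sin (4 * (η * u)) -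
        11 / 20 * Real.sin (4 * (η * u)) * Real.cos (4 * (η * u)))) -
        l * (1.1019 * Real.exp (-(u / 2)) ^ 2 - 0.6122 * Real.exp (-(u / 2)) ^ 3) : ℝ) : ℂ) := by
  have e1 : Real.exp (-(u / 2)) ^ 2 = Real.exp (-(1 * u)) := by
    rw [← Real.exp_nat_mul]; congr 1; push_cast; ring
  have e2 : Real.exp (-(u / 2)) ^ 3 = Real.exp (-(3 / 2 * u)) := by
    rw [← Real.exp_nat_mul]; congr 1; push_cast; ring
  rw [e1, e2, ofReal_sub, ofReal_mul, ← sum_expCoeff_mul_exp, Finset.mul_sum, Fintype.sum_sum_type]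
  simp only [kerCoeff, kerRate, Sum.elim_inl, Sum.elim_inr, Fin.sum_univ_two, Matrix.cons_val]
  rw [sub_eq_add_neg]
  congr 1
  · refine Finset.sum_congr rfl fun j _ ↦ ?_
    rw [ofReal_exp, mul_left_comm, ← Complex.exp_add]
    congr 2
    push_cast
    ring
  · push_cast
    ring

theorem exp_neg_le_of_five_le {u : ℝ} (hu : 5 ≤ u) :
    Real.exp (-u) ≤ 1 / 28 * Real.exp (-(0.3 * u)) := by
  have h3 : Real.exp (-u) = Real.exp (-(0.7 * u)) * Real.exp (-(0.3 * u)) := by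
    rw [← Real.exp_add]; congr 1; ring
  rw [h3]
  gcongr
  rw [Real.exp_neg, ← one_div]
  refine one_div_le_one_div_of_le (by norm_num) ?_
  have e1 : Real.exp 1 ^ 3 * Real.exp 0.5 ≤ Real.exp (0.7 * u) := by
    rw [← Real.exp_nat_mul, ← Real.exp_add]
    exact Real.exp_le_exp.mpr (by norm_num; linarith)
  have e2 := Real.exp_one_gt_d9
  have e3 : (2.7 : ℝ) ^ 3 ≤ Real.exp 1 ^ 3 :=
    pow_le_pow_left₀ (by norm_num) (by linarith) 3
  have e4 : (1.5 : ℝ) ≤ Real.exp 0.5 := by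
    have := Real.add_one_le_exp (0.5 : ℝ)
    norm_num at this ⊢
    linarith
  have e5 : (2.7 : ℝ) ^ 3 * 1.5 ≤ Real.exp 1 ^ 3 * Real.exp 0.5 :=
    mul_le_mul e3 e4 (by norm_num) (by positivity)
  exact le_trans (by norm_num) (e5.trans e1)

theorem kernel_sum_exp_nonneg {η κ l u : ℝ} (hη : 0 < η) (hη1 : η ≤ 0.06) (hκ : 0 ≤ κ)
    (hl1 : l ≤ 1) (hu : Real.log 2 ≤ u) :
    0 ≤ (∑ j, kerCoeff l j * exp (-(kerRate η κ j * u))).re := by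
  rw [kernel_sum_exp_eq, ofReal_re, sub_nonneg]
  have hu0 : 0 < u := (Real.log_pos (by norm_num)).trans_le hu
  set p := Real.exp (-(u / 2)) with hp
  have hp0 : 0 < p := Real.exp_pos _
  have hp2e : p ^ 2 = Real.exp (-u) := by
    rw [hp, ← Real.exp_nat_mul]; congr 1; push_cast; ring
  have hp2 : p ^ 2 ≤ 1 / 2 := by
    rw [hp2e, Real.exp_neg, ← one_div]
    refine one_div_le_one_div_of_le (by norm_num) ?_
    calc (2 : ℝ) = Real.exp (Real.log 2) := (Real.exp_log (by norm_num)).symm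
      _ ≤ _ := Real.exp_le_exp.mpr hu
  have hp1 : p ≤ 0.7072 := by nlinarith
  have hw0 : 0 ≤ 1.1019 * p ^ 2 - 0.6122 * p ^ 3 := by
    have : p ^ 3 = p ^ 2 * p := by ring
    nlinarith [sq_nonneg p]
  set v := η * u with hv
  have hv0 : 0 < v := mul_pos hη hu0
  have htrig := trig_lower_bound (Real.sin_sq_add_cos_sq (4 * v))
  set D := 15 / 8 - 7 / 8 * Real.cos (4 * v) + 9 / 5 * Real.sin (4 * v) -
    11 / 20 * Real.sin (4 * v) * Real.cos (4 * v) with hD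
  have h1 : 1 ≤ Real.exp (κ * v) := Real.one_le_exp (by positivity)
  have hE0 : 0 < Real.exp (-(5 * v)) := Real.exp_pos _
  suffices h : 1.1019 * p ^ 2 - 0.6122 * p ^ 3 ≤ Real.exp (-(5 * v)) * D by
    calc l * (1.1019 * p ^ 2 - 0.6122 * p ^ 3) ≤ 1 * (1.1019 * p ^ 2 - 0.6122 * p ^ 3) := by gcongr
      _ ≤ 1 * (Real.exp (-(5 * v)) * D) := by gcongr
      _ ≤ _ := by
        have : 0 ≤ D := by linarith
        gcongr
  have he := Real.exp_one_lt_d9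
  rcases le_or_gt v 0.3 with hv3 | hv3
  · have hw : 1.1019 * p ^ 2 - 0.6122 * p ^ 3 ≤ 0.3375 := by
      nlinarith [sq_nonneg (p - 0.7072), mul_nonneg (sub_nonneg.mpr hp1) hp0.le]
    refine hw.trans ?_
    have hs : 2 / Real.pi * (4 * v) ≤ Real.sin (4 * v) :=
      Real.mul_le_sin (by positivity) (by have := Real.pi_gt_d2; linarith)
    have hs' : 0.63 * (4 * v) ≤ Real.sin (4 * v) := by
      refine le_trans ?_ hs
      gcongr
      rw [le_div_iff₀ Real.pi_pos]
      have := Real.pi_lt_d2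
      linarith
    have hc := Real.cos_le_one (4 * v)
    have hD1 : 1 + 1.25 * Real.sin (4 * v) ≤ D := by
      nlinarith [mul_nonneg (show 0 ≤ Real.sin (4 * v) by linarith) (sub_nonneg.mpr hc)]
    rcases le_or_gt v 0.2 with hv2 | hv2
    · have h2 : 0.3675 ≤ Real.exp (-(5 * v)) := by
        have : Real.exp (-1) ≤ Real.exp (-(5 * v)) := Real.exp_le_exp.mpr (by linarith)
        refine le_trans ?_ this
        rw [Real.exp_neg, ← one_div, le_div_iff₀ (Real.exp_pos 1)]
        linarith
      nlinarith
    · have h2 : 0.223 ≤ Real.exp (-(5 * v)) := by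
        have : Real.exp (-1.5) ≤ Real.exp (-(5 * v)) := Real.exp_le_exp.mpr (by linarith)
        refine le_trans ?_ this
        have h3 : Real.exp (-1.5) ^ 2 * Real.exp 1 ^ 3 = 1 := by
          rw [← Real.exp_nat_mul, ← Real.exp_nat_mul, ← Real.exp_add]
          norm_num
        have h4 : Real.exp 1 ^ 3 ≤ 20.0856 := by
          calc Real.exp 1 ^ 3 ≤ 2.7182818286 ^ 3 := by gcongr
            _ ≤ _ := by norm_num
        have h5 := Real.exp_pos (-1.5)
        by_contra! h
        have : Real.exp (-1.5) ^ 2 < 0.223 ^ 2 := by gcongr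
        nlinarith [sq_nonneg (Real.exp (-1.5))]
      nlinarith
  · have hvu : v ≤ 0.06 * u := mul_le_mul_of_nonneg_right hη1 hu0.le
    have hu5 : 5 ≤ u := by linarith
    have h2 : Real.exp (-(0.3 * u)) ≤ Real.exp (-(5 * v)) := Real.exp_le_exp.mpr (by linarith)
    have h4 := exp_neg_le_of_five_le hu5
    rw [← hp2e] at h4
    have h7 : Real.exp (-(0.3 * u)) * 0.04 ≤ Real.exp (-(5 * v)) * D := by gcongr
    have h8 : 0 < p ^ 3 := by positivity
    have h5 : 0 < Real.exp (-(0.3 * u)) := Real.exp_pos _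
    linarith

theorem kernel_sum_exp_im (η κ l u : ℝ) :
    (∑ j, kerCoeff l j * exp (-(kerRate η κ j * u))).im = 0 := by
  rw [kernel_sum_exp_eq, ofReal_im]

theorem symmKernel_one_sub_conj {ι : Type} [Fintype ι] (c b : ι → ℂ) (z : ℂ) :
    symmKernel c b (1 - conj z) = symmKernel c b z := by
  simp [symmKernel, add_comm]

theorem symmKernel_nonneg_of_boundary {ι : Type} [Fintype ι] {c b : ι → ℂ}
    (hconj : ∀ z, ratKernel c b (conj z) = conj (ratKernel c b z)) {a : ℝ} (ha : a < 1 / 2)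
    (hb : ∀ j, 0 < a + (b j).re) (hbd : ∀ z : ℂ, z.re = a → 0 ≤ symmKernel c b z)
    {z : ℂ} (hz : a ≤ z.re) (hz' : z.re ≤ 1 - a) : 0 ≤ symmKernel c b z := by
  set f : ℂ → ℂ := fun w ↦ exp (-(ratKernel c b w + ratKernel c b (1 - w))) with hf
  have hnorm : ∀ w, ‖f w‖ = Real.exp (-symmKernel c b w) := fun w ↦ by
    rw [hf, norm_exp, neg_re, add_re, symmKernel,
      show 1 - conj w = conj (1 - w) by simp, hconj, conj_re]
  have hne : ∀ w : ℂ, a ≤ w.re → ∀ j, w + b j ≠ 0 := fun w hw j h ↦ by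
    have := congrArg re h
    simp only [add_re, zero_re] at this
    linarith [hb j]
  have hda : ∀ w : ℂ, a ≤ w.re → DifferentiableAt ℂ (ratKernel c b) w := fun w hw ↦ by
    unfold ratKernel
    have := hne w hw
    fun_prop (disch := exact this _)
  have hdf : ∀ w : ℂ, a ≤ w.re → w.re ≤ 1 - a → DifferentiableAt ℂ f w := fun w h1 h2 ↦ by
    have h3 : DifferentiableAt ℂ (fun w ↦ ratKernel c b (1 - w)) w :=
      (hda (1 - w) (by simp; linarith)).comp w (by fun_prop)
    exact ((hda w h1).add h3).neg.cexp
  have hKle : ∀ w : ℂ, a ≤ w.re → ‖ratKernel c b w‖ ≤ ∑ j, ‖c j‖ * (1 / (a + (b j).re)) :=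
    fun w hw ↦ by
    refine (norm_sum_le _ _).trans (Finset.sum_le_sum fun j _ ↦ ?_)
    rw [norm_mul, norm_div, norm_one]
    gcongr
    · exact hb j
    · refine le_trans ?_ (re_le_norm _)
      rw [add_re]
      linarith
  set M := ∑ j, ‖c j‖ * (1 / (a + (b j).re))
  have hfle : ∀ w : ℂ, a ≤ w.re → w.re ≤ 1 - a → ‖f w‖ ≤ Real.exp (M + M) := fun w h1 h2 ↦ by
    rw [hf, norm_exp]
    refine Real.exp_le_exp.mpr ((re_le_norm _).trans ?_)
    rw [norm_neg]
    exact (norm_add_le _ _).trans (add_le_add (hKle w h1) (hKle (1 - w) (by simp; linarith)))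
  have key : ‖f z‖ ≤ 1 := by
    refine PhragmenLindelof.vertical_strip (a := a) (b := 1 - a) ?_ ?_ ?_ ?_ hz hz'
    · refine DifferentiableOn.diffContOnCl fun w hw ↦ ?_
      have hcl : w ∈ re ⁻¹' Icc a (1 - a) :=
        closure_minimal (preimage_mono Ioo_subset_Icc_self)
          (isClosed_Icc.preimage continuous_re) hw
      exact (hdf w hcl.1 hcl.2).differentiableWithinAt
    · refine ⟨0, by have := Real.pi_pos; exact div_pos this (by linarith), 0, ?_⟩
      refine Asymptotics.IsBigO.of_bound (Real.exp (M + M)) ?_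
      refine Filter.eventually_inf_principal.mpr (Filter.Eventually.of_forall fun w hw ↦ ?_)
      simpa using hfle w hw.1.le hw.2.le
    · intro w hw
      rw [hnorm, Real.exp_le_one_iff, neg_nonpos]
      exact hbd w hw
    · intro w hw
      rw [hnorm, Real.exp_le_one_iff, neg_nonpos, ← symmKernel_one_sub_conj]
      exact hbd _ (by simp [hw])
  rw [hnorm, Real.exp_le_one_iff, neg_nonpos] at key
  exact key

/-- The Laplace transform of the exponential sum with frequencies scaled by `η`. -/
noncomputable def expKernel (η : ℝ) (s : ℂ) : ℂ := ∑ j, expCoeff j * (1 / (s + η * expRate j))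

theorem expKernel_conj (η : ℝ) (s : ℂ) : expKernel η (conj s) = conj (expKernel η s) := by
  simp only [expKernel, Fin.sum_univ_five, expCoeff, expRate, Matrix.cons_val]
  simp only [map_add, map_mul, map_div₀, map_neg, map_sub, map_one, conj_I, map_ofNat,
    conj_ofReal]
  ring_nf

theorem ratKernel_kerCoeff (η κ l : ℝ) (z : ℂ) :
    ratKernel (kerCoeff l) (kerRate η κ) z = expKernel η (z - κ * η) -
      l * ((1.1019 : ℝ) * (1 / (z + 1)) - (0.6122 : ℝ) * (1 / (z + 3 / 2))) := by
  rw [ratKernel, Fintype.sum_sum_type]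
  simp only [kerCoeff, kerRate, Sum.elim_inl, Sum.elim_inr, Fin.sum_univ_two, Matrix.cons_val]
  rw [expKernel, sub_eq_add_neg]
  congr 1
  · refine Finset.sum_congr rfl fun j _ ↦ ?_
    rw [show z + η * (expRate j - κ) = z - κ * η + η * expRate j by ring]
  · push_cast
    ring

theorem ratKernel_kerCoeff_conj (η κ l : ℝ) (z : ℂ) :
    ratKernel (kerCoeff l) (kerRate η κ) (conj z) =
      conj (ratKernel (kerCoeff l) (kerRate η κ) z) := by
  rw [ratKernel_kerCoeff, ratKernel_kerCoeff]
  simp only [map_add, map_mul, map_div₀, map_sub, map_one, map_ofNat, conj_ofReal]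
  rw [show conj z - κ * η = conj (z - κ * η) by simp, expKernel_conj]

theorem re_mul_one_div (c w : ℂ) :
    (c * (1 / w)).re = (c.re * w.re + c.im * w.im) / (w.re ^ 2 + w.im ^ 2) := by
  rw [one_div, mul_re, inv_re, inv_im, normSq_apply]
  ring

theorem expKernel_mul_I_re_nonneg {η : ℝ} (hη : 0 < η) (y : ℝ) :
    0 ≤ (expKernel η (y * I)).re := by
  have hscale : expKernel η (y * I) = (1 / η : ℝ) * ∑ j, expCoeff j *
      (1 / (((y / η : ℝ) : ℂ) * I + expRate j)) := by
    have hη' : (η : ℂ) ≠ 0 := ofReal_ne_zero.mpr hη.ne'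
    rw [expKernel, Finset.mul_sum]
    refine Finset.sum_congr rfl fun j _ ↦ ?_
    have : (y * I + η * expRate j : ℂ) = η * (((y / η : ℝ) : ℂ) * I + expRate j) := by
      push_cast
      field_simp
    rw [this, one_div, mul_inv]
    push_cast
    ring
  rw [hscale, re_ofReal_mul]
  refine mul_nonneg (by positivity) ?_
  generalize y / η = Y
  rw [re_sum]
  simp only [re_mul_one_div, Fin.sum_univ_five, expCoeff, expRate, Matrix.cons_val]
  simp
  have e : ∀ Z : ℝ, Z = Y ^ 2 → 0 ≤ (139537760 - 1817905.6 * Z - 2128 * Z ^ 2 + 65.6 * Z ^ 3) /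
      ((25 + Y ^ 2) * ((25 + (Y - 4) ^ 2) * (25 + (Y + 4) ^ 2)) *
        ((25 + (Y - 8) ^ 2) * (25 + (Y + 8) ^ 2))) := by
    intro Z hZ
    have hZ0 : 0 ≤ Z := by rw [hZ]; positivity
    refine div_nonneg ?_ (by positivity)
    nlinarith [mul_nonneg hZ0 (sq_nonneg (Z - 107.5)), sq_nonneg (Z - 107.5)]
  refine (e _ rfl).trans (le_of_eq ?_)
  have h1 : 25 + Y ^ 2 ≠ 0 := by positivity
  have h2 : 25 + (Y - 4) ^ 2 ≠ 0 := by positivity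
  have h3 : 25 + (Y + 4) ^ 2 ≠ 0 := by positivity
  have h4 : 25 + (Y - 8) ^ 2 ≠ 0 := by positivity
  have h5 : 25 + (Y + 8) ^ 2 ≠ 0 := by positivity
  field_simp
  ring

theorem sum_mul_mul_expCoeffBound : ∑ j, expCoeffBound j * expRateBound j ^ 3 ≤ 991 := by
  simp only [expCoeffBound, expRateBound, Fin.sum_univ_five, Matrix.cons_val]
  norm_num

theorem re_expKernel_ge {η m : ℝ} {s : ℂ} (hη : 0 < η) (hm : 0 < m) (hs : s ≠ 0)
    (h : ∀ j, m ≤ ‖s + η * expRate j‖) :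
    (1 / s).re - (11 * η ^ 2 + 991 * η ^ 3 / m) / ‖s‖ ^ 3 ≤ (expKernel η s).re := by
  have hne : ∀ j, s + η * expRate j ≠ 0 := fun j ↦ norm_pos_iff.mp (hm.trans_le (h j))
  have e1 : expKernel η s = 1 / s + (-11 * η ^ 2 / s ^ 3 - η ^ 3 / s ^ 3 *
      ∑ j, expCoeff j * (expRate j ^ 3 / (s + η * expRate j))) := by
    have e2 : ∀ j, expCoeff j * (1 / (s + η * expRate j)) = expCoeff j * (1 / s) -
        expCoeff j * expRate j * (η / s ^ 2) + expCoeff j * expRate j ^ 2 * (η ^ 2 / s ^ 3) -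
        η ^ 3 / s ^ 3 * (expCoeff j * (expRate j ^ 3 / (s + η * expRate j))) := fun j ↦ by
      have := hne j
      field_simp
      ring
    rw [expKernel, Finset.sum_congr rfl fun j _ ↦ e2 j, Finset.sum_sub_distrib,
      Finset.sum_add_distrib, Finset.sum_sub_distrib, ← Finset.sum_mul, ← Finset.sum_mul,
      ← Finset.sum_mul, sum_expCoeff, sum_expCoeff_mul_expRate, sum_expCoeff_mul_expRate_sq,
      ← Finset.mul_sum]
    ring
  have hs0 : 0 < ‖s‖ := norm_pos_iff.mpr hs
  have e3 : ‖∑ j, expCoeff j * (expRate j ^ 3 / (s + η * expRate j))‖ ≤ 991 / m := by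
    refine (norm_sum_le _ _).trans ?_
    calc ∑ j, ‖expCoeff j * (expRate j ^ 3 / (s + η * expRate j))‖
        ≤ ∑ j, expCoeffBound j * expRateBound j ^ 3 / m := by
          refine Finset.sum_le_sum fun j _ ↦ ?_
          have h1 := norm_expRate_sub_le le_rfl zero_le_one j
          rw [ofReal_zero, sub_zero] at h1
          have h2 := norm_expCoeff_le j
          have h3 := (norm_nonneg _).trans h2
          have h4 := (norm_nonneg _).trans h1
          rw [norm_mul, norm_div, norm_pow, mul_div_assoc]
          gcongr
          exact h j
      _ = (∑ j, expCoeffBound j * expRateBound j ^ 3) / m := (Finset.sum_div _ _ _).symm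
      _ ≤ _ := by
        gcongr
        exact sum_mul_mul_expCoeffBound
  have e4 : ‖(-11 * η ^ 2 / s ^ 3 - η ^ 3 / s ^ 3 *
      ∑ j, expCoeff j * (expRate j ^ 3 / (s + η * expRate j)) : ℂ)‖ ≤
      (11 * η ^ 2 + 991 * η ^ 3 / m) / ‖s‖ ^ 3 := by
    refine (norm_sub_le _ _).trans ?_
    rw [norm_mul, norm_div, norm_div, norm_mul, norm_neg, norm_pow, norm_pow, norm_pow, norm_real,
      Real.norm_of_nonneg hη.le, norm_ofNat, add_div]
    gcongr
    calc η ^ 3 / ‖s‖ ^ 3 * ‖∑ j, expCoeff j * (expRate j ^ 3 / (s + η * expRate j))‖ ≤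
        η ^ 3 / ‖s‖ ^ 3 * (991 / m) := by gcongr
      _ = _ := by ring
  rw [e1, add_re]
  have := (abs_le.mp ((abs_re_le_norm _).trans e4)).1
  linarith

theorem re_expKernel_ge_of_re_near_one {η : ℝ} {s : ℂ} (hη : 0 < η) (h1 : 0.98 ≤ s.re)
    (h2 : s.re ≤ 1) :
    (s.re - (11.8 * η ^ 2 + 1080 * η ^ 3)) / (1 + s.im ^ 2) ≤ (expKernel η s).re := by
  have hs : s ≠ 0 := fun h ↦ by
    rw [h, zero_re] at h1
    norm_num at h1
  have h := re_expKernel_ge hη (m := 0.98) (by norm_num) hs fun j ↦ by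
    refine le_trans ?_ (re_le_norm _)
    rw [add_re, re_ofReal_mul, expRate_re]
    linarith
  refine le_trans ?_ h
  have e1 : s.re / (1 + s.im ^ 2) ≤ (1 / s).re := by
    rw [one_div, inv_re, normSq_apply]
    refine div_le_div_of_nonneg_left (by linarith) (by nlinarith) (by nlinarith)
  have e2 : (11 * η ^ 2 + 991 * η ^ 3 / 0.98) / ‖s‖ ^ 3 ≤
      (11.8 * η ^ 2 + 1080 * η ^ 3) / (1 + s.im ^ 2) := by
    have hn : ‖s‖ ^ 2 = s.re ^ 2 + s.im ^ 2 := by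
      rw [← normSq_eq_norm_sq, normSq_apply]; ring
    have hn1 : 0.98 ≤ ‖s‖ := h1.trans (re_le_norm _)
    have hn2 : 0.96 * (1 + s.im ^ 2) ≤ ‖s‖ ^ 2 := by nlinarith
    have hn3 : 0.9408 * (1 + s.im ^ 2) ≤ ‖s‖ ^ 3 := by
      calc 0.9408 * (1 + s.im ^ 2) = 0.96 * (1 + s.im ^ 2) * 0.98 := by ring
        _ ≤ ‖s‖ ^ 2 * ‖s‖ := by gcongr
        _ = _ := by ring
    calc (11 * η ^ 2 + 991 * η ^ 3 / 0.98) / ‖s‖ ^ 3 ≤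
        (11 * η ^ 2 + 991 * η ^ 3 / 0.98) / (0.9408 * (1 + s.im ^ 2)) := by gcongr
      _ = (11 * η ^ 2 + 991 * η ^ 3 / 0.98) / 0.9408 / (1 + s.im ^ 2) := by rw [div_div]
      _ ≤ _ := by
        gcongr
        have h3 := pow_pos hη 2
        have h4 := pow_pos hη 3
        norm_num
        linarith
  rw [sub_div]
  linarith

/-- The real part of the symmetrized correction kernel. -/
noncomputable def symmCorrection (x Y : ℝ) : ℝ :=
  1.1019 * ((1 + x) / ((1 + x) ^ 2 + Y) + (2 - x) / ((2 - x) ^ 2 + Y)) -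
    0.6122 * ((3 / 2 + x) / ((3 / 2 + x) ^ 2 + Y) + (5 / 2 - x) / ((5 / 2 - x) ^ 2 + Y))

theorem symmKernel_kerCoeff (η κ l : ℝ) (z : ℂ) :
    symmKernel (kerCoeff l) (kerRate η κ) z = (expKernel η (z - κ * η)).re +
      (expKernel η (1 - conj z - κ * η)).re - l * symmCorrection z.re (z.im ^ 2) := by
  have e : ∀ (w : ℂ) (r : ℝ), (1 / (w + r)).re = (r + w.re) / ((r + w.re) ^ 2 + w.im ^ 2) := by
    intro w r
    rw [one_div, inv_re, normSq_apply, add_re, add_im, ofReal_re, ofReal_im]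
    ring
  have e1 := fun w ↦ e w 1
  have e2 := fun w ↦ e w (3 / 2)
  push_cast at e1 e2
  rw [symmKernel, ratKernel_kerCoeff, ratKernel_kerCoeff, sub_re, sub_re, re_ofReal_mul,
    re_ofReal_mul, sub_re, sub_re, re_ofReal_mul, re_ofReal_mul, re_ofReal_mul, re_ofReal_mul,
    e1, e2, e1, e2, symmCorrection]
  simp only [sub_re, one_re, conj_re, sub_im, one_im, conj_im]
  ring

theorem symmCorrection_zero_le {Y : ℝ} (hY : 0 ≤ Y) : symmCorrection 0 Y ≤ 1 / (1 + Y) := by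
  have e : 1 / (1 + Y) - symmCorrection 0 Y =
      ((1 + Y) * (4 + Y) * (9 / 4 + Y) * (25 / 4 + Y) * (1 + Y) *
        (1 / (1 + Y) - symmCorrection 0 Y)) /
        ((1 + Y) * (4 + Y) * (9 / 4 + Y) * (25 / 4 + Y) * (1 + Y)) := by
    field_simp
  rw [← sub_nonneg, e]
  refine div_nonneg ?_ (by positivity)
  unfold symmCorrection
  have h1 : (1 + 0) ^ 2 + Y ≠ 0 := by positivity
  have h2 : (2 - 0) ^ 2 + Y ≠ 0 := by positivity
  have h3 : (3 / 2 + 0) ^ 2 + Y ≠ 0 := by positivity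
  have h4 : (5 / 2 - 0) ^ 2 + Y ≠ 0 := by positivity
  have h5 : 1 + Y ≠ 0 := by positivity
  norm_num at *
  field_simp
  have hc : 0 ≤ 1757.73 + 490.47 * Y - 1023.6 * Y ^ 2 + 228.96 * Y ^ 3 := by
    nlinarith [mul_nonneg hY (sq_nonneg (Y - 2.7177)), sq_nonneg (Y - 2.7177)]
  nlinarith [mul_nonneg hY hc]

theorem symmCorrection_le {x Y : ℝ} (hx : 0 ≤ x) (hx1 : x ≤ 0.01) (hY : 0 ≤ Y) :
    symmCorrection x Y ≤ (1 + 5.3 * x) / (1 + Y) := by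
  have h0 := symmCorrection_zero_le hY
  have a1 : (1 + x) / ((1 + x) ^ 2 + Y) ≤ 1 / (1 + Y) + x / (1 + Y) := by
    rw [← add_div]
    gcongr
    nlinarith
  have a2 : (2 - x) / ((2 - x) ^ 2 + Y) ≤ 2 / (4 + Y) + 1.1 * x / (1 + Y) := by
    have h1 : (2 - x) / ((2 - x) ^ 2 + Y) ≤ (2 + 1.1 * x) / (4 + Y) := by
      rw [div_le_div_iff₀ (by nlinarith) (by positivity)]
      nlinarith [mul_nonneg hx hY, pow_nonneg hx 2, pow_nonneg hx 3,
        mul_nonneg hx (sub_nonneg.mpr hx1)]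
    rw [add_div] at h1
    refine h1.trans ?_
    gcongr
    norm_num
  have a3 : 3 / 2 / (9 / 4 + Y) - 1.01 * x / (1 + Y) ≤ (3 / 2 + x) / ((3 / 2 + x) ^ 2 + Y) := by
    have h1 : (3 / 2 - 1.01 * x) / (9 / 4 + Y) ≤ (3 / 2 + x) / ((3 / 2 + x) ^ 2 + Y) := by
      rw [div_le_div_iff₀ (by positivity) (by positivity)]
      nlinarith [mul_nonneg hx hY, pow_nonneg hx 2, pow_nonneg hx 3,
        mul_nonneg hx (sub_nonneg.mpr hx1)]
    have h2 : 1.01 * x / (9 / 4 + Y) ≤ 1.01 * x / (1 + Y) := by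
      gcongr
      norm_num
    rw [sub_div] at h1
    linarith
  have a4 : 5 / 2 / (25 / 4 + Y) - x / (1 + Y) ≤ (5 / 2 - x) / ((5 / 2 - x) ^ 2 + Y) := by
    have h1 : (5 / 2 - x) / (25 / 4 + Y) ≤ (5 / 2 - x) / ((5 / 2 - x) ^ 2 + Y) :=
      div_le_div_of_nonneg_left (by linarith) (by nlinarith) (by nlinarith)
    have h2 : x / (25 / 4 + Y) ≤ x / (1 + Y) := by
      gcongr
      norm_num
    rw [sub_div] at h1
    linarith
  have h0' : symmCorrection 0 Y = 1.1019 * (1 / (1 + Y) + 2 / (4 + Y)) -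
      0.6122 * (3 / 2 / (9 / 4 + Y) + 5 / 2 / (25 / 4 + Y)) := by
    unfold symmCorrection
    norm_num
  have h1 : x / (1 + Y) = x * (1 / (1 + Y)) := by ring
  have h2 : 0 ≤ x * (1 / (1 + Y)) := by positivity
  rw [add_div, mul_div_assoc]
  rw [mul_div_assoc] at a2 a3
  rw [h0'] at h0
  rw [symmCorrection]
  rw [← h1] at h2
  generalize (1 + x) / ((1 + x) ^ 2 + Y) = A₁ at *
  generalize (2 - x) / ((2 - x) ^ 2 + Y) = A₂ at *
  generalize (3 / 2 + x) / ((3 / 2 + x) ^ 2 + Y) = A₃ at *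
  generalize (5 / 2 - x) / ((5 / 2 - x) ^ 2 + Y) = A₄ at *
  generalize x / (1 + Y) = T at *
  linarith

theorem symmKernel_kerCoeff_nonneg_of_re_eq {η κ l : ℝ} (hη : 0 < η) (hκ : 0 ≤ κ) (hl : 0 ≤ l)
    (hκη : κ * η ≤ 0.01)
    (h : l * (1 + 5.3 * (κ * η)) ≤ 1 - 2 * (κ * η) - (11.8 * η ^ 2 + 1080 * η ^ 3)) {z : ℂ}
    (hz : z.re = κ * η) : 0 ≤ symmKernel (kerCoeff l) (kerRate η κ) z := by
  have hx : 0 ≤ κ * η := by positivity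
  rw [symmKernel_kerCoeff]
  have e1 : z - κ * η = (z.im : ℂ) * I := by
    apply Complex.ext <;> simp [hz]
  rw [e1, hz]
  have h1 := expKernel_mul_I_re_nonneg hη z.im
  have hre : (1 - conj z - κ * η).re = 1 - 2 * (κ * η) := by
    simp [hz]
    ring
  have him : (1 - conj z - κ * η).im = z.im := by simp
  have h2 := re_expKernel_ge_of_re_near_one (s := 1 - conj z - κ * η) hη (by rw [hre]; linarith)
    (by rw [hre]; linarith)
  rw [hre, him] at h2
  have h3 := mul_le_mul_of_nonneg_left (symmCorrection_le hx hκη (sq_nonneg z.im)) hl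
  have h4 : l * ((1 + 5.3 * (κ * η)) / (1 + z.im ^ 2)) ≤
      (1 - 2 * (κ * η) - (11.8 * η ^ 2 + 1080 * η ^ 3)) / (1 + z.im ^ 2) := by
    rw [← mul_div_assoc]
    gcongr
  linarith

theorem symmKernel_kerCoeff_nonneg {η κ l : ℝ} (hη : 0 < η) (hκ : 0 ≤ κ) (hκ1 : κ ≤ 1) (hl : 0 ≤ l)
    (hκη : κ * η ≤ 0.01)
    (h : l * (1 + 5.3 * (κ * η)) ≤ 1 - 2 * (κ * η) - (11.8 * η ^ 2 + 1080 * η ^ 3)) {z : ℂ}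
    (hz : κ * η ≤ z.re) (hz' : z.re ≤ 1 - κ * η) :
    0 ≤ symmKernel (kerCoeff l) (kerRate η κ) z :=
  symmKernel_nonneg_of_boundary (ratKernel_kerCoeff_conj η κ l) (by linarith)
    (fun j ↦ by
      have := kerRate_re_pos hη hκ1 j
      have : 0 ≤ κ * η := by positivity
      linarith)
    (fun _ hw ↦ symmKernel_kerCoeff_nonneg_of_re_eq hη hκ hl hκη h hw) hz hz'

theorem symmKernel_kerCoeff_nonneg_of_ten_le_im {η l : ℝ} (hη : 0 < η) (hη1 : η ≤ 0.0113)
    (hl : l = 1 - 7 * η) {z : ℂ} (hz : 0 ≤ z.re) (hz' : z.re ≤ 0.8 * η) (him : 10 ≤ |z.im|) :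
    0 ≤ symmKernel (kerCoeff l) (kerRate η 0.8) z := by
  rw [symmKernel_kerCoeff]
  have hre : (1 - conj z - (0.8 : ℝ) * η).re = 1 - z.re - 0.8 * η := by
    rw [sub_re, sub_re, re_ofReal_mul]
    simp
  have him' : (1 - conj z - (0.8 : ℝ) * η).im = z.im := by simp
  have h2 := re_expKernel_ge_of_re_near_one (s := 1 - conj z - (0.8 : ℝ) * η) hη
    (by rw [hre]; linarith) (by rw [hre]; linarith)
  rw [hre, him'] at h2
  have h3 := symmCorrection_le hz (by linarith) (sq_nonneg z.im)
  set s : ℂ := z - (0.8 : ℝ) * η with hs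
  have hsre : s.re = z.re - 0.8 * η := by rw [hs, sub_re, re_ofReal_mul, ofReal_re]
  have hsim : s.im = z.im := by simp [hs]
  have hs10 : 10 ≤ ‖s‖ := by
    rw [← hsim] at him
    exact him.trans (abs_im_le_norm s)
  have hY : 100 ≤ z.im ^ 2 := by
    rw [← sq_abs]
    nlinarith
  have hsq : ‖s‖ ^ 2 = s.re ^ 2 + z.im ^ 2 := by
    rw [← normSq_eq_norm_sq, normSq_apply, hsim]; ring
  have h4 := re_expKernel_ge hη one_pos (norm_pos_iff.mp (by linarith)) fun j ↦ by
    have e1 := norm_sub_le (s + η * expRate j) (η * expRate j)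
    rw [add_sub_cancel_right] at e1
    have e2 : ‖(η : ℂ) * expRate j‖ ≤ 0.0113 * 10 := by
      have e3 := norm_expRate_sub_le le_rfl zero_le_one j
      rw [ofReal_zero, sub_zero] at e3
      have e4 : expRateBound j ≤ 10 := by fin_cases j <;> norm_num [expRateBound]
      rw [norm_mul, norm_real, Real.norm_of_nonneg hη.le]
      gcongr
      linarith
    linarith
  have h5 : -(0.8 * η) / z.im ^ 2 ≤ (1 / s).re := by
    have e1 : (0.8 * η - z.re) / (s.re ^ 2 + z.im ^ 2) ≤ 0.8 * η / z.im ^ 2 :=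
      div_le_div₀ (by positivity) (by linarith) (by linarith) (by nlinarith)
    have e2 : (1 / s).re = -((0.8 * η - z.re) / (s.re ^ 2 + z.im ^ 2)) := by
      rw [one_div, inv_re, normSq_eq_norm_sq, hsq, hsre]
      ring
    rw [e2, neg_div]
    linarith
  have h6 : (11 * η ^ 2 + 991 * η ^ 3 / 1) / ‖s‖ ^ 3 ≤ 0.03 * η / z.im ^ 2 := by
    have e1 : z.im ^ 2 * 10 ≤ ‖s‖ ^ 3 := by
      rw [pow_succ]
      have : z.im ^ 2 ≤ ‖s‖ ^ 2 := by rw [hsq]; nlinarith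
      exact mul_le_mul this hs10 (by norm_num) (sq_nonneg _)
    have e2 : 11 * η ^ 2 + 991 * η ^ 3 / 1 ≤ 0.3 * η := by
      nlinarith [pow_pos hη 2]
    calc (11 * η ^ 2 + 991 * η ^ 3 / 1) / ‖s‖ ^ 3 ≤ (0.3 * η) / (z.im ^ 2 * 10) :=
          div_le_div₀ (by positivity) e2 (by linarith) e1
      _ = _ := by
          rw [mul_comm (z.im ^ 2), ← div_div]
          congr 1
          ring
  have h7 : 0.83 * η / z.im ^ 2 ≤ 0.87 * η / (1 + z.im ^ 2) := by
    rw [div_le_div_iff₀ (by positivity) (by positivity)]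
    nlinarith
  have hl0 : 0 ≤ l := by linarith
  have h8 : l * symmCorrection z.re (z.im ^ 2) ≤ l * ((1 + 5.3 * z.re) / (1 + z.im ^ 2)) := by
    gcongr
  have h9 : l * ((1 + 5.3 * z.re) / (1 + z.im ^ 2)) + 0.87 * η / (1 + z.im ^ 2) ≤
      (1 - z.re - 0.8 * η - (11.8 * η ^ 2 + 1080 * η ^ 3)) / (1 + z.im ^ 2) := by
    rw [← mul_div_assoc, ← add_div]
    have e1 : 11.8 * η ^ 2 + 1080 * η ^ 3 ≤ 0.28 * η := by
      nlinarith [pow_pos hη 2]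
    have e2 : l * (1 + 5.3 * z.re) ≤ (1 - 7 * η) * (1 + 5.3 * (0.8 * η)) := by
      rw [hl]
      exact mul_le_mul_of_nonneg_left (by linarith) (by linarith)
    refine div_le_div_of_nonneg_right ?_ (by positivity)
    nlinarith
  have h10 : 0.83 * η / z.im ^ 2 = 0.8 * η / z.im ^ 2 + 0.03 * η / z.im ^ 2 := by ring
  rw [neg_div] at h5
  linarith

/-- The values of `η * expKernel η (η * x)` for real `x`. -/
noncomputable def expKernelReal (x : ℝ) : ℝ :=
  15 / 8 / (x + 5) + (36 / 5 - 7 / 8 * (x + 5)) / ((x + 5) ^ 2 + 16) - 11 / 5 / ((x + 5) ^ 2 + 64)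

theorem expKernel_ofReal_mul {η x : ℝ} (hη : η ≠ 0) (hx : -5 < x) :
    expKernel η ((x * η : ℝ) : ℂ) = ((expKernelReal x / η : ℝ) : ℂ) := by
  have hx0 : (x : ℂ) + 5 ≠ 0 := by
    have : x + 5 ≠ 0 := by linarith
    exact_mod_cast this
  have hη0 : (η : ℂ) ≠ 0 := by exact_mod_cast hη
  have h1 : ∀ m : ℝ, (x : ℂ) + 5 + m * I ≠ 0 := fun m h ↦ by
    have := congrArg re h
    simp at this
    linarith
  have h2 : ∀ m : ℝ, 1 / ((x * η : ℝ) + η * (5 + m * I) : ℂ) =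
      ((x : ℂ) + 5 - m * I) / (((x : ℂ) + 5) ^ 2 + m ^ 2) / η := fun m ↦ by
    have e : ((x : ℂ) + 5) ^ 2 + m ^ 2 = (x + 5 + m * I) * (x + 5 - m * I) := by
      linear_combination (m : ℂ) ^ 2 * I_sq
    have h3 := h1 (-m)
    rw [ofReal_neg, neg_mul, ← sub_eq_add_neg] at h3
    have h4 := h1 m
    rw [e, ofReal_mul, show (x : ℂ) * η + η * (5 + m * I) = (x + 5 + m * I) * η by ring]
    field_simp
  have h0 : 1 / ((x * η : ℝ) + η * 5 : ℂ) = 1 / ((x : ℂ) + 5) / η := by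
    rw [ofReal_mul, show (x : ℂ) * η + η * 5 = (x + 5) * η by ring]
    field_simp
  have e1 : 5 - 4 * I = 5 + ((-4 : ℝ) : ℂ) * I := by push_cast; ring
  have e2 : 5 + 4 * I = 5 + ((4 : ℝ) : ℂ) * I := by push_cast; ring
  have e3 : 5 - 8 * I = 5 + ((-8 : ℝ) : ℂ) * I := by push_cast; ring
  have e4 : 5 + 8 * I = 5 + ((8 : ℝ) : ℂ) * I := by push_cast; ring
  simp only [expKernel, Fin.sum_univ_five, expCoeff, expRate, Matrix.cons_val]
  rw [e1, e2, e3, e4]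
  rw [h0, h2, h2, h2, h2, expKernelReal]
  push_cast
  rw [show ((-4 : ℂ)) ^ 2 = 16 by norm_num, show ((4 : ℂ)) ^ 2 = 16 by norm_num,
    show ((-8 : ℂ)) ^ 2 = 64 by norm_num, show ((8 : ℂ)) ^ 2 = 64 by norm_num]
  set A := ((x : ℂ) + 5)⁻¹
  set B := (((x : ℂ) + 5) ^ 2 + 16)⁻¹
  set C := (((x : ℂ) + 5) ^ 2 + 64)⁻¹
  simp only [div_eq_mul_inv]
  linear_combination (36 / 5 * B - 11 / 5 * C) * (η : ℂ)⁻¹ * -I_sq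

theorem expKernelReal_ge {x : ℝ} (hx : 14 ≤ x) : 1 / (x + 1) ≤ expKernelReal x := by
  obtain ⟨s, hs, rfl⟩ : ∃ s : ℝ, 0 ≤ s ∧ x = s + 14 := ⟨x - 14, by linarith, by ring⟩
  rw [← sub_nonneg, expKernelReal]
  have : 15 / 8 / (s + 14 + 5) + (36 / 5 - 7 / 8 * (s + 14 + 5)) / ((s + 14 + 5) ^ 2 + 16) -
      11 / 5 / ((s + 14 + 5) ^ 2 + 64) - 1 / (s + 14 + 1) =
      ((15 / 8 * (s + 15) - (s + 19)) * ((s + 19) ^ 2 + 16) * ((s + 19) ^ 2 + 64) +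
      (36 / 5 - 7 / 8 * (s + 19)) * (s + 19) * (s + 15) * ((s + 19) ^ 2 + 64) -
      11 / 5 * (s + 19) * (s + 15) * ((s + 19) ^ 2 + 16)) /
      ((s + 19) * (s + 15) * ((s + 19) ^ 2 + 16) * ((s + 19) ^ 2 + 64)) := by
    have h1 : s + 19 ≠ 0 := by linarith
    have h2 : s + 15 ≠ 0 := by linarith
    have h3 : (s + 19) ^ 2 + 16 ≠ 0 := by positivity
    have h4 : (s + 19) ^ 2 + 64 ≠ 0 := by positivity
    have h5 : s + 14 + 5 ≠ 0 := by linarith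
    have h6 : s + 14 + 1 ≠ 0 := by linarith
    rw [show s + 14 + 5 = s + 19 by ring, show s + 14 + 1 = s + 15 by ring]
    field_simp
    ring
  rw [this]
  refine div_nonneg ?_ (by positivity)
  ring_nf
  positivity

theorem one_le_re_expKernel {η κ : ℝ} (hη : 0 < η) (hη1 : η ≤ 0.06) (hκ : 0 ≤ κ) (hκ1 : κ ≤ 1) :
    1 ≤ (expKernel η ((1 - η - κ * η : ℝ) : ℂ)).re := by
  have h1 : 16 ≤ 1 / η := by
    rw [le_div_iff₀ hη]; linarith
  have e : 1 - η - κ * η = (1 / η - 1 - κ) * η := by field_simp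
  rw [e, expKernel_ofReal_mul hη.ne' (by linarith), ofReal_re, le_div_iff₀ hη]
  refine le_trans ?_ (expKernelReal_ge (by linarith))
  rw [le_div_iff₀ (by linarith)]
  have : η * (1 / η) = 1 := by field_simp
  nlinarith [mul_nonneg hη.le hκ]

theorem symmCorrection_zero_right_le {η : ℝ} (hη : 0 < η) (hη1 : η ≤ 0.06) :
    symmCorrection η (0 ^ 2) ≤ 1 - 0.55 * η := by
  have e : ∀ a : ℝ, 0 < a → a / (a ^ 2 + 0 ^ 2) = 1 / a := fun a ha ↦ by
    field_simp
    ring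
  rw [symmCorrection, e _ (by linarith), e _ (by linarith), e _ (by linarith), e _ (by linarith)]
  have h1 : 1 / (1 + η) ≤ 1 - η + η ^ 2 := by
    rw [div_le_iff₀ (by linarith)]
    nlinarith [pow_pos hη 3]
  have h2 : 1 / (2 - η) ≤ 1 / 2 + η / 4 + 0.13 * η ^ 2 := by
    rw [div_le_iff₀ (by linarith)]
    nlinarith [pow_pos hη 3, pow_pos hη 2]
  have h3 : 2 / 3 - 4 / 9 * η ≤ 1 / (3 / 2 + η) := by
    rw [le_div_iff₀ (by linarith)]
    nlinarith [pow_pos hη 2]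
  have h4 : 2 / 5 + 4 / 25 * η ≤ 1 / (5 / 2 - η) := by
    rw [le_div_iff₀ (by linarith)]
    nlinarith [pow_pos hη 2]
  nlinarith

theorem digamma_two_sub_re_le : -1.1019 * (digamma ((2 : ℝ) : ℂ)).re +
    0.6122 * (digamma ((9 / 4 : ℝ) : ℂ)).re ≤ -0.09 := by
  have key : ∀ x : ℝ, 3 / 2 ≤ x →
      |(digamma (x : ℂ)).re - Real.log x + 1 / (2 * x)| ≤ 19 / 200 / x ^ 2 := fun x hx ↦ by
    have h := (norm_digamma_sub_le (z := (x : ℂ)) (by simpa using hx)).1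
    refine le_trans ?_ ((abs_re_le_norm _).trans h)
    rw [add_re, sub_re, ← ofReal_log (by linarith), ofReal_re,
      show (1 / (2 * (x : ℂ))) = ((1 / (2 * x) : ℝ) : ℂ) by push_cast; rfl, ofReal_re]
  have h1 := (abs_le.mp (key 2 (by norm_num))).1
  have h2 := (abs_le.mp (key (9 / 4) (by norm_num))).2
  have h3 := log_le_nat_mul_log_two_add (x := (3 / 2) ^ 12) (by norm_num) 7
  have h4 : Real.log (9 / 4) = 2 * Real.log (3 / 2) := by
    rw [show (9 / 4 : ℝ) = (3 / 2) ^ 2 by norm_num, Real.log_pow]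
    norm_num
  rw [Real.log_pow] at h3
  have h5 := Real.log_two_gt_d9
  rw [h4] at h2
  norm_num at h1 h2 h3 h5 ⊢
  linarith

theorem log_three_halves_le : Real.log (3 / 2) ≤ 0.40549 := by
  have h3 := log_le_nat_mul_log_two_add (x := (3 / 2) ^ 12) (by norm_num) 7
  rw [Real.log_pow] at h3
  norm_num at h3 ⊢
  linarith

theorem norm_digamma_low_le {d : ℂ} (hd0 : 0 ≤ d.re) (hd : ‖d‖ ≤ 0.6) :
    ‖digamma ((3 + d) / 2) - (Real.log (3 / 2) - 1 / 3 + 4 / 9 * d)‖ ≤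
      0.0423 + 0.1066 * ‖d‖ ^ 2 := by
  set z : ℂ := (3 + d) / 2 with hz
  have hzre : z.re = (3 + d.re) / 2 := by simp [hz]
  have h1 := (norm_digamma_sub_le (z := z) (by rw [hzre]; linarith)).1
  have h1' : 19 / 200 / z.re ^ 2 ≤ 0.0423 := by
    rw [hzre, div_le_iff₀ (by positivity)]
    nlinarith
  have hn3 : ‖d / 3‖ = ‖d‖ / 3 := by rw [norm_div]; simp
  have h2 := norm_log_one_add_sub_self_le (z := d / 3) (by rw [hn3]; linarith)
  rw [hn3] at h2
  have h2' : (‖d‖ / 3) ^ 2 * (1 - ‖d‖ / 3)⁻¹ / 2 ≤ 0.0695 * ‖d‖ ^ 2 := by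
    have : (1 - ‖d‖ / 3)⁻¹ ≤ 1.25 := by
      rw [inv_le_comm₀ (by linarith) (by norm_num)]
      norm_num
      linarith
    calc (‖d‖ / 3) ^ 2 * (1 - ‖d‖ / 3)⁻¹ / 2 ≤ (‖d‖ / 3) ^ 2 * 1.25 / 2 := by gcongr
      _ ≤ _ := by nlinarith [sq_nonneg ‖d‖]
  have hn : 3 ≤ ‖3 + d‖ := by
    refine le_trans ?_ (re_le_norm _)
    simp
    linarith
  have h3d : 3 + d ≠ 0 := by
    intro h
    rw [h, norm_zero] at hn
    linarith
  have h3 : ‖d ^ 2 / (9 * (3 + d))‖ ≤ ‖d‖ ^ 2 / 27 := by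
    rw [norm_div, norm_mul, norm_pow]
    simp only [Complex.norm_ofNat]
    gcongr
    linarith
  have hlog : log z = Real.log (3 / 2) + log (1 + d / 3) := by
    rw [← log_ofReal_mul (by norm_num)]
    · congr 1
      rw [hz]
      push_cast
      ring
    · intro h
      exact h3d (by linear_combination 3 * h)
  have e : digamma z - (Real.log (3 / 2) - 1 / 3 + 4 / 9 * d) =
      (digamma z - log z + 1 / (2 * z)) + (log (1 + d / 3) - d / 3) - d ^ 2 / (9 * (3 + d)) := by
    rw [hlog, show 2 * z = 3 + d by rw [hz]; ring]
    field_simp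
    ring
  rw [e]
  refine (norm_sub_le _ _).trans ?_
  have := norm_add_le (digamma z - log z + 1 / (2 * z)) (log (1 + d / 3) - d / 3)
  have h0 := sq_nonneg ‖d‖
  linarith

theorem norm_digamma_high_le {y m : ℝ} {b : ℂ} (hy : 20 ≤ y) (hb0 : 0 ≤ b.re)
    (hbi : |b.im| ≤ 0.6) (hm : ‖3 + b‖ ≤ m) (hm1 : m ≤ 4.5) :
    ‖digamma ((3 + b + y * I) / 2) - (Real.log (y / 2) + log I + (2 + b) / (y * I))‖ ≤
      0.0131 + m / 388 + (m / 20) ^ 2 / (1 - m / 20) / 2 := by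
  set z : ℂ := (3 + b + y * I) / 2 with hz
  have hzre : z.re = (3 + b.re) / 2 := by simp [hz]
  have hzim : z.im = (b.im + y) / 2 := by simp [hz]
  have hbi' := abs_le.mp hbi
  have hy0 : y ≠ 0 := by linarith
  have hyC : (y : ℂ) ≠ 0 := by exact_mod_cast hy0
  have hm0 : 0 ≤ m := (norm_nonneg _).trans hm
  have h1 := (norm_digamma_sub_le (z := z) (by rw [hzre]; linarith)).2
  have h1' : ‖digamma z - log z + 1 / (2 * z)‖ ≤ 0.0131 := by
    have h5 : 19 / 100 / z.re ≤ 19 / 100 / (3 / 2) := by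
      rw [hzre]
      gcongr
      linarith
    have h6 : 9.7 ≤ |z.im| := by
      refine le_trans ?_ (le_abs_self _)
      rw [hzim]
      linarith
    nlinarith [norm_nonneg (digamma z - log z + 1 / (2 * z))]
  set w : ℂ := (3 + b) / (y * I) with hw
  have hyI : ‖(y : ℂ) * I‖ = y := by
    rw [norm_mul, norm_I, mul_one, norm_real, Real.norm_eq_abs, abs_of_pos (by linarith)]
  have hwn : ‖w‖ ≤ m / 20 := by
    rw [hw, norm_div, hyI]
    gcongr
  have hw1 : ‖w‖ < 1 := by linarith
  have h2 := norm_log_one_add_sub_self_le hw1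
  have h2' : ‖w‖ ^ 2 * (1 - ‖w‖)⁻¹ / 2 ≤ (m / 20) ^ 2 / (1 - m / 20) / 2 := by
    rw [div_eq_mul_inv ((m / 20) ^ 2)]
    have : 0 < 1 - m / 20 := by linarith
    gcongr
  have hn : 19.4 ≤ ‖3 + b + y * I‖ := by
    refine le_trans ?_ ((le_abs_self _).trans (abs_im_le_norm _))
    simp
    linarith
  have h3d : 3 + b + y * I ≠ 0 := by
    intro h
    rw [h, norm_zero] at hn
    linarith
  have h3 : ‖(3 + b) / (y * I * (3 + b + y * I))‖ ≤ m / 388 := by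
    rw [norm_div, norm_mul, hyI]
    have : (388 : ℝ) ≤ y * ‖3 + b + y * I‖ := by nlinarith
    gcongr
  have hwre : 0 < (1 + w).re := by
    have := (abs_le.mp (abs_re_le_norm w)).1
    rw [add_re, one_re]
    linarith
  have hw0 : 1 + w ≠ 0 := fun h ↦ by rw [h, zero_re] at hwre; exact lt_irrefl _ hwre
  have hlog : log z = Real.log (y / 2) + (log I + log (1 + w)) := by
    have harg := abs_lt.mp ((abs_arg_lt_pi_div_two_iff).mpr (Or.inl hwre))
    rw [← (log_mul_eq_add_log_iff I_ne_zero hw0).mpr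
      (by rw [arg_I]; constructor <;> linarith [Real.pi_pos]),
      ← log_ofReal_mul (by linarith) (mul_ne_zero I_ne_zero hw0)]
    congr 1
    rw [hz, hw]
    push_cast
    field_simp
    ring
  have e : digamma z - (Real.log (y / 2) + log I + (2 + b) / (y * I)) =
      (digamma z - log z + 1 / (2 * z)) + (log (1 + w) - w) +
        (3 + b) / (y * I * (3 + b + y * I)) := by
    rw [hlog, show 2 * z = 3 + b + y * I by rw [hz]; ring, hw]
    field_simp
    ring
  rw [e]
  refine (norm_add_le _ _).trans ?_
  have := norm_add_le (digamma z - log z + 1 / (2 * z)) (log (1 + w) - w)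
  linarith

theorem norm_sum_expCoeff_mul_le {f : Fin 5 → ℂ} {E : Fin 5 → ℝ} (h : ∀ j, ‖f j‖ ≤ E j) :
    ‖∑ j, expCoeff j * f j‖ ≤ ∑ j, expCoeffBound j * E j := by
  refine norm_sum_le_of_le _ fun j _ ↦ ?_
  rw [norm_mul]
  exact mul_le_mul (norm_expCoeff_le j) (h j) (norm_nonneg _)
    ((norm_nonneg _).trans (norm_expCoeff_le j))

theorem sum_kerCoeff (l : ℝ) : ∑ j, kerCoeff l j = ((1 - 0.4897 * l : ℝ) : ℂ) := by
  rw [Fintype.sum_sum_type]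
  simp only [kerCoeff, Sum.elim_inl, Sum.elim_inr, sum_expCoeff, Fin.sum_univ_two,
    Matrix.cons_val_zero, Matrix.cons_val_one]
  push_cast
  ring

theorem kerTerm_eq (η κ l y : ℝ) :
    (∑ j, kerCoeff l j * (1 / (kerRate η κ j + y * I) - Real.log Real.pi / 2 +
      digamma ((3 + kerRate η κ j + y * I) / 2) / 2)).re =
    (ratKernel (kerCoeff l) (kerRate η κ) (y * I)).re - Real.log Real.pi / 2 * (1 - 0.4897 * l) +
      (∑ j, kerCoeff l j * digamma ((3 + kerRate η κ j + y * I) / 2)).re / 2 := by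
  have : ∑ j, kerCoeff l j * (1 / (kerRate η κ j + y * I) - Real.log Real.pi / 2 +
      digamma ((3 + kerRate η κ j + y * I) / 2) / 2) =
      ratKernel (kerCoeff l) (kerRate η κ) (y * I) -
      ((Real.log Real.pi / 2 : ℝ) : ℂ) * ((1 - 0.4897 * l : ℝ) : ℂ) +
      (∑ j, kerCoeff l j * digamma ((3 + kerRate η κ j + y * I) / 2)) / 2 := by
    rw [← sum_kerCoeff, ratKernel, Finset.mul_sum, Finset.sum_div, ← Finset.sum_sub_distrib,
      ← Finset.sum_add_distrib]
    refine Finset.sum_congr rfl fun j _ ↦ ?_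
    rw [add_comm (y * I)]
    push_cast
    ring
  rw [this, add_re, sub_re, ← ofReal_mul, ofReal_re, div_ofNat_re]

theorem norm_kerRate_inl_le {η κ : ℝ} (hη : 0 < η) (hη1 : η ≤ 0.06) (hκ : 0 ≤ κ) (hκ1 : κ ≤ 1)
    (j : Fin 5) : ‖(η : ℂ) * (expRate j - κ)‖ ≤ η * expRateBound j ∧
      ‖(η : ℂ) * (expRate j - κ)‖ ≤ 0.6 := by
  have h1 : ‖(η : ℂ) * (expRate j - κ)‖ ≤ η * expRateBound j := by
    rw [norm_mul, norm_real, Real.norm_eq_abs, abs_of_pos hη]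
    exact mul_le_mul_of_nonneg_left (norm_expRate_sub_le hκ hκ1 j) hη.le
  refine ⟨h1, h1.trans ?_⟩
  have : expRateBound j ≤ 9.434 := by fin_cases j <;> norm_num [expRateBound]
  nlinarith

theorem re_kerRate_inl_nonneg {η κ : ℝ} (hη : 0 < η) (hκ1 : κ ≤ 1) (j : Fin 5) :
    0 ≤ ((η : ℂ) * (expRate j - κ)).re := by
  rw [re_ofReal_mul, sub_re, expRate_re, ofReal_re]
  nlinarith

theorem re_ratKernel_kerCoeff_high_le {η κ l y : ℝ} (hη : 0 < η) (hη1 : η ≤ 0.06) (hκ : 0 ≤ κ)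
    (hκ1 : κ ≤ 1) (hl : 0 ≤ l) (hy : 20 ≤ y) :
    (ratKernel (kerCoeff l) (kerRate η κ) (y * I)).re ≤ 0.004 := by
  have hyC : (y : ℂ) ≠ 0 := by
    have : y ≠ 0 := by linarith
    exact_mod_cast this
  have hyI : ‖(y : ℂ) * I‖ = y := by
    rw [norm_mul, norm_I, mul_one, norm_real, Real.norm_eq_abs, abs_of_pos (by linarith)]
  have e : expKernel η (y * I - κ * η) = 1 / (y * I) -
      ∑ j, expCoeff j * (η * (expRate j - κ) / (y * I * (y * I + η * (expRate j - κ)))) := by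
    rw [show 1 / (y * I) = ∑ j, expCoeff j * (1 / (y * I)) by
      rw [← Finset.sum_mul, sum_expCoeff, one_mul], ← Finset.sum_sub_distrib, expKernel]
    refine Finset.sum_congr rfl fun j _ ↦ ?_
    rw [← mul_sub]
    have h0 : (y : ℂ) * I + η * (expRate j - κ) ≠ 0 := fun h ↦ by
      have h1 := (norm_kerRate_inl_le hη hη1 hκ hκ1 j).2
      rw [← neg_eq_of_add_eq_zero_right h, norm_neg, hyI] at h1
      linarith
    rw [show (y : ℂ) * I - κ * η + η * expRate j = y * I + η * (expRate j - κ) by ring]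
    congr 1
    field_simp
    ring
  have hb := norm_sum_expCoeff_mul_le (E := fun j ↦ η * expRateBound j / 388)
    (f := fun j ↦ η * (expRate j - κ) / (y * I * (y * I + η * (expRate j - κ)))) fun j ↦ by
      obtain ⟨h1, h2⟩ := norm_kerRate_inl_le hη hη1 hκ hκ1 j
      have h3 : 19.4 ≤ ‖(y : ℂ) * I + η * (expRate j - κ)‖ := by
        have := norm_sub_le ((y : ℂ) * I + η * (expRate j - κ)) (η * (expRate j - κ))
        rw [add_sub_cancel_right, hyI] at this
        linarith
      rw [norm_div, norm_mul (y * I : ℂ), hyI]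
      have : (388 : ℝ) ≤ y * ‖(y : ℂ) * I + η * (expRate j - κ)‖ := by nlinarith
      gcongr
      exact (norm_nonneg _).trans h1
  have hb' : ∑ j, expCoeffBound j * (η * expRateBound j / 388) ≤ 0.004 := by
    simp [Fin.sum_univ_five, expCoeffBound, expRateBound]
    linarith
  have hre := (abs_le.mp ((abs_re_le_norm _).trans (hb.trans hb'))).1
  have e1 : ∀ r : ℝ, (1 / (y * I + (r : ℂ))).re = r / (r ^ 2 + y ^ 2) := fun r ↦ by
    rw [one_div, inv_re, normSq_apply]
    simp
    ring
  have e2 := e1 1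
  have e3 := e1 (3 / 2)
  push_cast at e2 e3
  have e4 : (1 / ((y : ℂ) * I)).re = 0 := by simp
  rw [ratKernel_kerCoeff, e, sub_re, sub_re, e4, re_ofReal_mul, sub_re, re_ofReal_mul,
    re_ofReal_mul, e2, e3]
  have hW : 0.6122 * (3 / 2 / ((3 / 2) ^ 2 + y ^ 2)) ≤ 1.1019 * (1 / (1 ^ 2 + y ^ 2)) := by
    rw [← mul_div_assoc 0.6122, ← mul_div_assoc 1.1019, div_le_div_iff₀ (by positivity) (by positivity)]
    nlinarith [sq_nonneg y]
  nlinarith [mul_nonneg hl (sub_nonneg.mpr hW)]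

theorem kerTerm_high_le {η κ l y : ℝ} (hη : 0 < η) (hη1 : η ≤ 0.06) (hκ : 0 ≤ κ)
    (hκ1 : κ ≤ 1) (hl : 0 ≤ l) (hl1 : l ≤ 1) (hy : 20 ≤ y) :
    (∑ j, kerCoeff l j * (1 / (kerRate η κ j + y * I) - Real.log Real.pi / 2 +
      digamma ((3 + kerRate η κ j + y * I) / 2) / 2)).re ≤
    0.004 - 0.572 * (1 - 0.4897 * l) + ((1 - 0.4897 * l) * Real.log (y / 2) + 0.275) / 2 := by
  have h1 := re_ratKernel_kerCoeff_high_le hη hη1 hκ hκ1 hl hy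
  have h2 := log_pi_gt
  set P : ℂ := Real.log (y / 2) + log I with hP
  have hC := norm_sum_expCoeff_mul_le (E := fun _ ↦ 0.0422)
    (f := fun j ↦ digamma ((3 + η * (expRate j - κ) + y * I) / 2) -
      (P + (2 + η * (expRate j - κ)) / (y * I))) fun j ↦ by
      have h3 := (norm_kerRate_inl_le hη hη1 hκ hκ1 j).2
      refine (norm_digamma_high_le (m := 3.6) hy (re_kerRate_inl_nonneg hη hκ1 j)
        ((abs_im_le_norm _).trans h3) ?_ (by norm_num)).trans (by norm_num)
      refine (norm_add_le _ _).trans ?_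
      rw [Complex.norm_ofNat]
      linarith
  have hC' : ∑ j, expCoeffBound j * 0.0422 ≤ 0.1753 := by
    simp [Fin.sum_univ_five, expCoeffBound]
    norm_num
  have hW : ∀ r : ℝ, 0 ≤ r → r ≤ 1.5 → ‖digamma ((3 + r + y * I) / 2) -
      (P + (2 + r) / (y * I))‖ ≤ 0.0575 := fun r h0 h1 ↦ by
    refine (norm_digamma_high_le (m := 4.5) hy (by simpa using h0) (by norm_num) ?_ le_rfl).trans
      (by norm_num)
    refine (norm_add_le _ _).trans ?_
    rw [Complex.norm_ofNat, norm_real, Real.norm_eq_abs, abs_of_nonneg h0]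
    linarith
  have hW1 := hW 1 (by norm_num) (by norm_num)
  have hW2 := hW (3 / 2) (by norm_num) (by norm_num)
  have hsum : ∑ j, kerCoeff l j * digamma ((3 + kerRate η κ j + y * I) / 2) =
      (1 - 0.4897 * l : ℝ) * P +
      ((2 * (1 - 0.4897 * l) - κ * η - 0.1836 * l : ℝ) : ℂ) * (1 / (y * I)) +
      ((∑ j, expCoeff j * (digamma ((3 + η * (expRate j - κ) + y * I) / 2) -
        (P + (2 + η * (expRate j - κ)) / (y * I)))) +
      ((-1.1019 * l : ℝ) * (digamma ((3 + (1 : ℝ) + y * I) / 2) -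
        (P + (2 + (1 : ℝ)) / (y * I))) +
       (0.6122 * l : ℝ) * (digamma ((3 + (3 / 2 : ℝ) + y * I) / 2) -
        (P + (2 + (3 / 2 : ℝ)) / (y * I))))) := by
    have e : ∑ j, expCoeff j * (digamma ((3 + η * (expRate j - κ) + y * I) / 2) -
        (P + (2 + η * (expRate j - κ)) / (y * I))) =
        ∑ j, expCoeff j * digamma ((3 + η * (expRate j - κ) + y * I) / 2) -
        (P + (2 - κ * η) / (y * I)) := by
      have : P + (2 - κ * η) / (y * I) = (∑ j, expCoeff j) * (P + (2 - κ * η) / (y * I)) +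
          (∑ j, expCoeff j * expRate j) * (η / (y * I)) := by
        rw [sum_expCoeff, sum_expCoeff_mul_expRate]; ring
      rw [this, Finset.sum_mul, Finset.sum_mul, ← Finset.sum_add_distrib,
        ← Finset.sum_sub_distrib]
      refine Finset.sum_congr rfl fun j _ ↦ ?_
      ring
    rw [e, Fintype.sum_sum_type]
    simp only [kerCoeff, kerRate, Sum.elim_inl, Sum.elim_inr, Fin.sum_univ_two,
      Matrix.cons_val_zero, Matrix.cons_val_one]
    push_cast
    ring
  have hPre : P.re = Real.log (y / 2) := by
    rw [hP, add_re, ofReal_re, log_re]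
    simp
  have hyre : (1 / ((y : ℂ) * I)).re = 0 := by simp
  have b1 := (abs_le.mp ((abs_re_le_norm _).trans (hC.trans hC'))).2
  have b2 := (abs_le.mp ((abs_re_le_norm _).trans hW1)).1
  have b3 := (abs_le.mp ((abs_re_le_norm _).trans hW2)).2
  have hψ : (∑ j, kerCoeff l j * digamma ((3 + kerRate η κ j + y * I) / 2)).re ≤
      (1 - 0.4897 * l) * Real.log (y / 2) + 0.275 := by
    rw [hsum, add_re, add_re, add_re, add_re, re_ofReal_mul, re_ofReal_mul, re_ofReal_mul,
      re_ofReal_mul, hPre, hyre]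
    nlinarith [mul_le_mul_of_nonneg_left b2 hl, mul_le_mul_of_nonneg_left b3 hl]
  rw [kerTerm_eq]
  nlinarith

theorem kerTerm_low_le {η κ l : ℝ} (hη : 0 < η) (hη1 : η ≤ 0.06) (hκ : 0 ≤ κ)
    (hκ1 : κ ≤ 1) (hl : 0 ≤ l) (hl1 : l ≤ 1) :
    (∑ j, kerCoeff l j * (1 / (kerRate η κ j + (0 : ℝ) * I) - Real.log Real.pi / 2 +
      digamma ((3 + kerRate η κ j + (0 : ℝ) * I) / 2) / 2)).re ≤
    expKernelReal (-κ) / η - 0.6937 * l - 0.572 * (1 - 0.4897 * l) + (0.307 - 0.09 * l) / 2 := by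
  have h1 : (ratKernel (kerCoeff l) (kerRate η κ) ((0 : ℝ) * I)).re ≤
      expKernelReal (-κ) / η - 0.6937 * l := by
    have e : expKernel η ((0 : ℝ) * I - κ * η) = ((expKernelReal (-κ) / η : ℝ) : ℂ) := by
      rw [← expKernel_ofReal_mul hη.ne' (by linarith)]
      congr 1
      push_cast
      ring
    have e2 : (1.1019 : ℝ) * (1 / (((0 : ℝ) : ℂ) * I + 1)) - (0.6122 : ℝ) *
        (1 / (((0 : ℝ) : ℂ) * I + 3 / 2)) = ((1.1019 - 0.6122 * (2 / 3) : ℝ) : ℂ) := by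
      push_cast
      norm_num
    rw [ratKernel_kerCoeff, e, e2, ← ofReal_mul, ← ofReal_sub, ofReal_re]
    linarith
  have h2 := log_pi_gt
  have hC := norm_sum_expCoeff_mul_le (E := fun j ↦ 0.0423 + 0.1066 * (0.06 * expRateBound j) ^ 2)
    (f := fun j ↦ digamma ((3 + η * (expRate j - κ)) / 2) -
      (Real.log (3 / 2) - 1 / 3 + 4 / 9 * (η * (expRate j - κ)))) fun j ↦ by
      obtain ⟨h3, h4⟩ := norm_kerRate_inl_le hη hη1 hκ hκ1 j
      refine (norm_digamma_low_le (re_kerRate_inl_nonneg hη hκ1 j) h4).trans ?_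
      have h5 : 0 ≤ expRateBound j := (norm_nonneg _).trans (norm_expRate_sub_le hκ hκ1 j)
      gcongr
      exact h3.trans (mul_le_mul_of_nonneg_right hη1 h5)
  have hC' : ∑ j, expCoeffBound j * (0.0423 + 0.1066 * (0.06 * expRateBound j) ^ 2) ≤ 0.2347 := by
    simp [Fin.sum_univ_five, expCoeffBound, expRateBound]
    norm_num
  have hsum : ∑ j, kerCoeff l j * digamma ((3 + kerRate η κ j + (0 : ℝ) * I) / 2) =
      (Real.log (3 / 2) - 1 / 3 - 4 / 9 * κ * η : ℝ) +
      ((∑ j, expCoeff j * (digamma ((3 + η * (expRate j - κ)) / 2) -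
        (Real.log (3 / 2) - 1 / 3 + 4 / 9 * (η * (expRate j - κ))))) +
      ((-1.1019 * l : ℝ) * digamma ((2 : ℝ) : ℂ) +
       (0.6122 * l : ℝ) * digamma ((9 / 4 : ℝ) : ℂ))) := by
    have e : ∑ j, expCoeff j * (digamma ((3 + η * (expRate j - κ)) / 2) -
        (Real.log (3 / 2) - 1 / 3 + 4 / 9 * (η * (expRate j - κ)))) =
        ∑ j, expCoeff j * digamma ((3 + η * (expRate j - κ)) / 2) -
        (Real.log (3 / 2) - 1 / 3 - 4 / 9 * κ * η : ℝ) := by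
      have : ((Real.log (3 / 2) - 1 / 3 - 4 / 9 * κ * η : ℝ) : ℂ) =
          (∑ j, expCoeff j) * (Real.log (3 / 2) - 1 / 3 - 4 / 9 * κ * η) +
          (∑ j, expCoeff j * expRate j) * (4 / 9 * η) := by
        rw [sum_expCoeff, sum_expCoeff_mul_expRate]; push_cast; ring
      rw [this, Finset.sum_mul, Finset.sum_mul, ← Finset.sum_add_distrib,
        ← Finset.sum_sub_distrib]
      refine Finset.sum_congr rfl fun j _ ↦ ?_
      ring
    have a1 : (3 + ((1 : ℝ) : ℂ)) / 2 = ((2 : ℝ) : ℂ) := by push_cast; ring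
    have a2 : (3 + ((3 / 2 : ℝ) : ℂ)) / 2 = ((9 / 4 : ℝ) : ℂ) := by push_cast; ring
    have a3 : ∀ z : ℂ, (3 + z + (0 : ℝ) * I) / 2 = (3 + z) / 2 := fun z ↦ by push_cast; ring
    rw [e, Fintype.sum_sum_type]
    simp only [kerCoeff, kerRate, Sum.elim_inl, Sum.elim_inr, Fin.sum_univ_two,
      Matrix.cons_val_zero, Matrix.cons_val_one, a3, a1, a2]
    ring
  have b1 := (abs_le.mp ((abs_re_le_norm _).trans (hC.trans hC'))).2
  have b2 := digamma_two_sub_re_le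
  have hψ : (∑ j, kerCoeff l j * digamma ((3 + kerRate η κ j + (0 : ℝ) * I) / 2)).re ≤
      0.307 - 0.09 * l := by
    rw [hsum, add_re, add_re, add_re, re_ofReal_mul, re_ofReal_mul, ofReal_re]
    have h3 := log_three_halves_le
    have h4 := mul_le_mul_of_nonneg_left b2 hl
    have h5 := mul_nonneg hκ hη.le
    norm_num at b1 h3 h4 ⊢
    linarith
  rw [kerTerm_eq]
  nlinarith

theorem symmKernel_kerCoeff_real_ge {η κ l : ℝ} (hη : 0 < η) (hη1 : η ≤ 0.06) (hκ : 0 ≤ κ)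
    (hκ1 : κ ≤ 1) (hl : 0 ≤ l) :
    expKernelReal (1 - κ) / η + 1 - l * (1 - 0.55 * η) ≤
      symmKernel (kerCoeff l) (kerRate η κ) (η : ℂ) := by
  have e1 : (η : ℂ) - κ * η = (((1 - κ) * η : ℝ) : ℂ) := by push_cast; ring
  have e2 : 1 - conj (η : ℂ) - κ * η = ((1 - η - κ * η : ℝ) : ℂ) := by
    rw [conj_ofReal]; push_cast; ring
  have h1 := one_le_re_expKernel hη hη1 hκ hκ1
  have h2 := mul_le_mul_of_nonneg_left (symmCorrection_zero_right_le hη hη1) hl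
  rw [symmKernel_kerCoeff, e2, e1, expKernel_ofReal_mul hη.ne' (by linarith), ofReal_re, ofReal_re,
    ofReal_im]
  linarith

theorem twenty_le_of_three_le_log {γ : ℝ} (hγ : 0 < γ) (hL : 3 ≤ Real.log γ) : 20 ≤ γ := by
  rw [Real.le_log_iff_exp_le hγ] at hL
  refine le_trans ?_ hL
  have h := Real.exp_one_gt_d9
  rw [show (3 : ℝ) = (3 : ℕ) * 1 by norm_num, Real.exp_nat_mul]
  nlinarith [sq_nonneg (Real.exp 1 - 2.7182818283)]

theorem zero_inequality {ρ : ℂ} {κ l : ℝ} (h0 : riemannXi ρ = 0) (hη0 : 0 < 1 - ρ.re)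
    (hη1 : 1 - ρ.re ≤ 0.06) (hγ : 0 < ρ.im) (hL : 3 ≤ Real.log ρ.im) (hκ : 0 ≤ κ) (hκ1 : κ ≤ 1)
    (hl : 0 ≤ l) (hl1 : l ≤ 1)
    (hpos : ∀ k : ℕ, k < 5 → ∀ z, riemannXi z = 0 →
      0 ≤ symmKernel (kerCoeff l) (kerRate (1 - ρ.re) κ) (1 + k * ρ.im * I - z)) :
    (2.391424 * expKernelReal (1 - κ) - 1.40277304 * expKernelReal (-κ)) * (1 / (1 - ρ.re)) +
        2.391424 * (1 - l * (1 - 0.55 * (1 - ρ.re))) ≤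
      1.40277304 * (-0.6937 * l - 0.572 * (1 - 0.4897 * l) + (0.307 - 0.09 * l) / 2) +
      4.574274 * (0.1415 - 0.572 * (1 - 0.4897 * l)) +
      (1 - 0.4897 * l) / 2 * (4.574274 * Real.log ρ.im - 1.329) := by
  set η := 1 - ρ.re with hη
  set γ := ρ.im
  have h20 := twenty_le_of_three_le_log hγ hL
  have h := cosCoeff_one_mul_symmKernel_le (kerRate_re_pos hη0 hκ1) (kernel_sum_exp_im η κ l)
    (fun _ ↦ kernel_sum_exp_nonneg hη0 hη1 hκ hl1) h0 (by intro h; linarith) hpos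
  have hS := symmKernel_kerCoeff_real_ge hη0 hη1 hκ hκ1 hl
  rw [← hη] at h
  have hk := fun k : ℕ ↦ kerTerm_high_le (y := k * γ) hη0 hη1 hκ hκ1 hl hl1
  have hk0 := kerTerm_low_le hη0 hη1 hκ hκ1 hl hl1
  have hk1 := hk 1 (by push_cast; linarith)
  have hk2 := hk 2 (by push_cast; linarith)
  have hk3 := hk 3 (by push_cast; linarith)
  have hk4 := hk 4 (by push_cast; linarith)
  push_cast at hk0 hk1 hk2 hk3 hk4 h
  simp only [Finset.sum_range_succ, Finset.sum_range_zero, zero_add, cosCoeff] at h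
  push_cast at h
  simp only [zero_mul, show ρ.im = γ from rfl] at h hk0
  have l2 := Real.log_two_gt_d9
  have l2' := Real.log_two_lt_d9
  have l3 := log_three_halves_le
  have q0 : 0 ≤ 1 - 0.4897 * l := by linarith
  have m1 : Real.log (1 * γ / 2) ≤ Real.log γ - 0.6931 := by
    rw [Real.log_div (by linarith) (by norm_num), one_mul]
    linarith
  have m2 : Real.log (2 * γ / 2) = Real.log γ := by
    congr 1; ring
  have m3 : Real.log (3 * γ / 2) ≤ Real.log γ + 0.4055 := by
    rw [show 3 * γ / 2 = γ * (3 / 2) by ring, Real.log_mul (by linarith) (by norm_num)]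
    linarith
  have m4 : Real.log (4 * γ / 2) ≤ Real.log γ + 0.6932 := by
    rw [show 4 * γ / 2 = γ * 2 by ring, Real.log_mul (by linarith) (by norm_num)]
    linarith
  have n1 := mul_le_mul_of_nonneg_left m1 q0
  have n2 := mul_le_mul_of_nonneg_left m2.le q0
  have n3 := mul_le_mul_of_nonneg_left m3 q0
  have n4 := mul_le_mul_of_nonneg_left m4 q0
  have d1 := div_eq_mul_one_div (expKernelReal (1 - κ)) η
  have d2 := div_eq_mul_one_div (expKernelReal (-κ)) η
  have e : (2.391424 * expKernelReal (1 - κ) - 1.40277304 * expKernelReal (-κ)) * (1 / η) =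
      2.391424 * (expKernelReal (1 - κ) / η) - 1.40277304 * (expKernelReal (-κ) / η) := by
    rw [d1, d2]; ring
  rw [e]
  generalize expKernelReal (1 - κ) / η = X1 at *
  generalize expKernelReal (-κ) / η = X2 at *
  nlinarith

theorem expKernelReal_values :
    0.19636 ≤ 2.391424 * expKernelReal (1 - 0) - 1.40277304 * expKernelReal (-0) ∧
    0.2163 ≤ 2.391424 * expKernelReal (1 - 0.8) - 1.40277304 * expKernelReal (-0.8) := by
  norm_num [expKernelReal]

theorem zero_inequality_zero {ρ : ℂ} (h0 : riemannXi ρ = 0) (hη0 : 0 < 1 - ρ.re)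
    (hη1 : 1 - ρ.re ≤ 0.06) (hγ : 0 < ρ.im) (hL : 3 ≤ Real.log ρ.im) :
    0.19636 * (1 / (1 - ρ.re)) + 17.6 * (1 - ρ.re) + 2.25 ≤
      1.16714 * Real.log ρ.im + 5.602 * ((1 - ρ.re) * Real.log ρ.im) := by
  have h := zero_inequality (κ := 0) (l := 1 - 5 * (1 - ρ.re)) h0 hη0 hη1 hγ hL le_rfl zero_le_one
    (by linarith) (by linarith) fun k _ z hz ↦ by
      obtain ⟨h1, h2⟩ := re_mem_Ioo_of_riemannXi_eq_zero hz
      refine symmKernel_kerCoeff_nonneg hη0 le_rfl zero_le_one (by linarith) (by norm_num) ?_ ?_ ?_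
      · nlinarith [pow_pos hη0 2]
      · simp
        linarith
      · simp
        linarith
  set η := 1 - ρ.re
  have hm : 0.19636 * (1 / η) ≤ _ := mul_le_mul_of_nonneg_right expKernelReal_values.1
    (one_div_pos.mpr hη0).le
  have h' := hm.trans (le_sub_iff_add_le.mpr h)
  nlinarith [mul_pos hη0 hη0]

theorem one_lt_of_log_im_le_sixteen {ρ : ℂ} (h0 : riemannXi ρ = 0) (hγ : 0 < ρ.im)
    (hL : 3 ≤ Real.log ρ.im) (hL' : Real.log ρ.im ≤ 16) :
    1 < (1 - ρ.re) * (5.558691 * Real.log ρ.im) := by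
  by_contra! hc
  have hη0 : 0 < 1 - ρ.re := sub_pos.mpr (re_mem_Ioo_of_riemannXi_eq_zero h0).2
  have hη1 : 1 - ρ.re ≤ 0.06 := by nlinarith
  have h := zero_inequality_zero h0 hη0 hη1 hγ hL
  set η := 1 - ρ.re
  have hX : 5.558691 * Real.log ρ.im ≤ 1 / η := by
    rw [le_div_iff₀ hη0]
    linarith
  rcases le_total η 0.0107 with h1 | h1
  · have hX' : 93 ≤ 1 / η := by
      rw [le_div_iff₀ hη0]
      linarith
    linarith
  · linarith

theorem one_lt_six_mul_of_three_le_log {ρ : ℂ} (h0 : riemannXi ρ = 0) (hγ : 0 < ρ.im)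
    (hL : 3 ≤ Real.log ρ.im) : 1 < (1 - ρ.re) * (6 * Real.log ρ.im) := by
  by_contra! hc
  have hη0 : 0 < 1 - ρ.re := sub_pos.mpr (re_mem_Ioo_of_riemannXi_eq_zero h0).2
  have hη1 : 1 - ρ.re ≤ 0.06 := by nlinarith
  have h := zero_inequality_zero h0 hη0 hη1 hγ hL
  have hX : 6 * Real.log ρ.im ≤ 1 / (1 - ρ.re) := by
    rw [le_div_iff₀ hη0]
    linarith
  linarith

/-- A zero with real part close to `1` has a large imaginary part. -/
theorem five_mul_le_abs_im {ρ : ℂ} {η γ : ℝ} (h0 : riemannXi ρ = 0) (hη0 : 0 < η) (hγ : 0 < γ)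
    (hL : 16 ≤ Real.log γ) (hη : η * (5.558691 * Real.log γ) ≤ 1) (hρ : 1 - ρ.re ≤ 0.8 * η) :
    5 * γ ≤ |ρ.im| := by
  wlog him : 0 ≤ ρ.im generalizing ρ
  · have := this (ρ := conj ρ) (by rw [riemannXi_conj, h0, map_zero]) (by simpa using hρ)
      (by rw [conj_im]; linarith)
    rwa [conj_im, abs_neg] at this
  rw [abs_of_nonneg him]
  have hη1 : η ≤ 0.0113 := by nlinarith
  have h2 := two_lt_abs_im_of_riemannXi_eq_zero h0 (by intro h; linarith)
  rw [abs_of_nonneg him] at h2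
  have hl0 : 0 ≤ Real.log ρ.im := Real.log_nonneg (by linarith)
  have hη' : 0 ≤ 1 - ρ.re := by
    linarith [(re_mem_Ioo_of_riemannXi_eq_zero h0).2]
  have hL3 : 3 < Real.log ρ.im := by
    by_contra! h3
    refine riemannXi_ne_zero_of_log_im_le_three h2.le h3 (by linarith) ?_ h0
    nlinarith
  have h6 := one_lt_six_mul_of_three_le_log h0 (by linarith) hL3.le
  have h7 : 1 < η * (4.8 * Real.log ρ.im) := by nlinarith
  have h8 : 5.558691 * Real.log γ < 4.8 * Real.log ρ.im := by
    by_contra! h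
    nlinarith
  have h5 : Real.log (5 * γ) = Real.log 5 + Real.log γ := Real.log_mul (by norm_num) hγ.ne'
  have h9 := log_le_nat_mul_log_two_add (x := 5) (by norm_num) 2
  rw [← Real.log_le_log_iff (by linarith) (by linarith), h5]
  norm_num at h9
  linarith

theorem ten_le_abs_im_sub {ρ : ℂ} {η γ : ℝ} {k : ℕ} (hk : k < 5) (h0 : riemannXi ρ = 0)
    (hη0 : 0 < η) (hγ : 0 < γ) (hL : 16 ≤ Real.log γ) (hη : η * (5.558691 * Real.log γ) ≤ 1)
    (hρ : 1 - ρ.re ≤ 0.8 * η) : 10 ≤ |k * γ - ρ.im| := by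
  have h1 := five_mul_le_abs_im h0 hη0 hγ hL hη hρ
  have h2 := twenty_le_of_three_le_log hγ (by linarith)
  have h3 : |(k : ℝ) * γ| ≤ 4 * γ := by
    rw [abs_of_nonneg (by positivity)]
    gcongr
    exact_mod_cast Nat.lt_succ_iff.mp hk
  have h4 := abs_sub_abs_le_abs_sub ρ.im (k * γ)
  rw [abs_sub_comm] at h4
  linarith

theorem one_lt_of_sixteen_le_log_im {ρ : ℂ} (h0 : riemannXi ρ = 0) (hγ : 0 < ρ.im)
    (hL : 16 ≤ Real.log ρ.im) : 1 < (1 - ρ.re) * (5.558691 * Real.log ρ.im) := by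
  by_contra! hc
  have hη0 : 0 < 1 - ρ.re := sub_pos.mpr (re_mem_Ioo_of_riemannXi_eq_zero h0).2
  have hη1 : 1 - ρ.re ≤ 0.0113 := by nlinarith
  have h := zero_inequality (κ := 0.8) (l := 1 - 7 * (1 - ρ.re)) h0 hη0 (by linarith) hγ
    (by linarith) (by norm_num) (by norm_num) (by linarith) (by linarith) fun k hk z hz ↦ by
      have hten : ∀ w, riemannXi w = 0 → 1 - w.re ≤ 0.8 * (1 - ρ.re) →
          0 ≤ symmKernel (kerCoeff (1 - 7 * (1 - ρ.re))) (kerRate (1 - ρ.re) 0.8)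
            (1 + k * ρ.im * I - w) := fun w hw hw1 ↦ by
        refine symmKernel_kerCoeff_nonneg_of_ten_le_im hη0 hη1 rfl ?_ ?_ ?_
        · have := (re_mem_Ioo_of_riemannXi_eq_zero hw).2
          simp
          linarith
        · simpa using hw1
        · simpa using ten_le_abs_im_sub hk hw hη0 hγ hL hc hw1
      by_cases hz1 : 1 - z.re ≤ 0.8 * (1 - ρ.re)
      · exact hten z hz hz1
      by_cases hz2 : z.re ≤ 0.8 * (1 - ρ.re)
      · rw [← symmKernel_one_sub_conj]
        have := hten (1 - conj z) (by rw [riemannXi_one_sub, riemannXi_conj, hz, map_zero])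
          (by simpa using hz2)
        convert this using 2
        simp
        ring
      push Not at hz1 hz2
      refine symmKernel_kerCoeff_nonneg hη0 (by norm_num) (by norm_num) (by linarith) (by linarith)
        ?_ ?_ ?_
      · nlinarith [pow_pos hη0 2]
      · simp
        linarith
      · simp
        linarith
  set η := 1 - ρ.re
  have hm : 0.2163 * (1 / η) ≤ _ := mul_le_mul_of_nonneg_right expKernelReal_values.2
    (one_div_pos.mpr hη0).le
  have h' := hm.trans (le_sub_iff_add_le.mpr h)
  have hX : 5.558691 * Real.log ρ.im ≤ 1 / η := by
    rw [le_div_iff₀ hη0]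
    linarith
  nlinarith [mul_pos hη0 hη0]

theorem riemannXi_ne_zero_of_mul_log_im_le {ρ : ℂ} (hγ : 2 ≤ ρ.im)
    (hη : (1 - ρ.re) * (5.558691 * Real.log ρ.im) ≤ 1) : riemannXi ρ ≠ 0 := by
  intro h0
  have hl2 := Real.log_two_gt_d9
  have hL2 : Real.log 2 ≤ Real.log ρ.im := Real.log_le_log (by norm_num) hγ
  rcases le_total (Real.log ρ.im) 3 with hL | hL
  · exact riemannXi_ne_zero_of_log_im_le_three hγ hL (by nlinarith) hη h0
  rcases le_total (Real.log ρ.im) 16 with hL' | hL'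
  · exact absurd (one_lt_of_log_im_le_sixteen h0 (by linarith) hL hL') (by linarith)
  · exact absurd (one_lt_of_sixteen_le_log_im h0 (by linarith) hL') (by linarith)

theorem stmt16 (t β : ℝ) (ht : 2 ≤ |t|)
    (hβ : 1 - 1 / (5.558691 * Real.log |t|) ≤ β) :
    riemannZeta ((β : ℂ) + (t : ℂ) * Complex.I) ≠ 0 := by
  intro hζ
  have hl2 := Real.log_two_gt_d9
  have hL2 : Real.log 2 ≤ Real.log |t| := Real.log_le_log (by norm_num) ht
  have hη : (1 - β) * (5.558691 * Real.log |t|) ≤ 1 := by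
    rw [← le_div_iff₀ (by linarith)]
    linarith
  have hβ0 : 0 < β := by nlinarith
  have hξ : riemannXi ((β : ℂ) + t * I) = 0 := by
    rw [riemannXi_eq (by simpa using hβ0), hζ, mul_zero, mul_zero]
    intro h
    have := congrArg im h
    simp at this
    norm_num [this] at ht
  rcases abs_cases t with ⟨h, -⟩ | ⟨h, -⟩ <;> rw [h] at ht hη
  · exact riemannXi_ne_zero_of_mul_log_im_le (ρ := (β : ℂ) + t * I) (by simpa using ht)
      (by simpa using hη) hξ
  · refine riemannXi_ne_zero_of_mul_log_im_le (ρ := conj ((β : ℂ) + t * I)) (by simpa using ht)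
      (by simpa using hη) ?_
    rw [riemannXi_conj, hξ, map_zero]
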